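/- arXiv:2310.02495 — 8 statements merged into one kernel-verified Lean document; each statement's English description precedes it below -/
import Mathlib

section
/- Let k ≥ 2 and let q be a prime power, and suppose c is a positive real constant with k·c < ζ_q(k). Then for all sufficiently large n there exists a monic polynomial F ∈ F_q[x] of degree at most n such that for every positive integer h satisfying q^{h+1} ≤ c·n/log_q(n), the interval I_q(F,h) contains no k-free polynomial. -/
open Polynomial

/-- A polynomial is `k`-power-free if no `k`-th power of an irreducible divides it. -/
def Polynomial.IsPowFree {F : Type*} [Field F] (k : ℕ) (Q : F[X]) : Prop :=
  ∀ P : F[X], Irreducible P → ¬ P ^ k ∣ Q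

namespace Polynomial

variable {F : Type*} [Field F]

open UniqueFactorizationMonoid in
theorem IsPowFree.count_normalizedFactors_lt [DecidableEq F] [DecidableEq F[X]] {k : ℕ}
    (hk : 0 < k) {b : F[X]}
    (hb : IsPowFree k b) (hb0 : b ≠ 0) (p : F[X]) : (normalizedFactors b).count p < k := by
  by_contra! h
  have hp : p ∈ normalizedFactors b := Multiset.count_pos.mp (hk.trans_le h)
  have hirr := irreducible_of_normalized_factor p hp
  refine hb p hirr ?_
  rw [pow_dvd_iff_le_emultiplicity, emultiplicity_eq_count_normalizedFactors hirr hb0,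
    normalize_normalized_factor p hp]
  exact_mod_cast h

open UniqueFactorizationMonoid in
theorem eq_of_pow_mul_eq_pow_mul {k : ℕ} (hk : 0 < k) {a a' b b' : F[X]} (ha : a.Monic)
    (ha' : a'.Monic) (hb : IsPowFree k b) (hb' : IsPowFree k b') (hb0 : b ≠ 0) (hb0' : b' ≠ 0)
    (h : a ^ k * b = a' ^ k * b') : a = a' := by
  classical
  refine eq_of_monic_of_associated ha ha' ?_
  rw [associated_iff_normalizedFactors_eq_normalizedFactors ha.ne_zero ha'.ne_zero]
  ext p
  have h1 := congrArg (fun f => (normalizedFactors f).count p) h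
  simp only [normalizedFactors_mul (pow_ne_zero k ha.ne_zero) hb0,
    normalizedFactors_mul (pow_ne_zero k ha'.ne_zero) hb0', normalizedFactors_pow,
    Multiset.count_add, Multiset.count_nsmul] at h1
  have h2 := congrArg (· / k) h1
  simp only [Nat.mul_add_div hk] at h2
  rwa [Nat.div_eq_of_lt (hb.count_normalizedFactors_lt hk hb0 p),
    Nat.div_eq_of_lt (hb'.count_normalizedFactors_lt hk hb0' p)] at h2

theorem exists_monic_irreducible_pow_dvd {k : ℕ} {Q : F[X]} (h : ¬ IsPowFree k Q) :
    ∃ P : F[X], P.Monic ∧ Irreducible P ∧ P ^ k ∣ Q := by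
  classical
  simp only [IsPowFree, not_forall, not_not] at h
  obtain ⟨P, hP, hd⟩ := h
  have hassoc : Associated (normalize P) P := normalize_associated P
  exact ⟨normalize P, monic_normalize hP.ne_zero, hassoc.symm.irreducible hP,
    (hassoc.pow_pow).dvd.trans hd⟩

theorem exists_eq_pow_mul_isPowFree {k : ℕ} (hk : 0 < k) (f : F[X]) (hf : f ≠ 0) :
    ∃ a b : F[X], a.Monic ∧ IsPowFree k b ∧ f = a ^ k * b := by
  induction hn : f.natDegree using Nat.strong_induction_on generalizing f with
  | _ n ih =>
    by_cases h : IsPowFree k f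
    · exact ⟨1, f, monic_one, h, by simp⟩
    · obtain ⟨P, hPm, hP, g, rfl⟩ := exists_monic_irreducible_pow_dvd h
      have hg : g ≠ 0 := right_ne_zero_of_mul hf
      have hlt : g.natDegree < n := by
        rw [← hn, natDegree_mul (pow_ne_zero _ hPm.ne_zero) hg, natDegree_pow]
        have := Nat.mul_pos hk hP.natDegree_pos
        omega
      obtain ⟨a, b, ha, hb, rfl⟩ := ih _ hlt g hg rfl
      exact ⟨P * a, b, hPm.mul ha, hb, by ring⟩

theorem finite_degree_lt [Finite F] (n : ℕ) : {f : F[X] | f.degree < n}.Finite := by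
  have : Finite (degreeLT F n) := Finite.of_equiv _ (degreeLTEquiv F n).symm.toEquiv
  refine Set.Finite.subset (Set.toFinite (degreeLT F n : Set F[X])) fun f hf => ?_
  exact mem_degreeLT.mpr hf

theorem ncard_degree_lt [Finite F] (n : ℕ) : {f : F[X] | f.degree < n}.ncard = Nat.card F ^ n := by
  have h : {f : F[X] | f.degree < n} = (degreeLT F n : Set F[X]) := by
    ext f; simp [mem_degreeLT]
  rw [h, ← Nat.card_coe_set_eq]
  change Nat.card (degreeLT F n) = _
  rw [Nat.card_congr (degreeLTEquiv F n).toEquiv, Nat.card_fun]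
  simp

theorem card_le_ncard_not_isPowFree [Finite F] {k : ℕ} (hk : 0 < k) (m : ℕ) :
    Nat.card F * Nat.card F ^ (m - k) ≤
      {f : F[X] | f.degree < m ∧ f ≠ 0 ∧ ¬ IsPowFree k f}.ncard + Nat.card F := by
  classical
  choose! a b ha hb hab using fun (f : F[X]) (hf : f ≠ 0) => exists_eq_pow_mul_isPowFree hk f hf
  have hb0 : ∀ f : F[X], f ≠ 0 → b f ≠ 0 := fun f hf h0 => hf (by rw [hab f hf, h0, mul_zero])
  have hmon : ∀ f : F[X], f ≠ 0 → ∀ t : F, (X * a f + C t).Monic ∧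
      (X * a f + C t).natDegree = (a f).natDegree + 1 := by
    intro f hf t
    have hd : (X * a f).natDegree = (a f).natDegree + 1 := by
      rw [monic_X.natDegree_mul (ha f hf), natDegree_X, add_comm]
    have hm : (X * a f).Monic := monic_X.mul (ha f hf)
    refine ⟨hm.add_of_left ?_, by rw [natDegree_add_C, hd]⟩
    refine degree_C_le.trans_lt ?_
    rw [degree_eq_natDegree hm.ne_zero, hd]
    exact_mod_cast Nat.succ_pos _
  set S : Set F[X] := {f | f.degree < (m - k : ℕ)} \ {0}
  set φ : F[X] × F → F[X] := fun x => (X * a x.1 + C x.2) ^ k * b x.1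
  have hS : S.Finite := (finite_degree_lt _).sdiff
  have hScard : S.ncard + 1 = Nat.card F ^ (m - k) := by
    rw [← ncard_degree_lt]
    exact Set.ncard_sdiff_singleton_add_one (by simp) (finite_degree_lt _)
  have hle : (S ×ˢ (Set.univ : Set F)).ncard ≤
      {f : F[X] | f.degree < m ∧ f ≠ 0 ∧ ¬ IsPowFree k f}.ncard := by
    refine Set.ncard_le_ncard_of_injOn φ ?_ ?_ ((finite_degree_lt m).subset fun f hf => hf.1)
    · rintro ⟨f, t⟩ ⟨⟨hf, hf0 : f ≠ 0⟩, -⟩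
      obtain ⟨h1, h2⟩ := hmon f hf0 t
      have hne : φ (f, t) ≠ 0 := mul_ne_zero (pow_ne_zero _ h1.ne_zero) (hb0 f hf0)
      refine ⟨?_, hne, ?_⟩
      · have hf' : f.natDegree < m - k := (natDegree_lt_iff_degree_lt hf0).mpr hf
        rw [← natDegree_lt_iff_degree_lt hne]
        have e1 : (φ (f, t)).natDegree = k * ((a f).natDegree + 1) + (b f).natDegree := by
          simp only [φ]
          rw [natDegree_mul (pow_ne_zero _ h1.ne_zero) (hb0 f hf0), natDegree_pow, h2]
        have e2 : f.natDegree = k * (a f).natDegree + (b f).natDegree := by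
          conv_lhs => rw [hab f hf0]
          rw [natDegree_mul (pow_ne_zero _ (ha f hf0).ne_zero) (hb0 f hf0), natDegree_pow]
        rw [e1, mul_add]
        omega
      · intro hfree
        obtain ⟨P, hP, hd⟩ := exists_irreducible_of_natDegree_pos
          (f := X * a f + C t) (by omega)
        exact hfree P hP ((pow_dvd_pow_of_dvd hd k).mul_right _)
    · rintro ⟨f, t⟩ ⟨⟨-, hf0 : f ≠ 0⟩, -⟩ ⟨g, s⟩ ⟨⟨-, hg0 : g ≠ 0⟩, -⟩ h
      have h' : (X * a f + C t) ^ k * b f = (X * a g + C s) ^ k * b g := h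
      have h1 := eq_of_pow_mul_eq_pow_mul hk (hmon f hf0 t).1 (hmon g hg0 s).1 (hb f hf0)
        (hb g hg0) (hb0 f hf0) (hb0 g hg0) h'
      have hts : t = s := by simpa using congrArg (coeff · 0) h1
      subst hts
      have haeq : a f = a g := mul_left_cancel₀ X_ne_zero (add_right_cancel h1)
      have hbeq : b f = b g := by
        rw [haeq] at h'
        exact mul_left_cancel₀ (pow_ne_zero _ (hmon g hg0 t).1.ne_zero) h'
      have hfg : f = g := by rw [hab f hf0, hab g hg0, haeq, hbeq]
      rw [hfg]
  rw [Set.ncard_prod, Set.ncard_univ] at hle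
  calc Nat.card F * Nat.card F ^ (m - k) = S.ncard * Nat.card F + Nat.card F := by
        rw [← hScard]; ring
    _ ≤ _ := by gcongr

theorem ncard_isPowFree_add_le [Finite F] {k : ℕ} (hk : 0 < k) (m : ℕ) :
    {f : F[X] | f.degree < m ∧ (f = 0 ∨ IsPowFree k f)}.ncard + Nat.card F * Nat.card F ^ (m - k) ≤
      Nat.card F ^ m + Nat.card F := by
  have h1 := card_le_ncard_not_isPowFree (F := F) hk m
  have hfin := finite_degree_lt (F := F) m
  have h2 : {f : F[X] | f.degree < m ∧ (f = 0 ∨ IsPowFree k f)}.ncard +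
      {f : F[X] | f.degree < m ∧ f ≠ 0 ∧ ¬ IsPowFree k f}.ncard = Nat.card F ^ m := by
    rw [← ncard_degree_lt, ← Set.ncard_union_eq _ (hfin.subset fun f hf => hf.1)
      (hfin.subset fun f hf => hf.1)]
    · congr 1
      ext f
      simp only [Set.mem_union, Set.mem_ofPred_eq]
      tauto
    · rw [Set.disjoint_left]
      rintro f ⟨-, hf⟩ ⟨-, h0, h⟩
      tauto
  omega

theorem exists_finset_irreducible [Finite F] {d : ℕ} (hd : 0 < d) :
    ∃ T : Finset F[X], (∀ P ∈ T, P.Monic ∧ Irreducible P ∧ P.natDegree ≤ d) ∧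
      Nat.card F ^ d ≤ d * T.card := by
  classical
  obtain ⟨p, _⟩ := CharP.exists F
  have : Fact p.Prime := ⟨CharP.char_is_prime F p⟩
  have : NeZero d := ⟨hd.ne'⟩
  set K := FiniteField.Extension F p d
  have : Fintype K := Fintype.ofFinite K
  have hdeg : ∀ x : K, (minpoly F x).natDegree ≤ d := fun x => by
    simpa [K, FiniteField.finrank_extension] using minpoly.natDegree_le (A := F) x
  have hint : ∀ x : K, IsIntegral F x := fun x => Algebra.IsIntegral.isIntegral x
  refine ⟨Finset.univ.image (fun x : K => minpoly F x), ?_, ?_⟩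
  · simp only [Finset.mem_image, Finset.mem_univ, true_and]
    rintro _ ⟨x, rfl⟩
    exact ⟨minpoly.monic (hint x), minpoly.irreducible (hint x), hdeg x⟩
  · have hc : Nat.card F ^ d = (Finset.univ : Finset K).card := by
      rw [← FiniteField.natCard_extension F p d, Finset.card_univ, Nat.card_eq_fintype_card]
    rw [hc]
    refine Finset.card_le_mul_card_image _ _ ?_
    simp only [Finset.mem_image, Finset.mem_univ, true_and]
    rintro _ ⟨x, rfl⟩
    calc _ ≤ ((minpoly F x).aroots K).toFinset.card := by
          refine Finset.card_le_card fun y hy => ?_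
          have hy' : minpoly F y = minpoly F x := by simpa using hy
          rw [Multiset.mem_toFinset, mem_aroots]
          exact ⟨minpoly.ne_zero (hint x), by rw [← hy']; exact minpoly.aeval F y⟩
      _ ≤ ((minpoly F x).aroots K).card := Multiset.toFinset_card_le _
      _ ≤ ((minpoly F x).map (algebraMap F K)).natDegree := card_roots' _
      _ ≤ d := by rw [natDegree_map]; exact hdeg x

/-- Chinese remainder theorem for `k`-th powers of distinct monic irreducibles. -/
theorem exists_monic_pow_dvd_sub (k : ℕ) (T : Finset F[X])
    (hT : ∀ P ∈ T, P.Monic ∧ Irreducible P) (r : F[X] → F[X]) :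
    ∃ f : F[X], f.Monic ∧ f.natDegree = ∑ P ∈ T, k * P.natDegree ∧ ∀ P ∈ T, P ^ k ∣ f - r P := by
  have hcop : Pairwise (Function.onFun IsCoprime
      fun P : T => Ideal.span {(P : F[X]) ^ k}) := by
    intro P Q hPQ
    rw [Function.onFun, Ideal.isCoprime_span_singleton_iff]
    refine IsCoprime.pow ?_
    rw [(hT P P.2).2.coprime_iff_not_dvd]
    intro hd
    refine hPQ (Subtype.ext (eq_of_monic_of_associated (hT P P.2).1 (hT Q Q.2).1 ?_))
    exact (hT P P.2).2.associated_of_dvd (hT Q Q.2).2 hd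
  obtain ⟨g, hg⟩ := Ideal.exists_forall_sub_mem_ideal hcop fun P => r P
  set M := ∏ P ∈ T, P ^ k
  have hM : M.Monic := monic_prod_of_monic _ _ fun P hP => (hT P hP).1.pow k
  have hlt : (g %ₘ M).degree < M.degree := degree_modByMonic_lt _ hM
  refine ⟨M + g %ₘ M, hM.add_of_left hlt, ?_, fun P hP => ?_⟩
  · rw [natDegree_add_eq_left_of_degree_lt hlt,
      natDegree_prod_of_monic _ _ fun P hP => (hT P hP).1.pow k]
    simp [natDegree_pow]
  · have h1 : P ^ k ∣ M := Finset.dvd_prod_of_mem (fun P => P ^ k) hP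
    have h2 : P ^ k ∣ g - r P := Ideal.mem_span_singleton.mp (hg ⟨P, hP⟩)
    have h3 : M + g %ₘ M - r P = (g - r P) + M * (1 - g /ₘ M) := by
      linear_combination modByMonic_add_div g M
    rw [h3]
    exact dvd_add h2 (h1.mul_right _)

/-- If the irreducibles of degree at most `d` suffice to hit every `k`-free polynomial of degree
at most `H` once, then some short interval contains no `k`-free polynomial. -/
theorem exists_monic_forall_exists_pow_dvd [Finite F] {k d H R n : ℕ} (hk : 0 < k) (hd : 0 < d)
    (hR : {f : F[X] | f.degree < (H + 1 : ℕ) ∧ (f = 0 ∨ IsPowFree k f)}.ncard ≤ R)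
    (hcard : d * (R + Nat.card F ^ (H / k + 1)) ≤ Nat.card F ^ d)
    (hdeg : k * (d * R + H * Nat.card F ^ (H / k + 1)) ≤ n) :
    ∃ f : F[X], f.Monic ∧ f.natDegree ≤ n ∧ ∀ Q : F[X], (f - Q).degree ≤ H →
      ∃ P : F[X], Irreducible P ∧ P ^ k ∣ Q := by
  classical
  set B : Set F[X] := {f | f.degree < (H + 1 : ℕ) ∧ (f = 0 ∨ IsPowFree k f)}
  have hBfin : B.Finite := (finite_degree_lt _).subset fun f hf => hf.1
  have hSfin := finite_degree_lt (F := F) (H / k + 1)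
  set S : Finset F[X] := hSfin.toFinset.filter fun P => P.Monic ∧ Irreducible P
  have hScard : S.card ≤ Nat.card F ^ (H / k + 1) := by
    rw [← ncard_degree_lt, Set.ncard_eq_toFinset_card _ hSfin]
    exact Finset.card_filter_le _ _
  obtain ⟨T, hT, hTcard⟩ := exists_finset_irreducible (F := F) hd
  have hTS : hBfin.toFinset.card ≤ (T \ S).card := by
    rw [← Set.ncard_eq_toFinset_card _ hBfin]
    have h1 : R + Nat.card F ^ (H / k + 1) ≤ T.card :=
      Nat.le_of_mul_le_mul_left (hcard.trans hTcard) hd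
    have h2 := Finset.le_card_sdiff S T
    omega
  obtain ⟨U, hU, hUcard⟩ := Finset.exists_subset_card_eq hTS
  let e : U ≃ hBfin.toFinset := Finset.equivOfCardEq hUcard
  have hSU : ∀ P ∈ S ∪ U, P.Monic ∧ Irreducible P := by
    intro P hP
    rcases Finset.mem_union.mp hP with h | h
    · exact (Finset.mem_filter.mp h).2
    · have := hT P (Finset.mem_sdiff.mp (hU h)).1
      exact ⟨this.1, this.2.1⟩
  obtain ⟨f, hfm, hfd, hf⟩ := exists_monic_pow_dvd_sub k (S ∪ U) hSU
    fun P => if h : P ∈ U then -(e ⟨P, h⟩ : F[X]) else 0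
  refine ⟨f, hfm, ?_, fun Q hQ => ?_⟩
  · rw [hfd, ← Finset.mul_sum]
    refine le_trans (Nat.mul_le_mul_left k ?_) hdeg
    have hdisj : Disjoint S U := by
      rw [Finset.disjoint_right]
      exact fun P hP => (Finset.mem_sdiff.mp (hU hP)).2
    rw [Finset.sum_union hdisj, add_comm]
    refine add_le_add ?_ ?_
    · refine (Finset.sum_le_card_nsmul _ _ d fun P hP =>
        (hT P (Finset.mem_sdiff.mp (hU hP)).1).2.2).trans ?_
      rw [smul_eq_mul, mul_comm]
      refine Nat.mul_le_mul_left d ?_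
      rw [hUcard, ← Set.ncard_eq_toFinset_card _ hBfin]
      exact hR
    · refine (Finset.sum_le_card_nsmul _ _ H fun P hP => ?_).trans ?_
      · obtain ⟨hP, -, hirr⟩ := Finset.mem_filter.mp hP
        have hP' : P.degree < (H / k + 1 : ℕ) := by simpa using hP
        rw [← natDegree_lt_iff_degree_lt hirr.ne_zero] at hP'
        exact (Nat.lt_succ_iff.mp hP').trans (Nat.div_le_self _ _)
      · rw [smul_eq_mul, mul_comm]
        exact Nat.mul_le_mul_left H hScard
  · have hdegG : (Q - f).degree < (H + 1 : ℕ) := by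
      rw [← degree_neg, neg_sub]
      exact hQ.trans_lt (by exact_mod_cast Nat.lt_succ_self H)
    by_cases hG : Q - f ∈ B
    · obtain ⟨⟨P, hPU⟩, hP⟩ := e.surjective ⟨Q - f, hBfin.mem_toFinset.mpr hG⟩
      have h1 := hf P (Finset.mem_union_right _ hPU)
      rw [dif_pos hPU, hP] at h1
      exact ⟨P, (hSU P (Finset.mem_union_right _ hPU)).2, by simpa using h1⟩
    · have hG' : Q - f ≠ 0 ∧ ¬ IsPowFree k (Q - f) := by
        rw [← not_or]
        exact fun h => hG ⟨hdegG, h⟩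
      obtain ⟨P, hPm, hP, hPd⟩ := exists_monic_irreducible_pow_dvd hG'.2
      have hle := natDegree_le_of_dvd hPd hG'.1
      rw [natDegree_pow] at hle
      rw [← natDegree_lt_iff_degree_lt hG'.1] at hdegG
      have hPS : P ∈ S := by
        refine Finset.mem_filter.mpr ⟨?_, hPm, hP⟩
        rw [Set.Finite.mem_toFinset, Set.mem_ofPred_eq, ← natDegree_lt_iff_degree_lt hP.ne_zero,
          Nat.lt_succ_iff, Nat.le_div_iff_mul_le hk, mul_comm]
        omega
      have h1 := hf P (Finset.mem_union_left _ hPS)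
      have hPU : P ∉ U := fun h => (Finset.mem_sdiff.mp (hU h)).2 hPS
      rw [dif_neg hPU, sub_zero] at h1
      refine ⟨P, hP, ?_⟩
      simpa using dvd_add hPd h1

end Polynomial

open Filter Topology in
theorem eventually_mul_logb_add_one_mul_le {b a k : ℝ} (hb : 1 < b) (hak : k * a < 1) :
    ∀ᶠ x : ℝ in atTop,
      k * (Real.logb b x + 1) * (a * x / Real.logb b x + b + b * √x) ≤ x := by
  have hL : Tendsto (Real.logb b) atTop atTop := Real.tendsto_logb_atTop hb
  have hinv : Tendsto (fun x => (Real.logb b x)⁻¹) atTop (𝓝 0) := hL.inv_tendsto_atTop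
  have hs : Tendsto (fun x : ℝ => (√x)⁻¹) atTop (𝓝 0) :=
    Real.tendsto_sqrt_atTop.inv_tendsto_atTop
  have ht : Tendsto (fun x : ℝ => (Real.logb b x + 1) * (√x)⁻¹) atTop (𝓝 0) := by
    have h1 : Tendsto (fun x : ℝ => Real.log x / √x) atTop (𝓝 0) := by
      simpa [Real.sqrt_eq_rpow] using
        (isLittleO_log_rpow_atTop (r := 1 / 2) (by norm_num)).tendsto_div_nhds_zero
    have h2 := (h1.div_const (Real.log b)).add hs
    simp only [zero_div, add_zero] at h2
    refine h2.congr fun x => ?_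
    rw [Real.logb]
    ring
  have hlim : Tendsto (fun x : ℝ => k * a * (1 + (Real.logb b x)⁻¹) +
      k * b * ((Real.logb b x + 1) * (√x)⁻¹) * ((√x)⁻¹ + 1)) atTop (𝓝 (k * a)) := by
    have h := ((hinv.const_add 1).const_mul (k * a)).add
      ((ht.const_mul (k * b)).mul (hs.add_const 1))
    simpa using h
  filter_upwards [hlim.eventually_lt_const hak, hL.eventually_gt_atTop 0, eventually_gt_atTop 0]
    with x hx hLx hx0
  have hsq : √x ≠ 0 := (Real.sqrt_pos.mpr hx0).ne'
  have hxx : √x * √x = x := Real.mul_self_sqrt hx0.le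
  have key : k * (Real.logb b x + 1) * (a * x / Real.logb b x + b + b * √x) =
      (k * a * (1 + (Real.logb b x)⁻¹) +
        k * b * ((Real.logb b x + 1) * (√x)⁻¹) * ((√x)⁻¹ + 1)) * x := by
    have hsx : (√x)⁻¹ * (√x)⁻¹ * x = 1 := by
      rw [← mul_inv, hxx, inv_mul_cancel₀ hx0.ne']
    have hsx' : (√x)⁻¹ * x = √x := by
      rw [inv_mul_eq_iff_eq_mul₀ hsq, hxx]
    have hLL : Real.logb b x * (Real.logb b x)⁻¹ = 1 := mul_inv_cancel₀ hLx.ne'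
    rw [div_eq_mul_inv]
    linear_combination (k * a * x) * hLL - (k * b * (Real.logb b x + 1)) * (hsx + hsx')
  rw [key]
  nlinarith

/-- **Theorem 1 (Erdős-type gaps).** Let `k ≥ 2`, `q` a prime power (the cardinality of a
finite field `Fq`), and `c > 0` a real constant with `k·c < ζ_q(k) = (1 - q^{1-k})⁻¹`.
Then for all sufficiently large `n` there is a monic `F ∈ Fq[x]` of degree at most `n`
such that for every positive `h` with `q^{h+1} ≤ c·n/log_q n`, the interval
`I_q(F,h)` contains no `k`-free polynomial. -/
theorem erdos_gaps_kfree_polynomials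
    {Fq : Type} [Field Fq] [Fintype Fq] (q k : ℕ) (hq : Fintype.card Fq = q)
    (hk : 2 ≤ k) (c : ℝ) (hc : 0 < c)
    (hck : (k : ℝ) * c < (1 - (q : ℝ) ^ (1 - (k : ℤ)))⁻¹) :
    ∃ N : ℕ, ∀ n : ℕ, N ≤ n →
      ∃ F : Polynomial Fq, F.Monic ∧ F.natDegree ≤ n ∧
        ∀ h : ℕ, 0 < h →
          (q : ℝ) ^ (h + 1) ≤ c * n / (Real.log n / Real.log q) →
          ∀ Q : Polynomial Fq, (F - Q).degree ≤ (h : WithBot ℕ) →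
            ∃ P : Polynomial Fq, Irreducible P ∧ P ^ k ∣ Q := by
  classical
  have hq1 : 1 < q := hq ▸ Fintype.one_lt_card
  have hqR : (1 : ℝ) < q := by exact_mod_cast hq1
  have hqN : Nat.card Fq = q := by rw [Nat.card_eq_fintype_card, hq]
  set A : ℝ := 1 - (q : ℝ) ^ (1 - (k : ℤ)) with hA
  have hApos : 0 < A := inv_pos.mp (lt_trans (by positivity) hck)
  have hAq : A = 1 - q / (q : ℝ) ^ k := by
    rw [hA, zpow_sub₀ (by positivity), zpow_one, zpow_natCast]
  have hkac : (k : ℝ) * (A * c) < 1 := by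
    have := mul_lt_mul_of_pos_right hck hApos
    rw [inv_mul_cancel₀ hApos.ne'] at this
    linarith
  have hev := (eventually_mul_logb_add_one_mul_le hqR hkac).and
    (((Real.tendsto_logb_atTop hqR).eventually_ge_atTop c).and (Filter.eventually_gt_atTop 0))
  obtain ⟨N, hN⟩ := Filter.eventually_atTop.mp (tendsto_natCast_atTop_atTop.eventually hev)
  refine ⟨N, fun n hn => ?_⟩
  obtain ⟨hmain, hcL, hn0⟩ := hN n hn
  set L := Real.logb q n
  have hLpos : 0 < L := hc.trans_le hcL
  change ∃ F : Fq[X], F.Monic ∧ F.natDegree ≤ n ∧ ∀ h : ℕ, 0 < h →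
    (q : ℝ) ^ (h + 1) ≤ c * n / L → _
  have hbound : ∀ h : ℕ, (q : ℝ) ^ (h + 1) ≤ c * n / L → (q : ℝ) ^ (h + 1) ≤ n := fun h hh =>
    hh.trans <| (div_le_iff₀ hLpos).mpr (by rw [mul_comm]; gcongr)
  have hlen : ∀ h : ℕ, (q : ℝ) ^ (h + 1) ≤ c * n / L → h ≤ n := fun h hh => by
    have h1 : q ^ (h + 1) ≤ n := by exact_mod_cast hbound h hh
    have h2 := Nat.lt_pow_self (n := h + 1) hq1
    omega
  by_cases hex : ∃ h : ℕ, (q : ℝ) ^ (h + 1) ≤ c * n / L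
  swap
  · exact ⟨1, monic_one, by simp, fun h _ hh => (hex ⟨h, hh⟩).elim⟩
  set H := Nat.findGreatest (fun h : ℕ => (q : ℝ) ^ (h + 1) ≤ c * n / L) n
  have hH : (q : ℝ) ^ (H + 1) ≤ c * n / L := by
    obtain ⟨h, hh⟩ := hex
    exact Nat.findGreatest_spec (P := fun h : ℕ => (q : ℝ) ^ (h + 1) ≤ c * n / L) (hlen h hh) hh
  have hHn := hbound H hH
  have hHL : (H : ℝ) ≤ L := by
    have h1 := (Real.le_logb_iff_rpow_le hqR hn0 (x := ((H + 1 : ℕ) : ℝ))).mpr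
      (by rw [Real.rpow_natCast]; exact hHn)
    push_cast at h1
    linarith
  set d := ⌈L⌉₊
  have hd : 0 < d := Nat.ceil_pos.mpr hLpos
  have hdL : (d : ℝ) ≤ L + 1 := (Nat.ceil_lt_add_one hLpos.le).le
  have hqd : (n : ℝ) ≤ (q : ℝ) ^ d := by
    rw [← Real.rpow_natCast, ← Real.logb_le_iff_le_rpow hqR hn0]
    exact Nat.le_ceil L
  have hD : (q : ℝ) ^ (H / k + 1) ≤ q * √n := by
    rw [pow_succ']
    gcongr
    refine Real.le_sqrt_of_sq_le ?_
    rw [← pow_mul]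
    refine (pow_le_pow_right₀ hqR.le ?_).trans hHn
    have := Nat.div_mul_le_self H k
    nlinarith [Nat.zero_le (H / k)]
  set R := {f : Fq[X] | f.degree < (H + 1 : ℕ) ∧ (f = 0 ∨ Polynomial.IsPowFree k f)}.ncard
  have hRle : (R : ℝ) ≤ A * c * n / L + q := by
    have h1 : R + q * q ^ (H + 1 - k) ≤ q ^ (H + 1) + q := by
      have := Polynomial.ncard_isPowFree_add_le (F := Fq) (k := k) (by omega) (H + 1)
      rwa [hqN] at this
    have h2 : (R : ℝ) + q * q ^ (H + 1 - k) ≤ q ^ (H + 1) + q := by exact_mod_cast h1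
    have h3 : (q : ℝ) ^ (H + 1) / q ^ k ≤ q ^ (H + 1 - k) := by
      rw [div_le_iff₀ (by positivity), ← pow_add]
      exact pow_le_pow_right₀ hqR.le (by omega)
    have h4 : A * (q : ℝ) ^ (H + 1) ≤ A * (c * n / L) := by gcongr
    have h5 : (q : ℝ) * (q ^ (H + 1) / q ^ k) ≤ q * q ^ (H + 1 - k) := by gcongr
    have h6 : A * (q : ℝ) ^ (H + 1) = q ^ (H + 1) - q * (q ^ (H + 1) / q ^ k) := by
      rw [hAq]; ring
    have h7 : A * c * n / L = A * (c * n / L) := by ring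
    linarith
  have hk1 : (1 : ℝ) ≤ k := by exact_mod_cast (by omega : 1 ≤ k)
  have htot : (k : ℝ) * ((L + 1) * (R + q ^ (H / k + 1))) ≤ n := by
    refine le_trans ?_ hmain
    rw [← mul_assoc]
    gcongr
  have hcard : d * (R + Nat.card Fq ^ (H / k + 1)) ≤ Nat.card Fq ^ d := by
    rw [hqN]
    have h1 : (d : ℝ) * (R + q ^ (H / k + 1)) ≤ q ^ d := by
      refine le_trans ?_ hqd
      calc _ ≤ (L + 1) * ((R : ℝ) + q ^ (H / k + 1)) := by gcongr
        _ ≤ k * ((L + 1) * ((R : ℝ) + q ^ (H / k + 1))) :=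
          le_mul_of_one_le_left (by positivity) hk1
        _ ≤ n := htot
    exact_mod_cast h1
  have hdeg : k * (d * R + H * Nat.card Fq ^ (H / k + 1)) ≤ n := by
    rw [hqN]
    have h1 : (k : ℝ) * (d * R + H * q ^ (H / k + 1)) ≤ n := by
      refine le_trans ?_ htot
      rw [mul_add (L + 1)]
      gcongr
      linarith
    exact_mod_cast h1
  obtain ⟨F, hF, hFd, hFQ⟩ :=
    exists_monic_forall_exists_pow_dvd (F := Fq) (by omega) hd le_rfl hcard hdeg
  have hle : ∀ h : ℕ, (q : ℝ) ^ (h + 1) ≤ c * n / L → h ≤ H := fun h hh =>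
    Nat.le_findGreatest (P := fun h : ℕ => (q : ℝ) ^ (h + 1) ≤ c * n / L) (hlen h hh) hh
  exact ⟨F, hF, hFd, fun h _ hh Q hQ => hFQ Q (hQ.trans (by exact_mod_cast hle h hh))⟩
end

section
/- Let k ≥ 2 and let q be a power of the prime p. Write the base-p representation k = d·p^a + d_{a−1}p^{a−1} + ⋯ + d_1·p + d_0 with 0 ≤ d_i < p and leading digit d = d_a ≠ 0 (so a = ⌊log_p k⌋ and d = ⌊k/p^a⌋), and set θ = 1 − (p − d + 1)/p^{a+1}. Then for all sufficiently large n: for every monic polynomial F ∈ F_q[x] of degree n and every integer h with 0 < h < n satisfying q^{h+1} > (n/log_q(n))^{1/θ}, the interval I_q(F,h) contains a k-free polynomial. -/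
open Polynomial

section Counting

variable {K : Type*} [Field K]

/-- The polynomials `P` in a finite set of monic irreducibles of degree `m` over a field with
`q` elements satisfy the Gauss bound `m * #S ≤ q ^ m`. -/
lemma mul_card_irreducible_le [Fintype K] {S : Finset K[X]} {m : ℕ} (hm : m ≠ 0)
    (hS : ∀ P ∈ S, P.Monic ∧ Irreducible P ∧ P.natDegree = m) :
    m * S.card ≤ Fintype.card K ^ m := by
  have hne : (X ^ Fintype.card K ^ m - X : K[X]) ≠ 0 :=
    FiniteField.X_pow_card_pow_sub_X_ne_zero _ hm Fintype.one_lt_card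
  have hdvd : ∏ P ∈ S, P ∣ (X ^ Fintype.card K ^ m - X : K[X]) := by
    refine Finset.prod_dvd_of_coprime (fun P hP Q hQ hPQ ↦ ?_) fun P hP ↦ ?_
    · obtain ⟨hPm, hPi, -⟩ := hS P hP
      obtain ⟨hQm, hQi, -⟩ := hS Q hQ
      refine (hPi.coprime_iff_not_dvd).2 fun h ↦ hPQ ?_
      exact eq_of_monic_of_associated hPm hQm (hPi.associated_of_dvd hQi h)
    · obtain ⟨-, hPi, hPd⟩ := hS P hP
      rw [← Nat.card_eq_fintype_card]
      exact hPi.natDegree_dvd_iff_dvd_X_pow_card_pow_sub_X.1 (hPd ▸ dvd_rfl)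
  have hle := natDegree_le_of_dvd hdvd hne
  rw [FiniteField.X_pow_card_pow_sub_X_natDegree_eq _ hm Fintype.one_lt_card,
    natDegree_prod_of_monic _ _ fun P hP ↦ (hS P hP).1,
    Finset.sum_congr rfl fun P hP ↦ (hS P hP).2.2] at hle
  simpa [mul_comm] using hle

/-- In an interval of length `q ^ L`, at most `q ^ (L - deg R)` polynomials are multiples
of `R`. -/
lemma card_multiples_le [Fintype K] [DecidableEq K] {L : ℕ} (F : K[X]) {R : K[X]}
    {s : Finset (Fin L → K)} (hs : ∀ v ∈ s, R ∣ F + ofFn L v) :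
    s.card ≤ Fintype.card K ^ (L - R.natDegree) := by
  have hinj : Set.InjOn
      (fun (v : Fin L → K) (j : Fin (L - R.natDegree)) ↦ v ⟨R.natDegree + j, by omega⟩) s := by
    intro v hv w hw hvw
    by_contra hne
    have hsub : ofFn L v - ofFn L w ≠ 0 := fun h ↦ hne (injective_ofFn L (sub_eq_zero.1 h))
    have hdvd : R ∣ ofFn L v - ofFn L w := by
      simpa using dvd_sub (hs v hv) (hs w hw)
    refine absurd (degree_le_of_dvd hdvd hsub) (not_le.2 ?_)
    have hR : R ≠ 0 := by rintro rfl; exact hsub (zero_dvd_iff.1 hdvd)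
    rw [degree_eq_natDegree hR, degree_lt_iff_coeff_zero]
    intro i hi
    rw [coeff_sub]
    by_cases hiL : i < L
    · have := congrFun hvw ⟨i - R.natDegree, by omega⟩
      simp only [Nat.add_sub_cancel' hi] at this
      rw [ofFn_coeff_eq_val_of_lt v hiL, ofFn_coeff_eq_val_of_lt w hiL, this, sub_self]
    · rw [ofFn_coeff_eq_zero_of_ge v (by omega), ofFn_coeff_eq_zero_of_ge w (by omega), sub_self]
  calc s.card ≤ (Finset.univ : Finset (Fin (L - R.natDegree) → K)).card :=
        Finset.card_le_card_of_injOn _ (fun _ _ ↦ Finset.mem_univ _) hinj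
    _ = _ := by simp

end Counting

section ComponentDerivative

variable {K : Type*} [Field K]

/-- Write `Q = ∑_{i < N} x ^ i * Q_i(x ^ N)`. Then `componentDerivative N r Q` is the `r`-th
derivative of the last component `Q_{N - 1}`. -/
noncomputable def componentDerivative (N r : ℕ) (Q : K[X]) : K[X] :=
  derivative^[r] (contract N (X * Q)).divX

lemma coeff_componentDerivative {N : ℕ} (hN : N ≠ 0) (r : ℕ) (Q : K[X]) (j : ℕ) :
    (componentDerivative N r Q).coeff j =
      ((j + r).descFactorial r : K) * Q.coeff ((j + r + 1) * N - 1) := by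
  obtain ⟨i, hi⟩ : ∃ i, (j + r + 1) * N = i + 1 :=
    Nat.exists_eq_succ_of_ne_zero (by positivity)
  rw [componentDerivative, coeff_iterate_derivative, coeff_divX, coeff_contract hN, hi,
    coeff_X_mul, nsmul_eq_mul, Nat.add_sub_cancel]

lemma componentDerivative_sub {N : ℕ} (hN : N ≠ 0) (r : ℕ) (Q R : K[X]) :
    componentDerivative N r (Q - R) = componentDerivative N r Q - componentDerivative N r R := by
  ext j
  simp only [coeff_sub, coeff_componentDerivative hN, mul_sub]

lemma mul_natDegree_componentDerivative_le {N : ℕ} (hN : N ≠ 0) (r : ℕ) (Q : K[X]) :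
    N * (componentDerivative N r Q).natDegree ≤ Q.natDegree := by
  by_cases h0 : componentDerivative N r Q = 0
  · simp [h0]
  have hc := mt leadingCoeff_eq_zero.1 h0
  rw [leadingCoeff, coeff_componentDerivative hN] at hc
  have := le_natDegree_of_ne_zero (right_ne_zero_of_mul hc)
  generalize (componentDerivative N r Q).natDegree = j at *
  have h1 : (j + r + 1) * N = N * j + r * N + N := by ring
  have : 1 ≤ N := Nat.one_le_iff_ne_zero.2 hN
  have : 0 ≤ r * N := Nat.zero_le _
  omega

lemma map_iterateFrobenius_dvd_componentDerivative (p : ℕ) [ExpChar K p] {a r : ℕ} {P Q : K[X]}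
    (h : P ^ (p ^ a * (r + 1)) ∣ Q) :
    P.map (iterateFrobenius K p a) ∣ componentDerivative (p ^ a) r Q := by
  have hN : p ^ a ≠ 0 := pow_ne_zero _ (expChar_ne_zero K p)
  obtain ⟨R, rfl⟩ := h
  set P' := P.map (iterateFrobenius K p a)
  have hP : P ^ p ^ a = expand K (p ^ a) P' := by
    rw [← map_iterateFrobenius_expand, map_expand]
  have hdiv : (contract (p ^ a) (X * (P ^ (p ^ a * (r + 1)) * R))).divX
      = (contract (p ^ a) (X * R)).divX * P' ^ (r + 1) := by
    have h0 : ∀ S : K[X], X * (contract (p ^ a) (X * S)).divX = contract (p ^ a) (X * S) := by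
      intro S
      have := X_mul_divX_add (contract (p ^ a) (X * S))
      rwa [coeff_contract hN, zero_mul, coeff_X_mul_zero, C_0, add_zero] at this
    have hX : (X : K[X]) ≠ 0 := X_ne_zero
    apply mul_left_cancel₀ hX
    rw [h0, ← mul_assoc X (divX _), h0, ← contract_mul_expand hN, map_pow, ← hP, ← pow_mul]
    congr 1
    ring
  rw [componentDerivative, hdiv]
  simpa using pow_sub_dvd_iterate_derivative_of_pow_dvd r
    (dvd_mul_left (P' ^ (r + 1)) (contract (p ^ a) (X * R)).divX)

/-- Few high powers of irreducibles can divide polynomials with a common non-zero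
`componentDerivative`. -/
lemma mul_card_le_of_componentDerivative_eq (p : ℕ) [ExpChar K p] {ι : Type*} {s : Finset ι}
    {P : ι → K[X]} {a M n : ℕ} {G : K[X]} (hG : G ≠ 0) (hn : p ^ a * G.natDegree ≤ n)
    (hm : ∀ i ∈ s, (P i).Monic) (hi : ∀ i ∈ s, Irreducible (P i))
    (hinj : Set.InjOn P s) (hM : ∀ i ∈ s, M ≤ (P i).natDegree)
    (hdvd : ∀ i ∈ s, (P i).map (iterateFrobenius K p a) ∣ G) :
    p ^ a * (M * s.card) ≤ n := by
  refine le_trans (Nat.mul_le_mul_left _ ?_) hn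
  have hprod : ∏ i ∈ s, (P i).map (iterateFrobenius K p a) ∣ G := by
    refine Finset.prod_dvd_of_coprime (fun i his j hjs hij ↦ ?_) hdvd
    have hcop : IsCoprime (P i) (P j) := (hi i his).coprime_iff_not_dvd.2 fun h ↦ hij <|
      hinj his hjs (eq_of_monic_of_associated (hm i his) (hm j hjs)
        ((hi i his).associated_of_dvd (hi j hjs) h))
    exact hcop.map (mapRingHom (iterateFrobenius K p a))
  refine le_trans ?_ (natDegree_le_of_dvd hprod hG)
  rw [natDegree_prod_of_monic _ _ fun i his ↦ (hm i his).map _, mul_comm]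
  refine Finset.card_nsmul_le_sum _ _ _ fun i his ↦ ?_
  rw [(hm i his).natDegree_map]
  exact hM i his

end ComponentDerivative

section VisibleIndices

/-- The coefficient indices on which `componentDerivative N r` depends in characteristic `p`. -/
def IsComponentIndex (N p r i : ℕ) : Prop := N ∣ i + 1 ∧ r ≤ ((i + 1) / N - 1) % p

instance (N p r : ℕ) : DecidablePred (IsComponentIndex N p r) := fun _ ↦ by
  unfold IsComponentIndex; infer_instance

lemma dvd_descFactorial_iff {p r n : ℕ} (hp : p.Prime) (hr : r < p) :
    p ∣ n.descFactorial r ↔ n % p < r := by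
  have : Fact p.Prime := ⟨hp⟩
  have hlucas := Choose.choose_modEq_choose_mod_mul_choose_div_nat (p := p) (n := n) (k := r)
  rw [Nat.mod_eq_of_lt hr, Nat.div_eq_of_lt hr, Nat.choose_zero_right, mul_one] at hlucas
  rw [Nat.descFactorial_eq_factorial_mul_choose, hp.dvd_mul, hp.dvd_factorial,
    or_iff_right (not_le.2 hr), hlucas.dvd_iff dvd_rfl]
  constructor
  · intro h
    by_contra! hle
    have h1 : p ∣ (n % p).factorial := by
      rw [← Nat.choose_mul_factorial_mul_factorial hle]
      exact (h.mul_right _).mul_right _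
    exact absurd (hp.dvd_factorial.1 h1) (not_le.2 (Nat.mod_lt _ hp.pos))
  · intro h
    simp [Nat.choose_eq_zero_of_lt h]

lemma isComponentIndex_iff {N p r : ℕ} (hN : N ≠ 0) (j : ℕ) :
    IsComponentIndex N p r ((j + 1) * N - 1) ↔ r ≤ j % p := by
  have : 1 ≤ (j + 1) * N := Nat.one_le_iff_ne_zero.2 (by positivity)
  rw [IsComponentIndex, Nat.sub_add_cancel this, Nat.mul_div_cancel _ (Nat.pos_of_ne_zero hN)]
  simp

lemma componentDerivative_eq_zero_iff {K : Type*} [Field K] {p N r : ℕ} [CharP K p]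
    (hp : p.Prime) (hN : N ≠ 0) (hr : r < p) (Q : K[X]) :
    componentDerivative N r Q = 0 ↔ ∀ i, IsComponentIndex N p r i → Q.coeff i = 0 := by
  have key : ∀ m, ((m.descFactorial r : ℕ) : K) = 0 ↔ m % p < r := fun m ↦ by
    rw [CharP.cast_eq_zero_iff K p, dvd_descFactorial_iff hp hr]
  constructor
  · rintro h i ⟨⟨c, hc⟩, hir⟩
    obtain ⟨m, rfl⟩ : ∃ m, c = m + 1 :=
      Nat.exists_eq_succ_of_ne_zero (by rintro rfl; simp at hc)
    have hi : i = (m + 1) * N - 1 := by rw [mul_comm, ← hc]; rfl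
    rw [hc, Nat.mul_div_cancel_left _ (Nat.pos_of_ne_zero hN), Nat.add_sub_cancel] at hir
    have hrm : r ≤ m := hir.trans (Nat.mod_le _ _)
    have hcoeff := coeff_componentDerivative hN r Q (m - r)
    rw [h, coeff_zero, Nat.sub_add_cancel hrm, ← hi] at hcoeff
    exact (mul_eq_zero.1 hcoeff.symm).resolve_left (mt (key m).1 (not_lt.2 hir))
  · intro h
    ext j
    rw [coeff_componentDerivative hN, coeff_zero, mul_eq_zero]
    refine (lt_or_ge ((j + r) % p) r).imp (key _).2 fun hle ↦ h _ ((isComponentIndex_iff hN _).2 hle)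

lemma count_le_mod {p r : ℕ} (b c : ℕ) (hc : c ≤ p) :
    Nat.count (fun j ↦ r ≤ j % p) (p * b + c) = b * (p - r) + (c - r) := by
  induction b generalizing c with
  | zero =>
    induction c with
    | zero => simp
    | succ c ih =>
      have ih := ih (by omega)
      simp only [mul_zero, zero_add, zero_mul] at ih ⊢
      rw [Nat.count_succ, ih, Nat.mod_eq_of_lt (by omega)]
      split_ifs <;> omega
  | succ b ihb =>
    induction c with
    | zero =>
      have := ihb p le_rfl
      rw [mul_add, mul_one, add_zero, this]
      simp [add_mul]
    | succ c ih =>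
      have ih := ih (by omega)
      rw [← add_assoc, Nat.count_succ, ih, Nat.mul_add_mod, Nat.mod_eq_of_lt (by omega)]
      split_ifs <;> omega

lemma card_isComponentIndex {N : ℕ} (hN : N ≠ 0) (p r L : ℕ) :
    (Finset.univ.filter fun i : Fin L ↦ IsComponentIndex N p r i).card =
      Nat.count (fun j ↦ r ≤ j % p) (L / N) := by
  have hpos := Nat.pos_of_ne_zero hN
  rw [Nat.count_eq_card_filter_range]
  symm
  have hlt : ∀ j, j ∈ (Finset.range (L / N)).filter (fun j ↦ r ≤ j % p) → (j + 1) * N - 1 < L := by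
    intro j hj
    have h1 : j + 1 ≤ L / N := Finset.mem_range.1 (Finset.mem_filter.1 hj).1
    have h2 := (Nat.le_div_iff_mul_le hpos).1 h1
    have : 1 ≤ (j + 1) * N := Nat.one_le_iff_ne_zero.2 (by positivity)
    omega
  refine Finset.card_bij (fun j hj ↦ ⟨(j + 1) * N - 1, hlt j hj⟩) ?_ ?_ ?_
  · intro j hj
    simpa [isComponentIndex_iff hN] using (Finset.mem_filter.1 hj).2
  · intro j _ j' _ h
    have h : (j + 1) * N - 1 = (j' + 1) * N - 1 := congrArg Fin.val h
    have h1 : 1 ≤ (j + 1) * N := Nat.one_le_iff_ne_zero.2 (by positivity)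
    have h2 : 1 ≤ (j' + 1) * N := Nat.one_le_iff_ne_zero.2 (by positivity)
    have h3 : (j + 1) * N = (j' + 1) * N := by omega
    have := Nat.eq_of_mul_eq_mul_right hpos h3
    omega
  · rintro ⟨i, hi⟩ hv
    have hv : IsComponentIndex N p r i := (Finset.mem_filter.1 hv).2
    obtain ⟨⟨c, hc⟩, hir⟩ := hv
    obtain ⟨m, rfl⟩ : ∃ m, c = m + 1 :=
      Nat.exists_eq_succ_of_ne_zero (by rintro rfl; simp at hc)
    rw [hc, Nat.mul_div_cancel_left _ hpos, Nat.add_sub_cancel] at hir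
    refine ⟨m, ?_, ?_⟩
    · rw [Finset.mem_filter, Finset.mem_range]
      refine ⟨(Nat.le_div_iff_mul_le hpos).2 ?_, hir⟩
      rw [Nat.succ_eq_add_one, mul_comm, ← hc]
      omega
    · ext
      simp only [mul_comm _ N, ← hc]
      rfl

lemma card_isComponentIndex_mul_le {N p r : ℕ} (hN : N ≠ 0) (hr : r < p) (L : ℕ) :
    (Finset.univ.filter fun i : Fin L ↦ IsComponentIndex N p r i).card * (p * N) ≤ L * (p - r) := by
  rw [card_isComponentIndex hN]
  have hJ := Nat.div_add_mod (L / N) p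
  have hmod := Nat.mod_lt (L / N) (by omega : 0 < p)
  set b := L / N / p
  set c := L / N % p
  rw [← hJ, count_le_mod b c hmod.le]
  have h1 : (c - r) * p ≤ c * (p - r) := by
    rcases le_total c r with h | h
    · simp [Nat.sub_eq_zero_of_le h]
    · zify [h, hr.le]
      nlinarith
  calc (b * (p - r) + (c - r)) * (p * N) = (b * (p - r) * p + (c - r) * p) * N := by ring
    _ ≤ (b * (p - r) * p + c * (p - r)) * N := by gcongr
    _ = (p * b + c) * N * (p - r) := by ring
    _ ≤ L * (p - r) := by rw [hJ]; gcongr; exact Nat.div_mul_le_self L N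

lemma div_le_card_isComponentIndex {N p r : ℕ} (hN : N ≠ 0) (hr : r < p) (L : ℕ) :
    L / (N * p) ≤ (Finset.univ.filter fun i : Fin L ↦ IsComponentIndex N p r i).card := by
  rw [card_isComponentIndex hN, ← Nat.div_div_eq_div_mul]
  have hJ := Nat.div_add_mod (L / N) p
  have hmod := Nat.mod_lt (L / N) (by omega : 0 < p)
  set b := L / N / p
  set c := L / N % p
  rw [← hJ, count_le_mod b c hmod.le]
  have : 1 ≤ p - r := by omega
  nlinarith

end VisibleIndices

section IntervalCounting

variable {K : Type*} [Field K] [Fintype K] [DecidableEq K] {L k : ℕ} {F : K[X]}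
  {P : (Fin L → K) → K[X]}

lemma mul_card_natDegree_eq_le (hmonic : ∀ v, (P v).Monic) (hirr : ∀ v, Irreducible (P v))
    (hdvd : ∀ v, P v ^ k ∣ F + ofFn L v) {m : ℕ} (hm : m ≠ 0) :
    m * (Finset.univ.filter fun v ↦ (P v).natDegree = m).card ≤
      Fintype.card K ^ (L - k * m) * Fintype.card K ^ m := by
  classical
  set s := Finset.univ.filter fun v ↦ (P v).natDegree = m
  have hs : ∀ v ∈ s, (P v).natDegree = m := fun v hv ↦ (Finset.mem_filter.1 hv).2
  have h1 : s.card ≤ Fintype.card K ^ (L - k * m) * (s.image P).card := by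
    refine Finset.card_le_mul_card_image s _ fun R hR ↦ ?_
    obtain ⟨w, hw, rfl⟩ := Finset.mem_image.1 hR
    have := card_multiples_le (L := L) F (R := P w ^ k) (s := s.filter fun v ↦ P v = P w)
      fun v hv ↦ (Finset.mem_filter.1 hv).2 ▸ hdvd v
    rwa [natDegree_pow, hs w hw] at this
  have h2 : m * (s.image P).card ≤ Fintype.card K ^ m := by
    refine mul_card_irreducible_le hm fun R hR ↦ ?_
    obtain ⟨w, hw, rfl⟩ := Finset.mem_image.1 hR
    exact ⟨hmonic w, hirr w, hs w hw⟩
  calc m * s.card ≤ m * (Fintype.card K ^ (L - k * m) * (s.image P).card) := by gcongr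
    _ = Fintype.card K ^ (L - k * m) * (m * (s.image P).card) := by ring
    _ ≤ _ := by gcongr

lemma card_natDegree_lt_le (hk : 2 ≤ k) (hmonic : ∀ v, (P v).Monic)
    (hirr : ∀ v, Irreducible (P v)) (hdvd : ∀ v, P v ^ k ∣ F + ofFn L v) (M : ℕ) :
    ((Finset.univ.filter fun v ↦ (P v).natDegree < M).card : ℝ) ≤
      (Fintype.card K : ℝ) ^ L *
        -Real.log (1 - (Fintype.card K : ℝ) / (Fintype.card K : ℝ) ^ k) +
      (Fintype.card K : ℝ) ^ M := by
  set q := Fintype.card K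
  have hq2 : 2 ≤ q := Fintype.one_lt_card
  have hqR : (1 : ℝ) < q := by exact_mod_cast hq2
  have hq0 : (0 : ℝ) < q := by positivity
  set y : ℝ := q / q ^ k
  have hy0 : 0 < y := by positivity
  have hy1 : y < 1 := by
    rw [div_lt_one (by positivity)]
    exact lt_self_pow₀ hqR (by omega)
  have hlog := Real.hasSum_pow_div_log_of_abs_lt_one (abs_lt.2 ⟨by linarith, hy1⟩)
  have hfib : (Finset.univ.filter fun v ↦ (P v).natDegree < M).card =
      ∑ m ∈ Finset.range M, (Finset.univ.filter fun v ↦ (P v).natDegree = m).card := by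
    rw [Finset.card_eq_sum_card_fiberwise (f := fun v ↦ (P v).natDegree)
      (t := Finset.range M) (by intro v hv; simpa using hv)]
    refine Finset.sum_congr rfl fun m hm ↦ ?_
    rw [Finset.filter_filter]
    congr 1
    ext v
    have := Finset.mem_range.1 hm
    simp only [Finset.mem_filter, Finset.mem_univ, true_and]
    omega
  have hterm : ∀ m : ℕ, ((Finset.univ.filter fun v ↦ (P v).natDegree = m + 1).card : ℝ) ≤
      q ^ L * (y ^ (m + 1) / (m + 1)) + q ^ (m + 1) := by
    intro m
    have h := mul_card_natDegree_eq_le hmonic hirr hdvd m.succ_ne_zero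
    have h' : ((m : ℝ) + 1) * ((Finset.univ.filter fun v ↦ (P v).natDegree = m + 1).card : ℝ) ≤
        q ^ (L - k * (m + 1)) * q ^ (m + 1) := by exact_mod_cast h
    have hpow : (q : ℝ) ^ (L - k * (m + 1)) ≤ q ^ L / q ^ (k * (m + 1)) + 1 := by
      rcases le_total (k * (m + 1)) L with hle | hle
      · rw [pow_sub₀ _ hq0.ne' hle, div_eq_mul_inv]
        linarith
      · rw [Nat.sub_eq_zero_of_le hle, pow_zero]
        have : (0 : ℝ) < q ^ L / q ^ (k * (m + 1)) := by positivity
        linarith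
    have hm1 : (0 : ℝ) < m + 1 := by positivity
    calc _ ≤ (q : ℝ) ^ (L - k * (m + 1)) * q ^ (m + 1) / (m + 1) := by
          rw [le_div_iff₀ hm1]; linarith
      _ ≤ (q ^ L / q ^ (k * (m + 1)) + 1) * q ^ (m + 1) / (m + 1) := by gcongr
      _ = q ^ L * (y ^ (m + 1) / (m + 1)) + q ^ (m + 1) / (m + 1) := by
          rw [div_pow, ← pow_mul]; field_simp
      _ ≤ _ := by
          gcongr
          exact div_le_self (by positivity) (by linarith [(Nat.cast_nonneg m : (0 : ℝ) ≤ m)])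
  rw [hfib]
  rcases M with _ | M
  · simp only [Finset.range_zero, Finset.sum_empty, Nat.cast_zero, pow_zero]
    have := hlog.nonneg fun i ↦ by positivity
    positivity
  have h0 : (Finset.univ.filter fun v ↦ (P v).natDegree = 0).card = 0 := by
    simp only [Finset.card_eq_zero, Finset.filter_eq_empty_iff]
    exact fun v _ h ↦ (hirr v).natDegree_pos.ne' h
  rw [Finset.sum_range_succ', h0, add_zero]
  push_cast
  calc _ ≤ ∑ m ∈ Finset.range M, ((q : ℝ) ^ L * (y ^ (m + 1) / (m + 1)) + q ^ (m + 1)) :=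
        Finset.sum_le_sum fun m _ ↦ hterm m
    _ = (q : ℝ) ^ L * ∑ m ∈ Finset.range M, (y ^ (m + 1) / (m + 1)) +
          ∑ m ∈ Finset.range M, (q : ℝ) ^ (m + 1) := by
        rw [Finset.sum_add_distrib, Finset.mul_sum]
    _ ≤ _ := by
        gcongr
        · exact sum_le_hasSum _ (fun i _ ↦ by positivity) hlog
        · have := Nat.geomSum_lt (m := q) (n := M + 1) (s := (Finset.range M).image (· + 1)) hq2
            (by simp)
          rw [Finset.sum_image (by simp)] at this
          exact_mod_cast this.le

variable {p a r M n : ℕ} [CharP K p]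

lemma card_componentDerivative_eq_zero_le (hp : p.Prime) (hr : r < p) {N : ℕ} (hN : N ≠ 0) :
    (Finset.univ.filter fun v ↦ componentDerivative N r (F + ofFn L v) = 0).card ≤
      Fintype.card K ^ (L - (Finset.univ.filter fun i : Fin L ↦ IsComponentIndex N p r i).card) := by
  set s := Finset.univ.filter fun v ↦ componentDerivative N r (F + ofFn L v) = 0
  have hinj : Set.InjOn (fun (v : Fin L → K)
      (i : {i : Fin L // ¬ IsComponentIndex N p r i}) ↦ v i) s := by
    intro v hv w hw hvw
    ext i
    by_cases hi : IsComponentIndex N p r i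
    · have hv := (componentDerivative_eq_zero_iff hp hN hr _).1 (Finset.mem_filter.1 hv).2 i hi
      have hw := (componentDerivative_eq_zero_iff hp hN hr _).1 (Finset.mem_filter.1 hw).2 i hi
      rw [coeff_add, ofFn_coeff_eq_val_of_lt _ i.2] at hv hw
      exact add_left_cancel (hv.trans hw.symm)
    · exact congrFun hvw ⟨i, hi⟩
  calc s.card ≤ (Finset.univ :
        Finset ({i : Fin L // ¬ IsComponentIndex N p r i} → K)).card :=
        Finset.card_le_card_of_injOn _ (fun _ _ ↦ Finset.mem_univ _) hinj
    _ = _ := by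
      rw [Finset.card_univ, Fintype.card_fun, Fintype.card_subtype_compl, Fintype.card_fin,
        Fintype.card_subtype]

lemma card_componentDerivative_ne_zero_le (hp : p.Prime) (hr : r < p)
    (hk : p ^ a * (r + 1) ≤ k) (hM : 0 < M) (hLM : L ≤ k * M) (hF : F.natDegree = n) (hL : L ≤ n)
    (hmonic : ∀ v, (P v).Monic) (hirr : ∀ v, Irreducible (P v))
    (hdvd : ∀ v, P v ^ k ∣ F + ofFn L v) :
    (Finset.univ.filter fun v ↦ M ≤ (P v).natDegree ∧
        componentDerivative (p ^ a) r (F + ofFn L v) ≠ 0).card ≤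
      n / (p ^ a * M) * Fintype.card K ^
        (Finset.univ.filter fun i : Fin L ↦ IsComponentIndex (p ^ a) p r i).card := by
  have hN : p ^ a ≠ 0 := pow_ne_zero _ hp.ne_zero
  have : ExpChar K p := .prime hp
  set s := Finset.univ.filter fun v ↦ M ≤ (P v).natDegree ∧
        componentDerivative (p ^ a) r (F + ofFn L v) ≠ 0
  let f : (Fin L → K) → ({i : Fin L // IsComponentIndex (p ^ a) p r i} → K) := fun v i ↦ v i
  have hfib := Finset.card_le_mul_card_image_of_maps_to (f := f) (s := s) (t := Finset.univ)
    (fun _ _ ↦ Finset.mem_univ _) (n / (p ^ a * M)) ?_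
  · rwa [Finset.card_univ, Fintype.card_fun, Fintype.card_subtype] at hfib
  intro b _
  rcases (s.filter fun v ↦ f v = b).eq_empty_or_nonempty with h | ⟨w, hw⟩
  · simp [h]
  rw [Nat.le_div_iff_mul_le (Nat.mul_pos (Nat.pos_of_ne_zero hN) hM), mul_comm, mul_assoc]
  have hmem : ∀ v ∈ s.filter fun v ↦ f v = b, M ≤ (P v).natDegree ∧
      componentDerivative (p ^ a) r (F + ofFn L v) ≠ 0 ∧ f v = b := fun v hv ↦ by
    simpa [s, and_assoc] using hv
  have hcongr : ∀ v ∈ s.filter fun v ↦ f v = b, componentDerivative (p ^ a) r (F + ofFn L v) =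
      componentDerivative (p ^ a) r (F + ofFn L w) := by
    intro v hv
    rw [← sub_eq_zero, ← componentDerivative_sub hN, componentDerivative_eq_zero_iff hp hN hr]
    intro i hi
    rw [add_sub_add_left_eq_sub, coeff_sub]
    by_cases hiL : i < L
    · rw [ofFn_coeff_eq_val_of_lt v hiL, ofFn_coeff_eq_val_of_lt w hiL]
      exact sub_eq_zero.2 (congrFun ((hmem v hv).2.2.trans (hmem w hw).2.2.symm) ⟨⟨i, hiL⟩, hi⟩)
    · rw [ofFn_coeff_eq_zero_of_ge v (by omega), ofFn_coeff_eq_zero_of_ge w (by omega), sub_self]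
  refine mul_card_le_of_componentDerivative_eq p (P := P) (hmem w hw).2.1 ?_
    (fun v _ ↦ hmonic v) (fun v _ ↦ hirr v) ?_ (fun v hv ↦ (hmem v hv).1) ?_
  · refine (mul_natDegree_componentDerivative_le hN _ _).trans ?_
    refine (natDegree_add_le _ _).trans (max_le hF.le ?_)
    exact natDegree_le_of_degree_le ((ofFn_degree_lt w).le.trans (by exact_mod_cast hL))
  · intro v hv v' hv' hvv'
    have hcard := card_multiples_le (L := L) F (R := P v ^ k) (s := {v, v'}) (by
      intro u hu
      rcases Finset.mem_insert.1 hu with rfl | hu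
      · exact hdvd _
      · rw [Finset.mem_singleton.1 hu, hvv']; exact hdvd _)
    rw [natDegree_pow, Nat.sub_eq_zero_of_le
      (hLM.trans (Nat.mul_le_mul_left _ (hmem v hv).1)), pow_zero] at hcard
    exact Finset.card_le_one.1 hcard _ (by simp) _ (by simp)
  · intro v hv
    rw [← hcongr v hv]
    exact map_iterateFrobenius_dvd_componentDerivative p ((pow_dvd_pow _ hk).trans (hdvd v))

/-- If every polynomial in an interval of length `q ^ L` fails to be `k`-free, then the interval
is covered by the multiples of `P ^ k` with `deg P < M`, the zeros of `componentDerivative`, and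
the multiples of `P ^ k` with `deg P ≥ M` on which `componentDerivative` is non-zero. -/
lemma card_interval_le (hp : p.Prime) (hr : r < p) (hk2 : 2 ≤ k)
    (hk : p ^ a * (r + 1) ≤ k) (hM : 0 < M) (hLM : L ≤ k * M) (hF : F.natDegree = n) (hL : L ≤ n)
    (h : ∀ v, ∃ P : K[X], Irreducible P ∧ P ^ k ∣ F + ofFn L v) :
    (Fintype.card K : ℝ) ^ L ≤ (Fintype.card K : ℝ) ^ L *
        -Real.log (1 - (Fintype.card K : ℝ) / (Fintype.card K : ℝ) ^ k) +
      (Fintype.card K : ℝ) ^ M + (Fintype.card K : ℝ) ^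
        (L - (Finset.univ.filter fun i : Fin L ↦ IsComponentIndex (p ^ a) p r i).card) +
      n / (p ^ a * M) * (Fintype.card K : ℝ) ^
        (Finset.univ.filter fun i : Fin L ↦ IsComponentIndex (p ^ a) p r i).card := by
  have h' : ∀ v, ∃ P : K[X], P.Monic ∧ Irreducible P ∧ P ^ k ∣ F + ofFn L v := fun v ↦ by
    obtain ⟨P, hP, hPk⟩ := h v
    exact ⟨normalize P, monic_normalize hP.ne_zero, (associated_normalize P).irreducible hP,
      ((associated_normalize P).pow_pow.dvd_iff_dvd_left).1 hPk⟩
  choose P hmonic hirr hdvd using h'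
  have h1 := card_natDegree_lt_le hk2 hmonic hirr hdvd M
  have h2 : ((_ : ℕ) : ℝ) ≤ (_ : ℕ) := Nat.cast_le.2
    (card_componentDerivative_eq_zero_le (F := F) (L := L) (K := K) hp hr
      (pow_ne_zero a hp.ne_zero))
  have h3 : ((_ : ℕ) : ℝ) ≤ (_ : ℕ) := Nat.cast_le.2
    (card_componentDerivative_ne_zero_le hp hr hk hM hLM hF hL hmonic hirr hdvd)
  have hdiv : ((n / (p ^ a * M) : ℕ) : ℝ) ≤ n / (p ^ a * M) := by
    simpa using Nat.cast_div_le (α := ℝ) (m := n) (n := p ^ a * M)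
  have hcover : Fintype.card K ^ L ≤ (Finset.univ.filter fun v ↦ (P v).natDegree < M).card +
      (Finset.univ.filter fun v ↦ componentDerivative (p ^ a) r (F + ofFn L v) = 0).card +
      (Finset.univ.filter fun v ↦ M ≤ (P v).natDegree ∧
        componentDerivative (p ^ a) r (F + ofFn L v) ≠ 0).card := by
    calc Fintype.card K ^ L = (Finset.univ : Finset (Fin L → K)).card := by simp
      _ ≤ _ := Finset.card_le_card (t := (_ ∪ _) ∪ _) fun v _ ↦ by
        simp only [Finset.mem_union, Finset.mem_filter, Finset.mem_univ, true_and]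
        have := lt_or_ge (P v).natDegree M
        tauto
      _ ≤ _ := (Finset.card_union_le _ _).trans
        (Nat.add_le_add_right (Finset.card_union_le _ _) _)
  have hcover' : ((_ : ℕ) : ℝ) ≤ (_ : ℕ) := Nat.cast_le.2 hcover
  push_cast at hcover' h2 h3
  have h4 := mul_le_mul_of_nonneg_right hdiv (by positivity : (0 : ℝ) ≤ (Fintype.card K : ℝ) ^
        (Finset.univ.filter fun i : Fin L ↦ IsComponentIndex (p ^ a) p r i).card)
  linarith

end IntervalCounting

section Constants

lemma neg_log_one_sub_le_inv {y c : ℝ} (hc : 0 < c) (hy : 0 < y) (h : y * (c + 1) ≤ 1) :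
    -Real.log (1 - y) ≤ 1 / c := by
  have hy1 : y < 1 := by nlinarith
  have h1 := Real.one_sub_inv_le_log_of_pos (by linarith : 0 < 1 - y)
  have h2 : (1 - y)⁻¹ - 1 ≤ 1 / c := by
    rw [inv_eq_one_div, div_sub_one (by linarith), div_le_div_iff₀ (by linarith) hc]
    nlinarith
  linarith

lemma digit_exponent_bounds {p q k : ℕ} (hp : p.Prime) (hpq : p ≤ q) (hk : 2 ≤ k) :
    0 < 1 - ((p : ℝ) - ((k / p ^ Nat.log p k : ℕ) : ℝ) + 1) / (p : ℝ) ^ (Nat.log p k + 1) ∧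
    -Real.log (1 - (q : ℝ) / (q : ℝ) ^ k) +
      (1 - ((p : ℝ) - ((k / p ^ Nat.log p k : ℕ) : ℝ) + 1) / (p : ℝ) ^ (Nat.log p k + 1)) /
        (p : ℝ) ^ Nat.log p k < 1 := by
  have hp2 := hp.two_le
  have hpR : (2 : ℝ) ≤ p := by exact_mod_cast hp2
  have hpqR : (p : ℝ) ≤ q := by exact_mod_cast hpq
  have hq0 : (0 : ℝ) < q := by linarith
  have hy0 : (0 : ℝ) < (q : ℝ) / (q : ℝ) ^ k := by positivity
  have hyk : (q : ℝ) / (q : ℝ) ^ k * (q : ℝ) ^ (k - 1) = 1 := by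
    obtain ⟨j, rfl⟩ : ∃ j, k = j + 1 := ⟨k - 1, by omega⟩
    rw [Nat.add_sub_cancel, pow_succ]
    field_simp
  have hd1 : 1 ≤ k / p ^ Nat.log p k :=
    (Nat.one_le_div_iff (pow_pos hp.pos _)).2 (Nat.pow_log_le_self p (by omega))
  have hdp : k / p ^ Nat.log p k < p := by
    rw [Nat.div_lt_iff_lt_mul (pow_pos hp.pos _), ← pow_succ']
    exact Nat.lt_pow_succ_log_self hp.one_lt k
  rcases Nat.eq_zero_or_pos (Nat.log p k) with ha | ha
  · rw [ha, pow_zero, Nat.div_one] at hdp ⊢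
    simp only [zero_add, pow_one, pow_zero, div_one]
    have hkR : (2 : ℝ) ≤ k := by exact_mod_cast hk
    have hkp : (k : ℝ) + 1 ≤ p := by exact_mod_cast hdp
    have hθ : 1 - ((p : ℝ) - k + 1) / p = (k - 1) / p := by field_simp; ring
    rw [hθ]
    refine ⟨div_pos (by linarith) (by linarith), ?_⟩
    have hS := neg_log_one_sub_le_inv (c := p - 1) (by linarith) hy0 (by
      rw [sub_add_cancel, ← hyk]
      gcongr
      exact hpqR.trans (le_self_pow₀ (by linarith) (by omega)))
    have hlt : 1 / ((p : ℝ) - 1) < 2 / p := by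
      rw [div_lt_div_iff₀ (by linarith) (by linarith)]
      linarith
    have hle : ((k : ℝ) - 1) / p ≤ (p - 2) / p :=
      div_le_div_of_nonneg_right (by linarith) (by linarith)
    have : 2 / (p : ℝ) + (p - 2) / p = 1 := by field_simp; ring
    linarith
  · set a := Nat.log p k
    set d := k / p ^ a
    have hdR : (1 : ℝ) ≤ d := by exact_mod_cast hd1
    have hdpR : (d : ℝ) + 1 ≤ p := by exact_mod_cast hdp
    have hN : (2 : ℝ) ≤ (p : ℝ) ^ a := hpR.trans (le_self_pow₀ (by linarith) ha.ne')
    have hNp : (p : ℝ) < (p : ℝ) ^ (a + 1) := by rw [pow_succ]; nlinarith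
    have hθ1 : 0 < ((p : ℝ) - d + 1) / (p : ℝ) ^ (a + 1) := div_pos (by linarith) (by linarith)
    have hθ0 : ((p : ℝ) - d + 1) / (p : ℝ) ^ (a + 1) < 1 := by
      rw [div_lt_one (by linarith)]; linarith
    refine ⟨by linarith, ?_⟩
    by_cases h2 : q = 2 ∧ k = 2
    · obtain ⟨rfl, rfl⟩ := h2
      obtain rfl : p = 2 := by omega
      have ha1 : a = 1 := Nat.log_eq_iff (by norm_num) |>.2 (by norm_num)
      have hd : d = 1 := by simp [d, ha1]
      rw [hd, ha1]
      have h4 : (1 : ℝ) - ((2 : ℕ) : ℝ) / ((2 : ℕ) : ℝ) ^ 2 = 2⁻¹ := by norm_num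
      rw [h4, Real.log_inv, neg_neg]
      have := Real.log_two_lt_d9
      norm_num
      linarith
    · have h3 : 3 ≤ q ^ (k - 1) := by
        rcases Nat.lt_or_ge 2 q with hq | hq
        · exact (Nat.succ_le_of_lt hq).trans (Nat.le_self_pow (n := k - 1) (by omega) q)
        · have hq2 : q = 2 := by omega
          have : 2 ≤ k - 1 := by omega
          calc 3 ≤ 2 ^ 2 := by norm_num
            _ ≤ q ^ (k - 1) := by rw [hq2]; exact Nat.pow_le_pow_right (by norm_num) this
      have hS := neg_log_one_sub_le_inv (c := 2) (by norm_num) hy0 (by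
        refine (mul_le_mul_of_nonneg_left ?_ hy0.le).trans hyk.le
        norm_num
        exact_mod_cast h3)
      have : (1 - ((p : ℝ) - d + 1) / (p : ℝ) ^ (a + 1)) / (p : ℝ) ^ a < 1 / 2 := by
        rw [div_lt_div_iff₀ (by linarith) (by norm_num)]
        linarith
      linarith

lemma exists_threshold {l θ ε : ℝ} (hl : 0 < l) (hθ : 0 < θ) (hε : 0 < ε) (C L₀ : ℝ) :
    ∃ N : ℕ, ∀ n : ℕ, N ≤ n → 0 < Real.log n / l ∧ ∀ L : ℝ,
      (n : ℝ) / (Real.log n / l) < Real.exp (θ * L * l) →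
        L₀ ≤ L ∧ Real.log n / l ≤ (θ + ε) * (L - C) := by
  set η := ε / (2 * (θ + ε))
  have hη : 0 < η := by positivity
  have hη2 : η * (θ + ε) = ε / 2 := by simp only [η]; field_simp
  have hη1 : η < 1 := by nlinarith
  have hx : Filter.Tendsto (fun n : ℕ ↦ Real.log n / l) Filter.atTop Filter.atTop :=
    (Real.tendsto_log_atTop.comp tendsto_natCast_atTop_atTop).atTop_div_const hl
  have hlog : ∀ᶠ x : ℝ in Filter.atTop, ‖Real.log x‖ ≤ η * l * ‖x‖ :=
    Real.isLittleO_log_id_atTop.bound (by positivity)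
  have hev := hx.eventually (hlog.and ((Filter.eventually_gt_atTop 0).and
    ((Filter.eventually_ge_atTop (θ * L₀ / (1 - η))).and
      (Filter.eventually_ge_atTop ((θ + ε) * C * θ / (ε / 2))))))
  obtain ⟨N, hN⟩ := Filter.eventually_atTop.1 hev
  refine ⟨N, fun n hn ↦ ?_⟩
  obtain ⟨h1, h2, h3, h4⟩ := hN n hn
  refine ⟨h2, fun L hL ↦ ?_⟩
  have hlogn : 0 < Real.log n := by
    have := mul_pos h2 hl
    rwa [div_mul_cancel₀ _ hl.ne'] at this
  have hn0 : (0 : ℝ) < n := by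
    rcases Nat.eq_zero_or_pos n with rfl | h
    · simp at hlogn
    · exact_mod_cast h
  have hlt := Real.log_lt_log (by positivity) hL
  rw [Real.log_exp, Real.log_div hn0.ne' h2.ne'] at hlt
  have hnx : Real.log n = Real.log n / l * l := by field_simp
  rw [div_le_iff₀ (by linarith)] at h3
  rw [div_le_iff₀ (by linarith)] at h4
  set x := Real.log n / l
  rw [hnx] at hlt
  rw [Real.norm_eq_abs, Real.norm_eq_abs, abs_of_pos h2] at h1
  have h5 := (le_abs_self _).trans h1
  have h6 : x * (1 - η) < θ * L := by
    refine lt_of_mul_lt_mul_right (a := l) ?_ hl.le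
    linarith
  constructor
  · exact le_of_mul_le_mul_left (h3.trans h6.le) hθ
  · refine le_of_mul_le_mul_left (a := θ) ?_ hθ
    have h7 := mul_le_mul_of_nonneg_right h6.le (by linarith : 0 ≤ θ + ε)
    have h8 : x * (1 - η) * (θ + ε) = x * (θ + ε) - x * (ε / 2) := by rw [← hη2]; ring
    linarith

end Constants

/-- **Theorem 2 (main theorem).** Let `k ≥ 2` and let `q` be a power of the prime `p`,
the characteristic of `Fq`. With `a = ⌊log_p k⌋`, `d = ⌊k/p^a⌋` (the leading base-`p`
digit of `k`) and `θ = 1 - (p - d + 1)/p^{a+1}`, for all sufficiently large `n`: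
for every monic `F` of degree `n` and every `0 < h < n` with
`q^{h+1} > (n/log_q n)^{1/θ}`, the interval `I_q(F,h)` contains a `k`-free polynomial. -/
theorem kfree_in_short_intervals_main
    {Fq : Type} [Field Fq] [Fintype Fq] (q p k : ℕ) [CharP Fq p]
    (hq : Fintype.card Fq = q) (hk : 2 ≤ k) :
    ∃ N : ℕ, ∀ n : ℕ, N ≤ n →
      ∀ F : Polynomial Fq, F.Monic → F.natDegree = n →
        ∀ h : ℕ, 0 < h → h < n →
          ((n : ℝ) / (Real.log n / Real.log q)) ^
              (1 / (1 - ((p : ℝ) - ((k / p ^ (Nat.log p k) : ℕ) : ℝ) + 1) /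
                (p : ℝ) ^ (Nat.log p k + 1)))
            < (q : ℝ) ^ (h + 1) →
          ∃ Q : Polynomial Fq, (F - Q).degree ≤ (h : WithBot ℕ) ∧
            ∀ P : Polynomial Fq, Irreducible P → ¬ P ^ k ∣ Q := by
  classical
  have hp : p.Prime := CharP.char_is_prime Fq p
  have : Fact p.Prime := ⟨hp⟩
  have hpq : p ≤ q := by
    obtain ⟨m, -, hm⟩ := FiniteField.card Fq p
    rw [← hq, hm]
    exact Nat.le_self_pow m.ne_zero p
  obtain ⟨hθ, hδ⟩ := digit_exponent_bounds hp hpq hk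
  set a := Nat.log p k
  set d := k / p ^ a with hd
  have hd1 : 1 ≤ d :=
    (Nat.one_le_div_iff (pow_pos hp.pos _)).2 (Nat.pow_log_le_self p (by omega))
  have hdp : d < p := by
    rw [hd, Nat.div_lt_iff_lt_mul (pow_pos hp.pos _), ← pow_succ']
    exact Nat.lt_pow_succ_log_self hp.one_lt k
  set θ : ℝ := 1 - ((p : ℝ) - d + 1) / (p : ℝ) ^ (a + 1) with hθ_def
  set S : ℝ := -Real.log (1 - (q : ℝ) / (q : ℝ) ^ k) with hS
  have hqR : (1 : ℝ) < q := by exact_mod_cast hp.one_lt.trans_le hpq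
  have hq0 : (0 : ℝ) < q := by linarith
  have hlq : 0 < Real.log q := Real.log_pos hqR
  obtain ⟨ε, hε, hεδ⟩ : ∃ ε : ℝ, 0 < ε ∧ S + θ / p ^ a + 3 * ε < 1 :=
    ⟨(1 - (S + θ / p ^ a)) / 4, by linarith, by linarith⟩
  obtain ⟨C, hC⟩ : ∃ C : ℕ, 1 / ε < (q : ℝ) ^ C := pow_unbounded_of_one_lt _ hqR
  obtain ⟨N, hN⟩ := exists_threshold hlq hθ hε C (2 * C + 1 + C * (p ^ a * p) : ℕ)
  refine ⟨N, fun n hn F _ hFn h _ hhn hbig ↦ ?_⟩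
  by_contra! hcon
  obtain ⟨L, hLh⟩ : ∃ L, L = h + 1 := ⟨_, rfl⟩
  rw [← hLh] at hbig
  obtain ⟨hx, hN⟩ := hN n hn
  have hexp : Real.exp (θ * L * Real.log q) = ((q : ℝ) ^ L) ^ θ := by
    rw [← Real.rpow_natCast, ← Real.rpow_mul hq0.le, Real.rpow_def_of_pos hq0]
    ring_nf
  have hnx : (n : ℝ) / (Real.log n / Real.log q) < Real.exp (θ * L * Real.log q) := by
    have h0 : 0 ≤ (n : ℝ) / (Real.log n / Real.log q) := by positivity
    have := Real.rpow_lt_rpow (by positivity) hbig hθ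
    rwa [← Real.rpow_mul h0, one_div, inv_mul_cancel₀ hθ.ne', Real.rpow_one, ← hexp] at this
  obtain ⟨hL₀, hxL⟩ := hN L hnx
  have hL₀ : 2 * C + 1 + C * (p ^ a * p) ≤ L := by exact_mod_cast hL₀
  obtain ⟨M, hM⟩ : ∃ M, L = M + C := ⟨L - C, by omega⟩
  have hM0 : 0 < M := by omega
  have hk' : p ^ a * (d - 1 + 1) ≤ k := by
    rw [Nat.sub_add_cancel hd1]; exact Nat.mul_div_le k _
  have hNpos : p ^ a ≠ 0 := pow_ne_zero a hp.ne_zero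
  have key := card_interval_le (L := L) (M := M) (a := a) (r := d - 1) hp (by omega) hk hk' hM0
    (by have := Nat.mul_le_mul_right M hk; omega) hFn (by omega) fun v ↦ hcon (F + ofFn L v) (by
      rw [sub_add_cancel_left, degree_neg]
      refine (degree_le_iff_coeff_zero _ _).2 fun i hi ↦ ofFn_coeff_eq_zero_of_ge v ?_
      have : h < i := by exact_mod_cast hi
      omega)
  have hTupper := card_isComponentIndex_mul_le hNpos (by omega : d - 1 < p) L
  have hTlower := (Nat.div_le_div_right hL₀).trans
    (div_le_card_isComponentIndex hNpos (by omega : d - 1 < p) L)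
  rw [Nat.add_mul_div_right _ _ (Nat.mul_pos (Nat.pos_of_ne_zero hNpos) hp.pos)] at hTlower
  have hTL : (Finset.univ.filter fun i : Fin L ↦ IsComponentIndex (p ^ a) p (d - 1) i).card ≤ L :=
    (Finset.card_filter_le _ _).trans (by simp)
  set T := (Finset.univ.filter fun i : Fin L ↦ IsComponentIndex (p ^ a) p (d - 1) i).card
  have hCT : C ≤ T := le_trans (Nat.le_add_left _ _) hTlower
  rw [hq, ← hS] at key
  have hpow_sub : ∀ j, C ≤ j → j ≤ L → (q : ℝ) ^ (L - j) ≤ q ^ L * ε := by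
    intro j hCj hjL
    rw [pow_sub₀ _ hq0.ne' hjL]
    gcongr
    rw [inv_le_comm₀ (by positivity) hε, ← one_div]
    exact hC.le.trans (pow_le_pow_right₀ hqR.le hCj)
  have hmid : (q : ℝ) ^ M ≤ q ^ L * ε := by
    have := hpow_sub C le_rfl (by omega)
    rwa [show L - C = M by omega] at this
  have hTθ : (T : ℝ) ≤ L * (1 - θ) := by
    have hcast : ((p - (d - 1) : ℕ) : ℝ) = p - d + 1 := by
      rw [Nat.cast_sub (by omega), Nat.cast_sub hd1]; push_cast; ring
    have h1 : (T : ℝ) * (p * p ^ a) ≤ L * (p - d + 1) := by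
      rw [← hcast]; exact_mod_cast hTupper
    have hp0 : (0 : ℝ) < p := by exact_mod_cast hp.pos
    rw [hθ_def, sub_sub_cancel, ← mul_div_assoc, le_div_iff₀ (by positivity), pow_succ']
    exact h1
  have hTpow : (q : ℝ) ^ T * Real.exp (θ * L * Real.log q) ≤ q ^ L := by
    rw [← Real.rpow_natCast, ← Real.rpow_natCast, Real.rpow_def_of_pos hq0,
      Real.rpow_def_of_pos hq0, ← Real.exp_add]
    gcongr
    nlinarith
  have hlarge : (n : ℝ) / (p ^ a * M) * q ^ T ≤ q ^ L * (θ / p ^ a + ε) := by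
    have hM0R : (0 : ℝ) < M := by exact_mod_cast hM0
    have hNR : (1 : ℝ) ≤ (p : ℝ) ^ a := one_le_pow₀ (by exact_mod_cast hp.one_lt.le)
    have hxM : Real.log n / Real.log q ≤ (θ + ε) * M := by
      rw [hM] at hxL; push_cast at hxL; linarith
    rw [div_lt_iff₀ hx] at hnx
    calc (n : ℝ) / (p ^ a * M) * q ^ T
        ≤ Real.exp (θ * L * Real.log q) * ((θ + ε) * M) / (p ^ a * M) * q ^ T := by
          gcongr
          exact hnx.le.trans (by gcongr)
      _ = (q ^ T * Real.exp (θ * L * Real.log q)) * ((θ + ε) / p ^ a) := by field_simp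
      _ ≤ q ^ L * ((θ + ε) / p ^ a) := by gcongr
      _ ≤ q ^ L * (θ / p ^ a + ε) := by
          rw [add_div]
          gcongr
          exact div_le_self hε.le hNR
  have hzero := hpow_sub T hCT hTL
  have hH : (0 : ℝ) < (q : ℝ) ^ L := by positivity
  nlinarith
end

section
/- Let k ≥ 2 and let q ≥ 3 be a prime power. If n ≥ k+1 and F ∈ F_q[x] is monic of degree n, then for every integer h with n/(k+1) ≤ h < n, the interval I_q(F,h) contains a k-free polynomial. -/
open Polynomial

section KFreeIntervals

variable {K : Type*} [Field K]

theorem mul_natDegree_sub_le_natDegree_pow_sub_pow {A B : K[X]} {d k : ℕ} (hk : k ≠ 0)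
    (hA : A.Monic) (hB : B.Monic) (hAd : A.natDegree = d) (hBd : B.natDegree = d)
    (hAB : A ≠ B) :
    A ^ k - B ^ k ≠ 0 ∧ k * (A - B).natDegree ≤ (A ^ k - B ^ k).natDegree := by
  obtain ⟨p, hp⟩ := ExpChar.exists K
  have key : ∃ a m : ℕ, k = p ^ a * m ∧ (m : K) ≠ 0 := by
    rcases hp with _ | hprime
    · exact ⟨0, k, by simp, by exact_mod_cast hk⟩
    · obtain ⟨a, m, hm, rfl⟩ := Nat.exists_eq_pow_mul_and_not_dvd hk p hprime.ne_one
      exact ⟨a, m, rfl, fun h0 => hm ((CharP.cast_eq_zero_iff K p m).1 h0)⟩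
  obtain ⟨a, m, rfl, hm⟩ := key
  have : ExpChar K[X] p := inferInstance
  have hpow : A ^ (p ^ a * m) - B ^ (p ^ a * m) = (A ^ m - B ^ m) ^ p ^ a := by
    rw [sub_pow_expChar_pow, ← pow_mul, ← pow_mul, mul_comm]
  have hm0 : m ≠ 0 := fun h0 => hm (by simp [h0])
  set S : K[X] := ∑ i ∈ Finset.range m, A ^ i * B ^ (m - 1 - i) with hS
  have hmul : S * (A - B) = A ^ m - B ^ m := (Commute.all A B).geom_sum₂_mul m
  have hcoeff : S.coeff ((m - 1) * d) = m := by
    rw [hS, finsetSum_coeff]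
    have : ∀ i ∈ Finset.range m, (A ^ i * B ^ (m - 1 - i)).coeff ((m - 1) * d) = 1 := by
      intro i hi
      have hi' : i < m := Finset.mem_range.1 hi
      have hmon : (A ^ i * B ^ (m - 1 - i)).Monic := (hA.pow _).mul (hB.pow _)
      have hdeg : (A ^ i * B ^ (m - 1 - i)).natDegree = (m - 1) * d := by
        rw [(hA.pow _).natDegree_mul (hB.pow _), hA.natDegree_pow, hB.natDegree_pow, hAd, hBd,
          ← add_mul]
        congr 1
        omega
      rw [← hdeg]
      exact hmon
    rw [Finset.sum_congr rfl this]
    simp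
  have hcoeff' : S.coeff ((m - 1) * d) ≠ 0 := by rwa [hcoeff]
  have hS0 : S ≠ 0 := fun h0 => hcoeff' (by simp [h0])
  have hsub : A - B ≠ 0 := sub_ne_zero.2 hAB
  have hle : (A - B).natDegree ≤ d :=
    (natDegree_sub_le A B).trans (by simp [hAd, hBd])
  rw [hpow, ← hmul]
  refine ⟨pow_ne_zero _ (mul_ne_zero hS0 hsub), ?_⟩
  rw [natDegree_pow, natDegree_mul hS0 hsub, mul_assoc]
  refine Nat.mul_le_mul_left _ ?_
  calc m * (A - B).natDegree = (m - 1) * (A - B).natDegree + (A - B).natDegree := by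
        obtain ⟨m', rfl⟩ := Nat.exists_eq_succ_of_ne_zero hm0
        simp [add_mul]
    _ ≤ S.natDegree + (A - B).natDegree := by
        have := le_natDegree_of_ne_zero hcoeff'
        have := Nat.mul_le_mul_left (m - 1) hle
        omega

theorem degree_sub_lt_of_monic {A B : K[X]} {d : ℕ} (hA : A.Monic) (hB : B.Monic)
    (hAd : A.natDegree = d) (hBd : B.natDegree = d) : (A - B).degree < d := by
  have hA' : A.degree = d := by rw [degree_eq_natDegree hA.ne_zero, hAd]
  have hB' : B.degree = d := by rw [degree_eq_natDegree hB.ne_zero, hBd]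
  rw [← hA']
  exact degree_sub_lt_left (hA'.trans hB'.symm) hA.ne_zero
    (hA.leadingCoeff.trans hB.leadingCoeff.symm)

theorem monic_and_natDegree_of_degree_sub_le {F Q : K[X]} {h : ℕ} (hF : F.Monic)
    (hh : h < F.natDegree) (hQ : (F - Q).degree ≤ h) :
    Q.Monic ∧ Q.natDegree = F.natDegree := by
  have hlt : (F - Q).degree < F.degree := by
    rw [degree_eq_natDegree hF.ne_zero]
    exact hQ.trans_lt (by exact_mod_cast hh)
  have hQF : Q = F - (F - Q) := by ring
  rw [hQF]
  exact ⟨hF.sub_of_left hlt, natDegree_sub_eq_left_of_natDegree_lt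
    (by
      have := natDegree_le_of_degree_le hQ
      omega)⟩

theorem natDegree_sub_le_of_degree_sub_le {F A B : K[X]} {h : ℕ} (hA : (F - A).degree ≤ h)
    (hB : (F - B).degree ≤ h) : (A - B).natDegree ≤ h := by
  have : A - B = (F - B) - (F - A) := by ring
  rw [this]
  exact natDegree_le_of_degree_le ((degree_sub_le _ _).trans (max_le hB hA))

variable [Fintype K]

theorem finite_and_ncard_le_of_degree_sub_lt {T : Set K[X]} {m : ℕ}
    (hT : ∀ A ∈ T, ∀ B ∈ T, (A - B).degree < m) :
    T.Finite ∧ T.ncard ≤ Fintype.card K ^ m := by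
  have hfin : Finite (degreeLT K m) := Finite.of_equiv _ (degreeLTEquiv K m).toEquiv.symm
  have hcard : ((degreeLT K m : Submodule K K[X]) : Set K[X]).ncard = Fintype.card K ^ m := by
    rw [← Nat.card_coe_set_eq]
    refine (Nat.card_congr (degreeLTEquiv K m).toEquiv).trans ?_
    simp
  rcases T.eq_empty_or_nonempty with rfl | ⟨P, hP⟩
  · simp
  have hfin' : ((degreeLT K m : Submodule K K[X]) : Set K[X]).Finite := hfin
  have hmaps : Set.MapsTo (fun A => A - P) T (degreeLT K m : Submodule K K[X]) := fun A hA =>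
    mem_degreeLT.2 (hT A hA P hP)
  have hinj : Set.InjOn (fun A => A - P) T := fun A _ B _ h => sub_left_injective h
  refine ⟨hfin'.of_injOn hmaps hinj, ?_⟩
  rw [← hcard]
  exact Set.ncard_le_ncard_of_injOn _ hmaps hinj hfin'

theorem finite_and_ncard_monic_le (d : ℕ) :
    {P : K[X] | P.Monic ∧ P.natDegree = d}.Finite ∧
      {P : K[X] | P.Monic ∧ P.natDegree = d}.ncard ≤ Fintype.card K ^ d :=
  finite_and_ncard_le_of_degree_sub_lt fun _ hA _ hB =>
    degree_sub_lt_of_monic hA.1 hB.1 hA.2 hB.2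

variable (K) in
/-- The monic polynomials of degree `d` over a finite field. -/
noncomputable def monicFinset (d : ℕ) : Finset K[X] :=
  (finite_and_ncard_monic_le (K := K) d).1.toFinset

theorem mem_monicFinset {d : ℕ} {P : K[X]} :
    P ∈ monicFinset K d ↔ P.Monic ∧ P.natDegree = d := by
  simp [monicFinset]

theorem card_monicFinset_le (d : ℕ) : (monicFinset K d).card ≤ Fintype.card K ^ d := by
  rw [monicFinset, ← Set.ncard_eq_toFinset_card _ (finite_and_ncard_monic_le d).1]
  exact (finite_and_ncard_monic_le d).2

theorem card_le_of_degree_sub_lt {T : Finset K[X]} {m : ℕ}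
    (hT : ∀ A ∈ T, ∀ B ∈ T, (A - B).degree < m) : T.card ≤ Fintype.card K ^ m := by
  rw [← Set.ncard_coe_finset]
  exact (finite_and_ncard_le_of_degree_sub_lt (T := (T : Set K[X])) hT).2

open Classical in
theorem card_monicFinset_filter_coeff_zero_ne_le {d : ℕ} (hd : 1 ≤ d) :
    ((monicFinset K d).filter fun P => P.coeff 0 ≠ 0).card ≤
      (Fintype.card K - 1) * Fintype.card K ^ (d - 1) := by
  calc _ ≤ (({0}ᶜ : Finset K) ×ˢ monicFinset K (d - 1)).card := by
        refine Finset.card_le_card_of_injOn (fun P => (P.coeff 0, P.divX)) ?_ ?_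
        · intro P hP
          obtain ⟨hP, hP0⟩ := Finset.mem_filter.1 hP
          obtain ⟨hm, hdeg⟩ := mem_monicFinset.1 hP
          have hmem : P.divX ∈ monicFinset K (d - 1) := by
            have hdeg' : P.divX.natDegree = d - 1 := by
              rw [natDegree_divX_eq_natDegree_tsub_one, hdeg]
            refine mem_monicFinset.2 ⟨?_, hdeg'⟩
            rw [Monic, leadingCoeff, hdeg', coeff_divX, Nat.sub_add_cancel hd, ← hdeg]
            exact hm
          simp [hP0, hmem]
        · intro P _ Q _ hPQ
          simp only [Prod.mk.injEq] at hPQ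
          rw [← divX_mul_X_add P, ← divX_mul_X_add Q, hPQ.1, hPQ.2]
    _ ≤ _ := by
        rw [Finset.card_product, Finset.card_compl, Finset.card_singleton]
        exact Nat.mul_le_mul_left _ (card_monicFinset_le _)

theorem finite_and_ncard_interval (F : K[X]) (h : ℕ) :
    {Q : K[X] | (F - Q).degree ≤ h}.Finite ∧
      Fintype.card K ^ (h + 1) ≤ {Q : K[X] | (F - Q).degree ≤ h}.ncard := by
  have hlt : ∀ A : K[X], A.degree < ((h + 1 : ℕ) : WithBot ℕ) ↔ A.degree ≤ h := fun A => by
    rw [degree_lt_iff_coeff_zero, degree_le_iff_coeff_zero]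
    simp
  have hfin : {Q : K[X] | (F - Q).degree ≤ h}.Finite := by
    refine (finite_and_ncard_le_of_degree_sub_lt (m := h + 1) ?_).1
    intro A hA B hB
    rw [hlt]
    have : A - B = (F - B) - (F - A) := by ring
    rw [this]
    exact (degree_sub_le _ _).trans (max_le hB hA)
  refine ⟨hfin, ?_⟩
  have hcard : ((degreeLT K (h + 1) : Submodule K K[X]) : Set K[X]).ncard =
      Fintype.card K ^ (h + 1) := by
    rw [← Nat.card_coe_set_eq]
    refine (Nat.card_congr (degreeLTEquiv K (h + 1)).toEquiv).trans ?_
    simp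
  rw [← hcard]
  refine Set.ncard_le_ncard_of_injOn (fun A => F - A) ?_ ?_ hfin
  · intro A hA
    have := (hlt A).1 (mem_degreeLT.1 hA)
    simpa using this
  · intro A _ B _ hAB
    exact sub_right_injective hAB

/-- The interval of polynomials `Q` with `deg (F - Q) ≤ h`. -/
noncomputable def intervalFinset (F : K[X]) (h : ℕ) : Finset K[X] :=
  (finite_and_ncard_interval F h).1.toFinset

theorem mem_intervalFinset {F Q : K[X]} {h : ℕ} :
    Q ∈ intervalFinset F h ↔ (F - Q).degree ≤ h := by
  simp [intervalFinset]

theorem le_card_intervalFinset (F : K[X]) (h : ℕ) :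
    Fintype.card K ^ (h + 1) ≤ (intervalFinset F h).card := by
  rw [intervalFinset, ← Set.ncard_eq_toFinset_card _ (finite_and_ncard_interval F h).1]
  exact (finite_and_ncard_interval F h).2

open Classical in
theorem card_interval_filter_dvd_le (F : K[X]) (h : ℕ) {G : K[X]} (hG : G ≠ 0) :
    ((intervalFinset F h).filter fun Q => G ∣ Q).card ≤
      Fintype.card K ^ (h + 1 - G.natDegree) := by
  set T := (intervalFinset F h).filter fun Q => G ∣ Q with hT
  have hmem : ∀ Q ∈ T, (F - Q).degree ≤ h ∧ G * (Q / G) = Q := fun Q hQ => by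
    obtain ⟨h1, h2⟩ := Finset.mem_filter.1 hQ
    exact ⟨mem_intervalFinset.1 h1, EuclideanDomain.mul_div_cancel' hG h2⟩
  have hinj : Set.InjOn (fun Q => Q / G) (T : Set K[X]) := fun A hA B hB hAB => by
    rw [← (hmem A hA).2, ← (hmem B hB).2]
    exact congrArg _ hAB
  rw [← Finset.card_image_of_injOn hinj]
  refine card_le_of_degree_sub_lt ?_
  intro A' hA' B' hB'
  obtain ⟨A, hA, rfl⟩ := Finset.mem_image.1 hA'
  obtain ⟨B, hB, rfl⟩ := Finset.mem_image.1 hB'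
  by_cases h0 : A / G - B / G = 0
  · simp [h0]
  have hle := natDegree_sub_le_of_degree_sub_le (hmem A hA).1 (hmem B hB).1
  rw [← (hmem A hA).2, ← (hmem B hB).2, ← mul_sub, natDegree_mul hG h0] at hle
  rw [degree_eq_natDegree h0]
  exact_mod_cast (by omega : (A / G - B / G).natDegree < h + 1 - G.natDegree)

open Classical in
theorem card_interval_filter_exists_pow_dvd_le {F : K[X]} {h d k m : ℕ} (hF : F.Monic)
    (hh : h < F.natDegree)
    (hm : ∀ A B R : K[X], A.Monic → B.Monic → R.Monic → A.natDegree = d → B.natDegree = d →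
      R.natDegree = F.natDegree - k * d → A ≠ B → ((A ^ k - B ^ k) * R).natDegree ≤ h →
      (A - B).natDegree < m) :
    ((intervalFinset F h).filter fun Q => ∃ P ∈ monicFinset K d, P ^ k ∣ Q).card ≤
      Fintype.card K ^ (F.natDegree - k * d + m) := by
  let fiber : K[X] → Finset K[X] := fun R =>
    (monicFinset K d).filter fun P => (F - P ^ k * R).degree ≤ h
  have hfiber : ∀ R ∈ monicFinset K (F.natDegree - k * d),
      ((fiber R).image fun P => P ^ k * R).card ≤ Fintype.card K ^ m := by
    intro R hR
    refine Finset.card_image_le.trans (card_le_of_degree_sub_lt ?_)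
    intro A hA B hB
    obtain ⟨hA1, hA2⟩ := Finset.mem_filter.1 hA
    obtain ⟨hB1, hB2⟩ := Finset.mem_filter.1 hB
    rw [mem_monicFinset] at hA1 hB1 hR
    rcases eq_or_ne A B with rfl | hAB
    · simp
    have hle := natDegree_sub_le_of_degree_sub_le hA2 hB2
    rw [← sub_mul] at hle
    rw [degree_eq_natDegree (sub_ne_zero.2 hAB)]
    exact_mod_cast hm A B R hA1.1 hB1.1 hR.1 hA1.2 hB1.2 hR.2 hAB hle
  calc _ ≤ ((monicFinset K (F.natDegree - k * d)).biUnion fun R =>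
        (fiber R).image fun P => P ^ k * R).card := by
        refine Finset.card_le_card ?_
        intro Q hQ
        obtain ⟨hQ, P, hP, R, rfl⟩ := Finset.mem_filter.1 hQ
        have hQ' := mem_intervalFinset.1 hQ
        obtain ⟨hmon, hdeg⟩ := monic_and_natDegree_of_degree_sub_le hF hh hQ'
        have hP' := mem_monicFinset.1 hP
        have hR : R.Monic := (hP'.1.pow k).of_mul_monic_left hmon
        refine Finset.mem_biUnion.2 ⟨R, mem_monicFinset.2 ⟨hR, ?_⟩,
          Finset.mem_image.2 ⟨P, Finset.mem_filter.2 ⟨hP, hQ'⟩, rfl⟩⟩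
        rw [(hP'.1.pow k).natDegree_mul hR, hP'.1.natDegree_pow, hP'.2] at hdeg
        omega
    _ ≤ (monicFinset K (F.natDegree - k * d)).card * Fintype.card K ^ m :=
        Finset.card_biUnion_le_card_mul _ _ _ hfiber
    _ ≤ _ := by
        rw [pow_add]
        exact Nat.mul_le_mul_right _ (card_monicFinset_le _)

open Classical in
theorem card_interval_filter_exists_pow_dvd_mul_pow_le {F : K[X]} {h d k s : ℕ} (hF : F.Monic)
    (hh : h < F.natDegree) (hn : F.natDegree ≤ (k + 1) * h) (hk : 2 ≤ k) (hd : h < d)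
    (hs : s + 1 ≤ k ∨ s = 2 ∧ k = 2 ∧ (2 : K) ≠ 0) :
    ((intervalFinset F h).filter fun Q => ∃ P ∈ monicFinset K d, P ^ k ∣ Q).card *
      (Fintype.card K ^ s) ^ (d - h) ≤ Fintype.card K ^ (h + 1) := by
  have hq : 0 < Fintype.card K := Fintype.card_pos
  by_cases hkd : F.natDegree < k * d
  · have : ((intervalFinset F h).filter fun Q => ∃ P ∈ monicFinset K d, P ^ k ∣ Q) = ∅ := by
      refine Finset.filter_eq_empty_iff.2 ?_
      rintro Q hQ ⟨P, hP, hPQ⟩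
      obtain ⟨hmon, hdeg⟩ :=
        monic_and_natDegree_of_degree_sub_le hF hh (mem_intervalFinset.1 hQ)
      have := natDegree_le_of_dvd hPQ hmon.ne_zero
      rw [natDegree_pow, (mem_monicFinset.1 hP).2] at this
      omega
    rw [this]
    simp
  obtain ⟨i, rfl⟩ : ∃ i, d = h + i := ⟨d - h, by omega⟩
  set e := F.natDegree - k * (h + i) with he
  have hei : e + k * i ≤ h := by
    have h1 : (k + 1) * h = k * h + h := by ring
    have h2 : k * (h + i) = k * h + k * i := by ring
    omega
  rcases hs with hs | ⟨rfl, rfl, h2⟩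
  · have hcard := card_interval_filter_exists_pow_dvd_le (m := (h - e) / k + 1) (d := h + i)
      (k := k) hF hh (by
        intro A B R hA hB hR hAd hBd hRd hAB hle
        obtain ⟨hne, hdeg⟩ :=
          mul_natDegree_sub_le_natDegree_pow_sub_pow (by omega : k ≠ 0) hA hB hAd hBd hAB
        rw [natDegree_mul hne hR.ne_zero, hRd] at hle
        rw [Nat.lt_succ_iff, Nat.le_div_iff_mul_le (by omega), mul_comm]
        omega)
    refine (Nat.mul_le_mul_right _ hcard).trans ?_
    rw [← pow_mul, ← pow_add]
    refine Nat.pow_le_pow_right hq ?_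
    rw [← he, Nat.add_sub_cancel_left]
    have h1 : i ≤ (h - e) / k := by
      rw [Nat.le_div_iff_mul_le (by omega), mul_comm]
      omega
    have h2 : k * ((h - e) / k) ≤ h - e := Nat.mul_div_le _ _
    have h3 : s * i ≤ (k - 1) * ((h - e) / k) := Nat.mul_le_mul (by omega) h1
    have h4 : (k - 1) * ((h - e) / k) + (h - e) / k = k * ((h - e) / k) := by
      obtain ⟨k', rfl⟩ : ∃ k', k = k' + 1 := ⟨k - 1, by omega⟩
      simp [add_mul]
    omega
  · have hcard := card_interval_filter_exists_pow_dvd_le (m := 0) (d := h + i)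
      (k := 2) hF hh (by
        intro A B R hA hB hR hAd hBd hRd hAB hle
        exfalso
        have hcoeff : (A + B).coeff (h + i) ≠ 0 := by
          have h1 : A.coeff (h + i) = 1 := hAd ▸ hA
          have h1' : B.coeff (h + i) = 1 := hBd ▸ hB
          rw [coeff_add, h1, h1']
          norm_num
          exact h2
        have hne : A + B ≠ 0 := fun h0 => hcoeff (by simp [h0])
        have := le_natDegree_of_ne_zero hcoeff
        rw [sq_sub_sq, natDegree_mul (mul_ne_zero hne (sub_ne_zero.2 hAB)) hR.ne_zero,
          natDegree_mul hne (sub_ne_zero.2 hAB)] at hle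
        omega)
    refine (Nat.mul_le_mul_right _ hcard).trans ?_
    rw [← pow_mul, ← pow_add]
    refine Nat.pow_le_pow_right hq ?_
    omega

end KFreeIntervals

theorem sum_pow_mul_pow_sub_le (q h m : ℕ) (hq : 1 ≤ q) (hm : 1 ≤ m) (hmh : m ≤ h) :
    ∑ d ∈ Finset.Icc 1 m, ((q - 1) * q ^ (d - 1)) * q ^ (h + 1 - 2 * d) + q ^ (h - m) + q ≤
      q ^ h + q ^ m := by
  induction m, hm using Nat.le_induction with
  | base =>
    obtain ⟨h, rfl⟩ : ∃ h', h = h' + 1 := ⟨h - 1, by omega⟩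
    obtain ⟨q, rfl⟩ : ∃ q', q = q' + 1 := ⟨q - 1, by omega⟩
    simp
    ring_nf
    omega
  | succ m hm ih =>
    specialize ih (by omega)
    rw [Finset.sum_Icc_succ_top (by omega)]
    have key : ((q - 1) * q ^ (m + 1 - 1)) * q ^ (h + 1 - 2 * (m + 1)) + q ^ (h - (m + 1)) + q ^ m
        ≤ q ^ (h - m) + q ^ (m + 1) := by
      obtain ⟨t, rfl⟩ : ∃ t, h = m + 1 + t := ⟨h - (m + 1), by omega⟩
      have e1 : m + 1 + t - m = t + 1 := by omega
      have e2 : m + 1 + t - (m + 1) = t := by omega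
      obtain ⟨q, rfl⟩ : ∃ q', q = q' + 1 := ⟨q - 1, by omega⟩
      rw [e1, e2, Nat.add_sub_cancel, Nat.add_sub_cancel]
      rcases le_total m t with hmt | hmt
      · have e3 : m + 1 + t + 1 - 2 * (m + 1) = t - m := by omega
        rw [e3, mul_assoc, ← pow_add, Nat.add_sub_cancel' hmt]
        have : (q + 1) ^ m ≤ (q + 1) ^ (m + 1) := Nat.pow_le_pow_right (by omega) (by omega)
        rw [pow_succ (q + 1) t]
        nlinarith
      · have e3 : m + 1 + t + 1 - 2 * (m + 1) = 0 := by omega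
        have : (q + 1) ^ t ≤ (q + 1) ^ (t + 1) := Nat.pow_le_pow_right (by omega) (by omega)
        rw [e3, pow_succ (q + 1) m]
        nlinarith
    omega

theorem mul_sum_Icc_add_div_pow_le {a : ℕ → ℝ} {B r : ℝ} {h : ℕ} (hr : 1 ≤ r)
    (ha : ∀ d, h < d → a d * r ^ (d - h) ≤ B) (m : ℕ) :
    (r - 1) * ∑ d ∈ Finset.Icc (h + 1) (h + m), a d + B / r ^ m ≤ B := by
  have hr0 : 0 < r := by linarith
  induction m with
  | zero => simp
  | succ m ih =>
    rw [← add_assoc, Finset.sum_Icc_succ_top (by omega)]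
    have h1 := ha (h + m + 1) (by omega)
    rw [show h + m + 1 - h = m + 1 by omega, ← le_div_iff₀ (by positivity)] at h1
    have h2 : B / r ^ m = r * (B / r ^ (m + 1)) := by
      rw [pow_succ]
      field_simp
    have h3 := mul_le_mul_of_nonneg_left h1 (sub_nonneg.2 hr)
    rw [mul_add]
    linarith

theorem two_ne_zero_of_card_eq_three {K : Type*} [Field K] [Fintype K]
    (hq : Fintype.card K = 3) : (2 : K) ≠ 0 := by
  intro h2
  have h3 : ((Fintype.card K : ℕ) : K) = 0 := Nat.cast_card_eq_zero K
  rw [hq] at h3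
  have : (1 : K) = ((3 : ℕ) : K) - 2 := by norm_num
  rw [h3, h2] at this
  simp at this

open Classical in
theorem intervalFinset_subset {K : Type*} [Field K] [Fintype K] {F : K[X]} {h k : ℕ}
    (hF : F.Monic) (hh : h < F.natDegree) (hh0 : 1 ≤ h) (hk : 1 ≤ k)
    (hno : ∀ Q : K[X], (F - Q).degree ≤ h → ∃ P : K[X], Irreducible P ∧ P ^ k ∣ Q) :
    intervalFinset F h ⊆ (intervalFinset F h).filter (fun Q => X ^ k ∣ Q) ∪
      ((Finset.Icc 1 h).biUnion fun d => ((monicFinset K d).filter fun P => P.coeff 0 ≠ 0).biUnion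
        fun P => (intervalFinset F h).filter fun Q => P ^ k ∣ Q) ∪
      (Finset.Icc (h + 1) (h + F.natDegree)).biUnion fun d =>
        (intervalFinset F h).filter fun Q => ∃ P ∈ monicFinset K d, P ^ k ∣ Q := by
  intro Q hQ
  obtain ⟨P₀, hP₀, hPQ₀⟩ := hno Q (mem_intervalFinset.1 hQ)
  obtain ⟨hmon, hdeg⟩ := monic_and_natDegree_of_degree_sub_le hF hh (mem_intervalFinset.1 hQ)
  obtain ⟨P, hPm, hP, hPQ⟩ : ∃ P : K[X], P.Monic ∧ Irreducible P ∧ P ^ k ∣ Q :=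
    ⟨normalize P₀, monic_normalize hP₀.ne_zero,
      (normalize_associated P₀).symm.irreducible hP₀,
      ((normalize_associated P₀).pow_pow.dvd).trans hPQ₀⟩
  have hPd : P.natDegree ≤ F.natDegree := by
    have := natDegree_le_of_dvd hPQ hmon.ne_zero
    rw [natDegree_pow, hdeg] at this
    nlinarith
  have hP1 : 1 ≤ P.natDegree := hP.natDegree_pos
  have hPmem : P ∈ monicFinset K P.natDegree := mem_monicFinset.2 ⟨hPm, rfl⟩
  simp only [Finset.mem_union, Finset.mem_biUnion, Finset.mem_filter, Finset.mem_Icc]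
  by_cases hle : P.natDegree ≤ h
  · left
    by_cases h0 : P.coeff 0 = 0
    · left
      have hX : Associated X P := irreducible_X.associated_of_dvd hP (X_dvd_iff.2 h0)
      exact ⟨hQ, (hX.pow_pow.dvd).trans hPQ⟩
    · right
      exact ⟨P.natDegree, ⟨hP1, hle⟩, P, ⟨hPmem, h0⟩, hQ, hPQ⟩
  · right
    exact ⟨P.natDegree, ⟨by omega, by omega⟩, hQ, P, hPmem, hPQ⟩

theorem exists_pow_not_dvd_of_natDegree_le {K : Type*} [Field K] [Fintype K] {F : K[X]} {h k : ℕ}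
    (hq3 : 3 ≤ Fintype.card K) (hk : 2 ≤ k) (hF : F.Monic) (hh : h < F.natDegree)
    (hn : F.natDegree ≤ (k + 1) * h) :
    ∃ Q : K[X], (F - Q).degree ≤ h ∧ ∀ P : K[X], Irreducible P → ¬ P ^ k ∣ Q := by
  classical
  by_contra! hno
  have hh0 : 1 ≤ h := by
    rcases Nat.eq_zero_or_pos h with rfl | h0
    · simp at hn
      omega
    · exact h0
  set q := Fintype.card K with hqdef
  set S := intervalFinset F h with hS
  have hSle : q ^ (h + 1) ≤ S.card := le_card_intervalFinset F h
  have hcover := Finset.card_le_card (intervalFinset_subset hF hh hh0 (by omega) hno)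
  rw [← hS] at hcover
  have hsmall : ∀ P : K[X], P.Monic →
      (S.filter fun Q => P ^ k ∣ Q).card ≤ q ^ (h + 1 - 2 * P.natDegree) := by
    intro P hP
    refine (card_interval_filter_dvd_le F h (hP.pow k).ne_zero).trans ?_
    rw [hP.natDegree_pow]
    have := Nat.mul_le_mul_right P.natDegree hk
    exact Nat.pow_le_pow_right (by omega) (by omega)
  have hX : (S.filter fun Q => (X : K[X]) ^ k ∣ Q).card ≤ q ^ (h - 1) := by
    have := hsmall X monic_X
    rwa [natDegree_X, show h + 1 - 2 * 1 = h - 1 by omega] at this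
  have hmid : ((Finset.Icc 1 h).biUnion fun d =>
      ((monicFinset K d).filter fun P => P.coeff 0 ≠ 0).biUnion
        fun P => S.filter fun Q => P ^ k ∣ Q).card + 1 ≤ 2 * q ^ h := by
    have h1 : ((Finset.Icc 1 h).biUnion fun d =>
      ((monicFinset K d).filter fun P => P.coeff 0 ≠ 0).biUnion
        fun P => S.filter fun Q => P ^ k ∣ Q).card ≤
        ∑ d ∈ Finset.Icc 1 h, ((q - 1) * q ^ (d - 1)) * q ^ (h + 1 - 2 * d) := by
      refine Finset.card_biUnion_le.trans (Finset.sum_le_sum ?_)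
      intro d hd
      refine (Finset.card_biUnion_le_card_mul _ _ (q ^ (h + 1 - 2 * d)) ?_).trans
        (Nat.mul_le_mul_right _
          (card_monicFinset_filter_coeff_zero_ne_le (Finset.mem_Icc.1 hd).1))
      intro P hP
      obtain ⟨hPm, rfl⟩ := mem_monicFinset.1 (Finset.mem_filter.1 hP).1
      exact hsmall P hPm
    have h2 := sum_pow_mul_pow_sub_le q h h (by omega) hh0 le_rfl
    omega
  obtain ⟨s, hs, hsq⟩ : ∃ s : ℕ, (s + 1 ≤ k ∨ s = 2 ∧ k = 2 ∧ (2 : K) ≠ 0) ∧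
      (q = 3 ∧ s = 2 ∨ 4 ≤ q ∧ s = 1) := by
    rcases hq3.eq_or_lt with hq | hq
    · refine ⟨2, ?_, Or.inl ⟨hq.symm, rfl⟩⟩
      rcases hk.eq_or_lt with hk2 | hk2
      · exact Or.inr ⟨rfl, hk2.symm, two_ne_zero_of_card_eq_three hq.symm⟩
      · exact Or.inl hk2
    · exact ⟨1, Or.inl hk, Or.inr ⟨hq, rfl⟩⟩
  set a : ℕ → ℕ := fun d => (S.filter fun Q => ∃ P ∈ monicFinset K d, P ^ k ∣ Q).card with ha
  have hlarge : ((q : ℝ) ^ s - 1) * ∑ d ∈ Finset.Icc (h + 1) (h + F.natDegree), (a d : ℝ) ≤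
      (q : ℝ) ^ (h + 1) := by
    have hr : (1 : ℝ) ≤ (q : ℝ) ^ s := one_le_pow₀ (by exact_mod_cast (by omega : 1 ≤ q))
    have := mul_sum_Icc_add_div_pow_le (a := fun d => (a d : ℝ)) (h := h)
      (B := (q : ℝ) ^ (h + 1)) hr
      (fun d hd => by
        exact_mod_cast card_interval_filter_exists_pow_dvd_mul_pow_le hF hh hn hk hd hs)
      F.natDegree
    have hpos : 0 ≤ (q : ℝ) ^ (h + 1) / ((q : ℝ) ^ s) ^ F.natDegree := by positivity
    linarith
  have htotal : q ^ (h + 1) + 1 ≤ q ^ (h - 1) + 2 * q ^ h +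
      ∑ d ∈ Finset.Icc (h + 1) (h + F.natDegree), a d := by
    have h1 := Finset.card_union_le (S.filter (fun Q => X ^ k ∣ Q) ∪
      ((Finset.Icc 1 h).biUnion fun d => ((monicFinset K d).filter fun P => P.coeff 0 ≠ 0).biUnion
        fun P => S.filter fun Q => P ^ k ∣ Q))
      ((Finset.Icc (h + 1) (h + F.natDegree)).biUnion fun d =>
        S.filter fun Q => ∃ P ∈ monicFinset K d, P ^ k ∣ Q)
    have h2 := Finset.card_union_le (S.filter (fun Q => X ^ k ∣ Q))
      ((Finset.Icc 1 h).biUnion fun d => ((monicFinset K d).filter fun P => P.coeff 0 ≠ 0).biUnion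
        fun P => S.filter fun Q => P ^ k ∣ Q)
    have h3 : ((Finset.Icc (h + 1) (h + F.natDegree)).biUnion fun d =>
        S.filter fun Q => ∃ P ∈ monicFinset K d, P ^ k ∣ Q).card ≤
        ∑ d ∈ Finset.Icc (h + 1) (h + F.natDegree), a d := Finset.card_biUnion_le
    omega
  have htotal' : (q : ℝ) ^ (h + 1) + 1 ≤ (q : ℝ) ^ (h - 1) + 2 * (q : ℝ) ^ h +
      ∑ d ∈ Finset.Icc (h + 1) (h + F.natDegree), (a d : ℝ) := by exact_mod_cast htotal
  set L : ℝ := ∑ d ∈ Finset.Icc (h + 1) (h + F.natDegree), (a d : ℝ)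
  obtain ⟨h', rfl⟩ : ∃ h', h = h' + 1 := ⟨h - 1, by omega⟩
  rw [Nat.add_sub_cancel, pow_succ, pow_succ] at htotal'
  rw [pow_succ, pow_succ] at hlarge
  have hx : 0 < (q : ℝ) ^ h' := pow_pos (by exact_mod_cast (by omega : 0 < q)) _
  set x : ℝ := (q : ℝ) ^ h'
  rcases hsq with ⟨hq, rfl⟩ | ⟨hq, rfl⟩
  · rw [hq] at htotal' hlarge
    norm_num at htotal' hlarge
    linarith
  · have hq' : (4 : ℝ) ≤ q := by exact_mod_cast hq
    rw [pow_one] at hlarge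
    have h1 := mul_le_mul_of_nonneg_left htotal' (by linarith : (0 : ℝ) ≤ (q : ℝ) - 1)
    have h2 : x * (((q : ℝ) - 1) * (q * q - 2 * q - 1) - q * q) < 0 := by nlinarith
    have h3 : 0 ≤ ((q : ℝ) - 1) * (q * q - 2 * q - 1) - q * q := by
      nlinarith [mul_nonneg (sub_nonneg.2 hq') (sub_nonneg.2 hq'),
        mul_nonneg (mul_nonneg (sub_nonneg.2 hq') (sub_nonneg.2 hq')) (sub_nonneg.2 hq')]
    exact absurd h2 (not_lt.2 (mul_nonneg hx.le h3))

/-- **Theorem 3.** Let `k ≥ 2` and `q ≥ 3` a prime power. If `n ≥ k+1` and `F` is monic of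
degree `n`, then for every integer `h` with `n/(k+1) ≤ h < n`, the interval `I_q(F,h)`
contains a `k`-free polynomial. -/
theorem kfree_in_intervals_n_div_k_add_one
    {Fq : Type} [Field Fq] [Fintype Fq] (q k : ℕ) (hq : Fintype.card Fq = q)
    (hq3 : 3 ≤ q) (hk : 2 ≤ k) (n : ℕ) (hn : k + 1 ≤ n)
    (F : Polynomial Fq) (hF : F.Monic) (hFdeg : F.natDegree = n)
    (h : ℕ) (hh1 : (n : ℝ) / (k + 1) ≤ (h : ℝ)) (hh2 : h < n) :
    ∃ Q : Polynomial Fq, (F - Q).degree ≤ (h : WithBot ℕ) ∧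
      ∀ P : Polynomial Fq, Irreducible P → ¬ P ^ k ∣ Q := by
  subst hq hFdeg
  refine exists_pow_not_dvd_of_natDegree_le hq3 hk hF hh2 ?_
  rw [div_le_iff₀ (by positivity), mul_comm] at hh1
  exact_mod_cast hh1
end

section
/- Let k ≥ 2 and let q be a prime power of characteristic p with p ∤ (k+1). Suppose either q ≥ 7, or k ≥ 3 and q ≥ 5. If n ≥ k+1 and F ∈ F_q[x] is monic of degree n, then for every integer h with n/(k+2) ≤ h < n, the interval I_q(F,h) contains a k-free polynomial. -/
open Polynomial

/-- Polynomials over a finite field pairwise agreeing from degree `M` on number at most `q ^ M`. -/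
lemma card_le_pow_of_degree_sub_lt {K : Type*} [Field K] [Fintype K] (T : Finset K[X]) (M : ℕ)
    (hT : ∀ u ∈ T, ∀ v ∈ T, (u - v).degree < M) : T.card ≤ Fintype.card K ^ M := by
  have hcard : (Finset.univ : Finset (Fin M → K)).card = Fintype.card K ^ M := by
    simp
  rw [← hcard]
  refine Finset.card_le_card_of_injOn (fun u i => u.coeff i) (by simp) ?_
  intro u hu v hv huv
  ext i
  by_cases hi : i < M
  · exact congrFun huv ⟨i, hi⟩
  · have := coeff_eq_zero_of_degree_lt ((hT u hu v hv).trans_le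
      (by exact_mod_cast not_lt.mp hi : (M : WithBot ℕ) ≤ i))
    rwa [coeff_sub, sub_eq_zero] at this

/-- If every ball of radius `E` contains at most `N` members of a set of monic polynomials of
degree `d`, then the set has at most `N * q ^ (d - E)` members. -/
lemma card_le_mul_pow_of_balls {K : Type*} [Field K] [Fintype K] (S : Finset K[X]) (d E N : ℕ)
    (hE : E ≤ d) (hS : ∀ u ∈ S, u.Monic ∧ u.natDegree = d)
    (hN : ∀ T ⊆ S, (∀ u ∈ T, ∀ v ∈ T, (u - v).degree < E) → T.card ≤ N) :
    S.card ≤ N * Fintype.card K ^ (d - E) := by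
  classical
  have hcard : (Finset.univ : Finset (Fin (d - E) → K)).card = Fintype.card K ^ (d - E) := by
    simp
  rw [← hcard]
  refine Finset.card_le_mul_card_image_of_maps_to
    (f := fun (u : K[X]) (i : Fin (d - E)) => u.coeff (E + i)) (by simp) N ?_
  intro b _
  refine hN _ (Finset.filter_subset _ _) ?_
  intro u hu v hv
  rw [Finset.mem_filter] at hu hv
  rw [degree_lt_iff_coeff_zero]
  intro i hi
  rw [coeff_sub, sub_eq_zero]
  obtain ⟨hum, hud⟩ := hS u hu.1
  obtain ⟨hvm, hvd⟩ := hS v hv.1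
  rcases lt_trichotomy i d with h | h | h
  · have := congrFun (hu.2.trans hv.2.symm) ⟨i - E, by omega⟩
    simpa [Nat.add_sub_cancel' hi] using this
  · subst h
    rw [← hud, hum.coeff_natDegree, hud, ← hvd, hvm.coeff_natDegree]
  · rw [coeff_eq_zero_of_natDegree_lt (by omega), coeff_eq_zero_of_natDegree_lt (by omega)]

/-- If `a * U` and `b * V` are both close to `F`, while `A * U` is close to `B * V`, then
`b * A = a * B`. -/
lemma mul_eq_mul_of_close {K : Type*} [Field K] {F a b U V A B : K[X]} {n h D d : ℕ}
    (hF : F.natDegree ≤ n) (hU : U.natDegree = D) (hV : V.natDegree = D) (hU0 : U ≠ 0)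
    (hV0 : V ≠ 0) (ha : (F - a * U).natDegree ≤ h) (hb : (F - b * V).natDegree ≤ h)
    (hA : A.natDegree ≤ d) (hB : B.natDegree ≤ d) (hd : h + d < D)
    (hAB : n + (A * U - B * V).natDegree < 2 * D) : b * A = a * B := by
  by_contra hne
  have key : (b * A - a * B) * (U * V) =
      F * (A * U - B * V) - (F - b * V) * (A * U) + (F - a * U) * (B * V) := by ring
  have h1 : ((b * A - a * B) * (U * V)).natDegree = (b * A - a * B).natDegree + (D + D) := by
    rw [natDegree_mul (sub_ne_zero.mpr hne) (mul_ne_zero hU0 hV0), natDegree_mul hU0 hV0, hU, hV]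
  have e1 : (F * (A * U - B * V)).natDegree ≤ n + (A * U - B * V).natDegree :=
    natDegree_mul_le.trans (by omega)
  have e2 : ((F - b * V) * (A * U)).natDegree ≤ h + (d + D) :=
    natDegree_mul_le_of_le hb (natDegree_mul_le_of_le hA hU.le)
  have e3 : ((F - a * U) * (B * V)).natDegree ≤ h + (d + D) :=
    natDegree_mul_le_of_le ha (natDegree_mul_le_of_le hB hV.le)
  have h2 := (natDegree_add_le (F * (A * U - B * V) - (F - b * V) * (A * U))
    ((F - a * U) * (B * V))).trans (max_le_max_right _ (natDegree_sub_le _ _))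
  rw [← key, h1] at h2
  omega

lemma exists_sq_factor {K : Type*} [Field K] (u v : K[X]) (d l : ℕ) (hu : u.natDegree ≤ d)
    (hv : v.natDegree ≤ d) : ∃ R : K[X], R.natDegree ≤ l * d ∧
      u ^ (l + 2) - ((l : K[X]) + 2) * u * v ^ (l + 1) + ((l : K[X]) + 1) * v ^ (l + 2)
        = (u - v) ^ 2 * R := by
  induction l with
  | zero => exact ⟨1, by simp, by push_cast; ring⟩
  | succ l ih =>
    obtain ⟨R, hR, h⟩ := ih
    refine ⟨u * R + ((l + 2 : ℕ) : K[X]) * v ^ (l + 1), ?_, ?_⟩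
    · refine natDegree_add_le_of_degree_le ?_ ?_
      · exact (natDegree_mul_le_of_le hu hR).trans (by lia)
      · refine (natDegree_mul_le_of_le (natDegree_natCast _).le
          (natDegree_pow_le_of_le (l + 1) hv)).trans (by lia)
    · push_cast
      linear_combination u * h

/-- The Padé approximant of `(u / v) ^ k` by linear forms, to third order in `u - v`. -/
lemma exists_cube_factor {K : Type*} [Field K] (u v : K[X]) (d l : ℕ) (hu : u.natDegree ≤ d)
    (hv : v.natDegree ≤ d) : ∃ R : K[X], R.natDegree ≤ l * d ∧
      (((l : K[X]) + 3) * v - ((l : K[X]) + 1) * u) * u ^ (l + 2)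
        - (((l : K[X]) + 3) * u - ((l : K[X]) + 1) * v) * v ^ (l + 2) = (u - v) ^ 3 * R := by
  induction l with
  | zero => exact ⟨-1, by simp, by push_cast; ring⟩
  | succ l ih =>
    obtain ⟨R, hR, h⟩ := ih
    obtain ⟨R', hR', h'⟩ := exists_sq_factor u v d (l + 1) hu hv
    refine ⟨u * R - R', ?_, ?_⟩
    · refine (natDegree_sub_le_of_le (natDegree_mul_le_of_le hu hR) hR').trans ?_
      exact max_le (by lia) le_rfl
    · push_cast at h' ⊢
      linear_combination u * h - (u - v) * h'

/-- The cofactor of a `k`-th power close to `F` has the expected degree. -/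
lemma natDegree_cofactor {K : Type*} [Field K] {F m u : K[X]} {k h : ℕ}
    (hh : h < F.natDegree) (hu : u ≠ 0) (hm : (F - m * u ^ k).natDegree ≤ h) :
    m ≠ 0 ∧ m.natDegree + k * u.natDegree = F.natDegree := by
  have h1 : (m * u ^ k).natDegree = F.natDegree := by
    have := natDegree_sub_eq_left_of_natDegree_lt (hm.trans_lt hh)
    rwa [sub_sub_cancel] at this
  have hm0 : m ≠ 0 := by
    rintro rfl
    rw [zero_mul, natDegree_zero] at h1
    omega
  exact ⟨hm0, by rw [← h1, natDegree_mul hm0 (pow_ne_zero _ hu), natDegree_pow]⟩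

lemma eq_of_monic_irreducible_of_dvd {K : Type*} [Field K] {u v : K[X]} (hu : Irreducible u)
    (hv : Irreducible v) (hum : u.Monic) (hvm : v.Monic) (h : u ∣ v) : u = v :=
  eq_of_monic_of_associated hum hvm (hu.associated_of_dvd hv h)

section counting

variable {K : Type*} [Field K] [Fintype K] {F : K[X]} {k h d : ℕ} {S : Finset K[X]}
  {m : K[X] → K[X]}

/-- Spacing bound for the irreducibles of degree `d > h` whose `k`-th power divides a member of the
interval, when the characteristic divides none of `2`, `k`, `k + 1`. -/
lemma card_le_of_char_not_dvd (hk : 2 ≤ k) (h2 : (2 : K) ≠ 0) (hk0 : (k : K) ≠ 0)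
    (hk1 : (k : K) + 1 ≠ 0) (hn : F.natDegree ≤ (k + 2) * h) (hh : h < F.natDegree)
    (hd : h < d) (hS : ∀ u ∈ S, u.Monic ∧ u.natDegree = d ∧ Irreducible u)
    (hm : ∀ u ∈ S, (F - m u * u ^ k).natDegree ≤ h) :
    S.card ≤ 2 * Fintype.card K ^ (h - 1 - (d - h - 1) / 3) := by
  rcases S.eq_empty_or_nonempty with rfl | ⟨u₀, hu₀⟩
  · simp
  obtain ⟨l, rfl⟩ := Nat.exists_eq_add_of_le' hk
  have hdeg : ∀ u ∈ S, m u ≠ 0 ∧ (m u).natDegree + (l + 2) * d = F.natDegree := by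
    intro u hu
    have := natDegree_cofactor hh (hS u hu).1.ne_zero (hm u hu)
    rwa [(hS u hu).2.1] at this
  have hμ := (hdeg u₀ hu₀).2
  set n := F.natDegree with hn_def
  set E := ((l + 2 + 2) * d - n + 2) / 3 with hE
  have hprod : (l + 2 + 2) * d = (l + 2) * d + 2 * d := by ring
  have hprod2 : (l + 2 + 2) * d = (l + 2 + 2) * h + (l + 2 + 2) * (d - h) := by
    rw [← mul_add]; congr 1; omega
  have hprod3 : 4 * (d - h) ≤ (l + 2 + 2) * (d - h) := Nat.mul_le_mul_right _ (by omega)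
  have hprod4 : 2 * d ≤ (l + 2) * d := Nat.mul_le_mul_right _ (by omega)
  have hEd : E ≤ d := by omega
  refine (card_le_mul_pow_of_balls S d E 2 hEd (fun u hu => ⟨(hS u hu).1, (hS u hu).2.1⟩) ?_).trans
    (Nat.mul_le_mul_left _ (Nat.pow_le_pow_right Fintype.card_pos (by omega)))
  intro T hTS hT
  have hlt : ∀ u ∈ T, ∀ v ∈ T, u ≠ v → (u - v).natDegree < E := fun u hu v hv huv =>
    (natDegree_lt_iff_degree_lt (sub_ne_zero.mpr huv)).mpr (hT u hu v hv)
  have hdvd : ∀ u ∈ T, ∀ v ∈ T, u ≠ v →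
      ((l : K[X]) + 3) * u - ((l : K[X]) + 1) * v ∣ m v := by
    intro u hu v hv huv
    obtain ⟨hum, hud, hui⟩ := hS u (hTS hu)
    obtain ⟨hvm, hvd, hvi⟩ := hS v (hTS hv)
    have he := hlt u hu v hv huv
    obtain ⟨R, hR, hR'⟩ := exists_cube_factor u v d l hud.le hvd.le
    have hform : ∀ a b : K[X], a.natDegree = d → b.natDegree = d →
        (((l : K[X]) + 3) * a - ((l : K[X]) + 1) * b).natDegree ≤ d := by
      intro a b ha hb
      have e1 : ((l + 3 : ℕ) * a : K[X]).natDegree ≤ d :=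
        (natDegree_mul_le_of_le (natDegree_natCast _).le ha.le).trans (by simp)
      have e2 : ((l + 1 : ℕ) * b : K[X]).natDegree ≤ d :=
        (natDegree_mul_le_of_le (natDegree_natCast _).le hb.le).trans (by simp)
      have := natDegree_sub_le_of_le e1 e2
      push_cast at this
      simpa using this
    have heq := mul_eq_mul_of_close (F := F) (a := m u) (b := m v) (U := u ^ (l + 2))
      (V := v ^ (l + 2)) (A := ((l : K[X]) + 3) * v - ((l : K[X]) + 1) * u)
      (B := ((l : K[X]) + 3) * u - ((l : K[X]) + 1) * v) (n := n) (h := h)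
      (D := (l + 2) * d) (d := d) le_rfl (by rw [natDegree_pow, hud]) (by rw [natDegree_pow, hvd])
      (pow_ne_zero _ hum.ne_zero) (pow_ne_zero _ hvm.ne_zero) (hm u (hTS hu)) (hm v (hTS hv))
      (hform v u hvd hud) (hform u v hud hvd) (by omega) (by
        rw [hR']
        have := natDegree_mul_le_of_le (natDegree_pow_le (p := u - v) (n := 3)) hR
        have : (l + 2) * d = l * d + 2 * d := by ring
        omega)
    have hcop : IsCoprime u v :=
      (hui.coprime_iff_not_dvd).mpr fun hdv =>
        huv (eq_of_monic_irreducible_of_dvd hui hvi hum hvm hdv)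
    have hcop' : IsCoprime (((l : K[X]) + 3) * u - ((l : K[X]) + 1) * v)
        (((l : K[X]) + 3) * v - ((l : K[X]) + 1) * u) := by
      obtain ⟨s, t, hst⟩ := hcop
      have hc : (C (((4 * (l + 2) : ℕ) : K)⁻¹) : K[X]) * (4 * ((l : K[X]) + 2)) = 1 := by
        have h4 : ((4 * (l + 2) : ℕ) : K) ≠ 0 := by
          have : ((4 * (l + 2) : ℕ) : K) = 2 * 2 * ((l + 2 : ℕ) : K) := by push_cast; ring
          rw [this]
          exact mul_ne_zero (mul_ne_zero h2 h2) hk0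
        have : (4 * ((l : K[X]) + 2)) = C ((4 * (l + 2) : ℕ) : K) := by
          rw [map_natCast]; push_cast; rfl
        rw [this, ← C_mul, inv_mul_cancel₀ h4, C_1]
      refine ⟨C (((4 * (l + 2) : ℕ) : K)⁻¹) * (((l : K[X]) + 3) * s + ((l : K[X]) + 1) * t),
        C (((4 * (l + 2) : ℕ) : K)⁻¹) * (((l : K[X]) + 1) * s + ((l : K[X]) + 3) * t), ?_⟩
      linear_combination C (((4 * (l + 2) : ℕ) : K)⁻¹) * (4 * ((l : K[X]) + 2)) * hst + hc
    exact hcop'.dvd_of_dvd_mul_right ⟨m u, by rw [heq]; ring⟩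
  by_contra hcon
  obtain ⟨u, hu, v, hv, w, hw, huv, huw, hvw⟩ := Finset.two_lt_card.mp (not_le.mp hcon)
  obtain ⟨hum, hud, hui⟩ := hS u (hTS hu)
  obtain ⟨hvm, hvd, hvi⟩ := hS v (hTS hv)
  obtain ⟨hwm, hwd, hwi⟩ := hS w (hTS hw)
  have hlead : ∀ a b : K[X], a.Monic → b.Monic → a.natDegree = d → b.natDegree = d →
      d ≤ (((l : K[X]) + 3) * a - ((l : K[X]) + 1) * b).natDegree := by
    intro a b ha hb had hbd
    refine le_natDegree_of_ne_zero ?_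
    have e : (((l : K[X]) + 3) * a - ((l : K[X]) + 1) * b)
        = C ((l : K) + 3) * a - C ((l : K) + 1) * b := by
      simp only [C_add, map_natCast, C_1, map_ofNat]
    have ha' : a.coeff d = 1 := had ▸ ha.coeff_natDegree
    have hb' : b.coeff d = 1 := hbd ▸ hb.coeff_natDegree
    rw [e, coeff_sub, coeff_C_mul, coeff_C_mul, ha', hb']
    convert h2 using 1
    ring
  obtain ⟨s, hs⟩ := hdvd v hv u hu huv.symm
  obtain ⟨t, ht⟩ := hdvd w hw u hu huw.symm
  set B₁ := ((l : K[X]) + 3) * v - ((l : K[X]) + 1) * u with hB₁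
  set B₂ := ((l : K[X]) + 3) * w - ((l : K[X]) + 1) * u with hB₂
  have hmul : m u * (C ((l : K) + 3) * (v - w)) = B₁ * B₂ * (t - s) := by
    have : C ((l : K) + 3) * (v - w) = B₁ - B₂ := by
      rw [hB₁, hB₂]; simp only [C_add, map_natCast]
      rw [map_ofNat]; ring
    rw [this, mul_sub]
    linear_combination B₁ * ht - B₂ * hs
  have hl3 : (l : K) + 3 ≠ 0 := by
    convert hk1 using 1; push_cast; ring
  have hne : m u * (C ((l : K) + 3) * (v - w)) ≠ 0 :=
    mul_ne_zero (hdeg u (hTS hu)).1 (mul_ne_zero (C_ne_zero.mpr hl3) (sub_ne_zero.mpr hvw))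
  have hle := natDegree_le_of_dvd (Dvd.intro _ hmul.symm) hne
  have hne' : B₁ * B₂ ≠ 0 := by
    intro h0; rw [hmul, h0, zero_mul] at hne; exact hne rfl
  rw [natDegree_mul (left_ne_zero_of_mul hne') (right_ne_zero_of_mul hne'),
    natDegree_mul (hdeg u (hTS hu)).1 (right_ne_zero_of_mul hne), natDegree_C_mul hl3] at hle
  have hd₁ : d ≤ B₁.natDegree := hlead v u hvm hum hvd hud
  have hd₂ : d ≤ B₂.natDegree := hlead w u hwm hum hwd hud
  have := hlt v hv w hw hvw
  have := (hdeg u (hTS hu)).2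
  omega

/-- Bound for the irreducibles of degree `d > h` whose `k`-th power divides a member of the
interval, when the characteristic divides `k`. -/
lemma card_le_of_char_dvd {p : ℕ} [Fact p.Prime] [CharP K p] (hk : 2 ≤ k) (hpk : p ∣ k)
    (hn : F.natDegree ≤ (k + 2) * h) (hh : h < F.natDegree)
    (hd : h < d) (hS : ∀ u ∈ S, u.Monic ∧ u.natDegree = d ∧ Irreducible u)
    (hm : ∀ u ∈ S, (F - m u * u ^ k).natDegree ≤ h) :
    S.card ≤ Fintype.card K ^ (h - 1 - (d - h - 1)) + Fintype.card K ^ (h / 2 + 1) := by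
  rcases S.eq_empty_or_nonempty with rfl | ⟨u₀, hu₀⟩
  · simp
  have hdeg : ∀ u ∈ S, m u ≠ 0 ∧ (m u).natDegree + k * d = F.natDegree := by
    intro u hu
    have := natDegree_cofactor hh (hS u hu).1.ne_zero (hm u hu)
    rwa [(hS u hu).2.1] at this
  have hμ := (hdeg u₀ hu₀).2
  set n := F.natDegree with hn_def
  set μ := (m u₀).natDegree with hμ_def
  have hp2 : 2 ≤ p := (Fact.out : p.Prime).two_le
  obtain ⟨l, rfl⟩ := hpk
  have hl : 1 ≤ l := Nat.pos_of_ne_zero (by rintro rfl; simp at hk)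
  have hprod2 : p * l * d = p * l * h + p * l * (d - h) := by
    rw [← mul_add]; congr 1; omega
  have hprod3 : 2 * (d - h) ≤ p * l * (d - h) := Nat.mul_le_mul_right _ hk
  have hprod4 : (p * l + 2) * h = p * l * h + 2 * h := by ring
  have hprod5 : 2 * d ≤ p * l * d := Nat.mul_le_mul_right _ hk
  have hsep : ∀ u ∈ S, ∀ v ∈ S, u ≠ v → (u - v).natDegree < d - μ / 2 →
      2 * (u - v).natDegree + μ ≤ h := by
    intro u hu v hv huv he
    obtain ⟨hum, hud, hui⟩ := hS u hu
    obtain ⟨hvm, hvd, hvi⟩ := hS v hv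
    have hfrob : u ^ (p * l) - v ^ (p * l) = (u ^ l - v ^ l) ^ p := by
      rw [sub_pow_char, ← pow_mul, ← pow_mul, mul_comm]
    have hne : u ^ l - v ^ l ≠ 0 := by
      intro h0
      have : u ∣ v ^ l := by
        rw [← sub_eq_zero.mp h0]; exact dvd_pow_self _ (by omega)
      exact huv (eq_of_monic_irreducible_of_dvd hui hvi hum hvm (hui.prime.dvd_of_dvd_pow this))
    obtain ⟨R, hR⟩ : ∃ R, R = ∑ i ∈ Finset.range l, u ^ i * v ^ (l - 1 - i) := ⟨_, rfl⟩
    have hfac : u ^ l - v ^ l = (u - v) * R := by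
      rw [hR, mul_comm, Commute.geom_sum₂_mul (Commute.all u v)]
    have hRdeg : R.natDegree ≤ (l - 1) * d := by
      rw [hR]
      refine natDegree_sum_le_of_forall_le _ _ fun i hi => ?_
      rw [Finset.mem_range] at hi
      refine (natDegree_mul_le_of_le (natDegree_pow_le_of_le i hud.le)
        (natDegree_pow_le_of_le (l - 1 - i) hvd.le)).trans ?_
      rw [← add_mul]
      exact Nat.mul_le_mul_right _ (by omega)
    have hR0 : R ≠ 0 := by rintro rfl; simp [hfac] at hne
    have hdl : (u ^ l - v ^ l).natDegree = (u - v).natDegree + R.natDegree := by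
      rw [hfac, natDegree_mul (sub_ne_zero.mpr huv) hR0]
    have heq := mul_eq_mul_of_close (F := F) (a := m u) (b := m v) (U := u ^ (p * l))
      (V := v ^ (p * l)) (A := 1) (B := 1) (n := n) (h := h)
      (D := p * l * d) (d := 0) le_rfl (by rw [natDegree_pow, hud]) (by rw [natDegree_pow, hvd])
      (pow_ne_zero _ hum.ne_zero) (pow_ne_zero _ hvm.ne_zero) (hm u hu) (hm v hv)
      (by simp) (by simp) (by omega) (by
        rw [one_mul, one_mul, hfrob, natDegree_pow, hdl]
        have h1 : p * ((u - v).natDegree + R.natDegree) ≤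
            p * ((u - v).natDegree + (l - 1) * d) := Nat.mul_le_mul_left _ (by omega)
        obtain ⟨g, hg⟩ : ∃ g, d = (u - v).natDegree + g := ⟨d - (u - v).natDegree, by omega⟩
        have h2 : p * l * d = p * ((u - v).natDegree + (l - 1) * d) + p * g := by
          obtain ⟨l', rfl⟩ := Nat.exists_eq_add_of_le' hl
          rw [Nat.add_sub_cancel]
          calc p * (l' + 1) * d = p * (l' * d) + p * d := by ring
            _ = p * (l' * d) + p * ((u - v).natDegree + g) := by rw [← hg]
            _ = _ := by ring
        have h3 : 2 * g ≤ p * g := Nat.mul_le_mul_right _ hp2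
        omega)
    rw [mul_one, mul_one] at heq
    have hdiff : m u * (u ^ l - v ^ l) ^ p
        = (F - m v * v ^ (p * l)) - (F - m u * u ^ (p * l)) := by
      rw [← hfrob, heq]; ring
    have hle : (m u * (u ^ l - v ^ l) ^ p).natDegree ≤ h := by
      rw [hdiff]
      exact (natDegree_sub_le_of_le (hm v hv) (hm u hu)).trans (by simp)
    rw [natDegree_mul (hdeg u hu).1 (pow_ne_zero _ hne), natDegree_pow, hdl] at hle
    have h1 : 2 * ((u - v).natDegree + R.natDegree) ≤ p * ((u - v).natDegree + R.natDegree) :=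
      Nat.mul_le_mul_right _ hp2
    have h2 := (hdeg u hu).2
    omega
  have hpos : 0 < Fintype.card K := Fintype.card_pos
  have hS' : ∀ u ∈ S, u.Monic ∧ u.natDegree = d := fun u hu => ⟨(hS u hu).1, (hS u hu).2.1⟩
  rcases lt_or_ge h μ with hcase | hcase
  · refine (card_le_mul_pow_of_balls S d (d - μ / 2) 1 (by omega) hS' ?_).trans ?_
    · intro T hTS hT
      refine Finset.card_le_one.mpr fun u hu v hv => ?_
      by_contra huv
      have := hsep u (hTS hu) v (hTS hv) huv
        ((natDegree_lt_iff_degree_lt (sub_ne_zero.mpr huv)).mpr (hT u hu v hv))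
      omega
    · rw [one_mul]
      exact (Nat.pow_le_pow_right hpos (by omega)).trans (Nat.le_add_right _ _)
  · refine (card_le_mul_pow_of_balls S d (d - μ / 2) (Fintype.card K ^ ((h - μ) / 2 + 1))
      (by omega) hS' ?_).trans ?_
    · intro T hTS hT
      refine card_le_pow_of_degree_sub_lt T _ fun u hu v hv => ?_
      by_cases huv : u = v
      · rw [huv, sub_self, degree_zero]; exact WithBot.bot_lt_coe _
      · have := hsep u (hTS hu) v (hTS hv) huv
          ((natDegree_lt_iff_degree_lt (sub_ne_zero.mpr huv)).mpr (hT u hu v hv))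
        exact (natDegree_lt_iff_degree_lt (sub_ne_zero.mpr huv)).mp (by omega)
    · rw [← pow_add]
      exact (Nat.pow_le_pow_right hpos (by omega)).trans (Nat.le_add_left _ _)

end counting

/-- Among polynomials pairwise agreeing from degree `M` on, at most `q ^ (M - deg G)` are
divisible by `G`. -/
lemma card_le_pow_of_dvd {K : Type*} [Field K] [Fintype K] (T : Finset K[X]) (M : ℕ) (G : K[X])
    (hG : G ≠ 0) (hT : ∀ u ∈ T, ∀ v ∈ T, (u - v).degree < M) (hdvd : ∀ u ∈ T, G ∣ u) :
    T.card ≤ Fintype.card K ^ (M - G.natDegree) := by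
  classical
  have hinj : Set.InjOn (fun u : K[X] => u / G) T := by
    intro u hu v hv huv
    rw [← EuclideanDomain.mul_div_cancel' hG (hdvd u hu),
      ← EuclideanDomain.mul_div_cancel' hG (hdvd v hv)]
    exact congrArg (G * ·) huv
  rw [← Finset.card_image_of_injOn hinj]
  refine card_le_pow_of_degree_sub_lt _ _ ?_
  intro a ha b hb
  obtain ⟨u, hu, rfl⟩ := Finset.mem_image.mp ha
  obtain ⟨v, hv, rfl⟩ := Finset.mem_image.mp hb
  by_cases hne : u / G - v / G = 0
  · rw [hne, degree_zero]
    exact WithBot.bot_lt_coe _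
  · have hmul : u - v = G * (u / G - v / G) := by
      rw [mul_sub, EuclideanDomain.mul_div_cancel' hG (hdvd u hu),
        EuclideanDomain.mul_div_cancel' hG (hdvd v hv)]
    have hlt := (natDegree_lt_iff_degree_lt (hmul ▸ mul_ne_zero hG hne)).mpr (hT u hu v hv)
    rw [hmul, natDegree_mul hG hne] at hlt
    exact (natDegree_lt_iff_degree_lt hne).mp (by omega)

lemma card_monic_natDegree_le {K : Type*} [Field K] [Fintype K] (S : Finset K[X]) (d : ℕ)
    (hS : ∀ u ∈ S, u.Monic ∧ u.natDegree = d) : S.card ≤ Fintype.card K ^ d := by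
  refine (card_le_mul_pow_of_balls S d 0 1 (Nat.zero_le _) hS fun T _ hT => ?_).trans (by simp)
  simpa using card_le_pow_of_degree_sub_lt T 0 hT

lemma mul_geom_sum_add_one (r h : ℕ) : r * ∑ i ∈ Finset.range h, (r + 1) ^ i + 1 = (r + 1) ^ h := by
  induction h with
  | zero => simp
  | succ h ih => rw [Finset.sum_range_succ, mul_add, pow_succ]; linarith

lemma sum_range_div_three (f : ℕ → ℕ) (m : ℕ) :
    ∑ j ∈ Finset.range (3 * m), f (j / 3) = 3 * ∑ i ∈ Finset.range m, f i := by
  induction m with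
  | zero => simp
  | succ m ih =>
    rw [show 3 * (m + 1) = 3 * m + 1 + 1 + 1 by ring, Finset.sum_range_succ,
      Finset.sum_range_succ, Finset.sum_range_succ, ih, Finset.sum_range_succ,
      show 3 * m / 3 = m by omega, show (3 * m + 1) / 3 = m by omega,
      show (3 * m + 1 + 1) / 3 = m by omega]
    ring

lemma mul_pow_half_le (r h : ℕ) (hr : 1 ≤ r) (hh : 1 ≤ h) :
    h * (r + 1) ^ (h / 2 + 1) ≤ 2 * (r + 1) ^ h := by
  obtain ⟨c, hc⟩ : ∃ c, h = h / 2 + 1 + c := ⟨h - (h / 2 + 1), by omega⟩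
  have h1 : c < (r + 1) ^ c := Nat.lt_pow_self (by omega)
  have h2 : h ≤ 2 * (r + 1) ^ c := by omega
  calc h * (r + 1) ^ (h / 2 + 1) ≤ 2 * (r + 1) ^ c * (r + 1) ^ (h / 2 + 1) :=
        Nat.mul_le_mul_right _ h2
    _ = 2 * (r + 1) ^ (h / 2 + 1 + c) := by rw [pow_add _ (h / 2 + 1) c]; ring
    _ = 2 * (r + 1) ^ h := by rw [← hc]

/-- The interval of radius `h` around `F`, as a finite set. -/
lemma exists_interval_finset {K : Type*} [Field K] [Fintype K] (F : K[X]) (h : ℕ) :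
    ∃ I : Finset K[X], I.card = Fintype.card K ^ (h + 1) ∧
      ∀ Q ∈ I, (F - Q).degree < ((h + 1 : ℕ) : WithBot ℕ) := by
  classical
  refine ⟨Finset.univ.image fun g : Fin (h + 1) → K =>
    F - ((degreeLTEquiv K (h + 1)).symm g : K[X]), ?_, ?_⟩
  · rw [Finset.card_image_of_injective]
    · simp
    · intro g g' hgg
      exact (degreeLTEquiv K (h + 1)).symm.injective (Subtype.ext (sub_right_injective hgg))
  · intro Q hQ
    obtain ⟨g, -, rfl⟩ := Finset.mem_image.mp hQ
    rw [sub_sub_cancel]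
    exact mem_degreeLT.mp ((degreeLTEquiv K (h + 1)).symm g).2

/-- Bound for the total number of irreducibles of degree greater than `h` whose `k`-th powers
divide members of the interval. -/
lemma sum_card_large_le {K : Type*} [Field K] [Fintype K] {p : ℕ} [CharP K p] {F : K[X]}
    {k h r : ℕ} (hr : Fintype.card K = r + 1) (hr4 : 4 ≤ r) (hp : ¬ p ∣ k + 1) (hk : 2 ≤ k)
    (hn : F.natDegree ≤ (k + 2) * h) (hh : h < F.natDegree) (S : ℕ → Finset K[X])
    (hS : ∀ j, ∀ u ∈ S j, u.Monic ∧ u.natDegree = h + j + 1 ∧ Irreducible u)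
    (hm : ∀ j, ∀ u ∈ S j, ∃ m : K[X], (F - m * u ^ k).natDegree ≤ h) :
    r * ∑ j ∈ Finset.range h, (S j).card ≤ (2 * r + 1) * (r + 1) ^ h := by
  have hprime : p.Prime := CharP.char_is_prime K p
  have : Fact p.Prime := ⟨hprime⟩
  have hgeom := mul_geom_sum_add_one r h
  have hh1 : 1 ≤ h := by
    rcases Nat.eq_zero_or_pos h with rfl | h0
    · omega
    · exact h0
  choose! m hm using hm
  by_cases hpk : p ∣ k
  · have hb : ∑ j ∈ Finset.range h, (S j).card ≤
        ∑ i ∈ Finset.range h, (r + 1) ^ i + h * (r + 1) ^ (h / 2 + 1) := by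
      rw [← Finset.sum_range_reflect (fun i => (r + 1) ^ i)]
      calc _ ≤ ∑ j ∈ Finset.range h, ((r + 1) ^ (h - 1 - j) + (r + 1) ^ (h / 2 + 1)) :=
            Finset.sum_le_sum fun j _ => by
              have := card_le_of_char_dvd hk hpk hn hh (d := h + j + 1) (by omega) (hS j) (hm j)
              rwa [hr, show h + j + 1 - h - 1 = j by omega] at this
        _ = _ := by rw [Finset.sum_add_distrib]; simp
    have := mul_pow_half_le r h (by omega) hh1
    nlinarith [Nat.mul_le_mul_left r hb, Nat.mul_le_mul_left r this]
  · have hk0 : (k : K) ≠ 0 := fun h0 => hpk ((CharP.cast_eq_zero_iff K p k).mp h0)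
    have hk1 : (k : K) + 1 ≠ 0 := fun h0 =>
      hp ((CharP.cast_eq_zero_iff K p (k + 1)).mp (by exact_mod_cast h0))
    have h2 : (2 : K) ≠ 0 := by
      intro h0
      have h2 : p ∣ 2 := (CharP.cast_eq_zero_iff K p 2).mp (by exact_mod_cast h0)
      obtain rfl : p = 2 := (Nat.prime_dvd_prime_iff_eq hprime Nat.prime_two).mp h2
      omega
    have hb : ∑ j ∈ Finset.range h, (S j).card ≤
        2 * (3 * ∑ i ∈ Finset.range h, (r + 1) ^ i) := by
      rw [← Finset.sum_range_reflect (fun i => (r + 1) ^ i),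
        ← sum_range_div_three (fun i => (r + 1) ^ (h - 1 - i)), Finset.mul_sum]
      calc _ ≤ ∑ j ∈ Finset.range h, 2 * (r + 1) ^ (h - 1 - j / 3) :=
            Finset.sum_le_sum fun j _ => by
              have := card_le_of_char_not_dvd hk h2 hk0 hk1 hn hh (d := h + j + 1) (by omega)
                (hS j) (hm j)
              rwa [hr, show h + j + 1 - h - 1 = j by omega] at this
        _ ≤ _ := Finset.sum_le_sum_of_subset (Finset.range_subset_range.mpr (by omega))
    have h6 : 6 * (r + 1) ^ h ≤ (2 * r + 1) * (r + 1) ^ h := Nat.mul_le_mul_right _ (by omega)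
    have := Nat.mul_le_mul_left r hb
    nlinarith

/-- **Theorem 4.** Let `k ≥ 2` and `q` a prime power of characteristic `p` with
`p ∤ (k+1)`, and suppose `q ≥ 7`, or `k ≥ 3` and `q ≥ 5`. If `n ≥ k+1` and `F` is monic
of degree `n`, then for every integer `h` with `n/(k+2) ≤ h < n`, the interval `I_q(F,h)`
contains a `k`-free polynomial. -/
theorem kfree_in_intervals_n_div_k_add_two
    {Fq : Type} [Field Fq] [Fintype Fq] (q p k : ℕ) [CharP Fq p]
    (hq : Fintype.card Fq = q) (hp : ¬ p ∣ (k + 1)) (hk : 2 ≤ k)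
    (hqk : 7 ≤ q ∨ (3 ≤ k ∧ 5 ≤ q)) (n : ℕ) (hn : k + 1 ≤ n)
    (F : Polynomial Fq) (hF : F.Monic) (hFdeg : F.natDegree = n)
    (h : ℕ) (hh1 : (n : ℝ) / (k + 2) ≤ (h : ℝ)) (hh2 : h < n) :
    ∃ Q : Polynomial Fq, (F - Q).degree ≤ (h : WithBot ℕ) ∧
      ∀ P : Polynomial Fq, Irreducible P → ¬ P ^ k ∣ Q := by
  classical
  obtain ⟨r, rfl⟩ : ∃ r, q = r + 1 := ⟨q - 1, by omega⟩
  have hr4 : 4 ≤ r := by omega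
  have hnh : F.natDegree ≤ (k + 2) * h := by
    rw [div_le_iff₀ (by positivity)] at hh1
    rw [hFdeg, mul_comm]
    exact_mod_cast hh1
  have hhn : h < F.natDegree := hFdeg ▸ hh2
  by_contra hcon
  push Not at hcon
  obtain ⟨I, hIcard, hI⟩ := exists_interval_finset F h
  have hIle : ∀ Q ∈ I, (F - Q).degree ≤ (h : WithBot ℕ) := fun Q hQ =>
    (degree_le_iff_coeff_zero _ _).mpr fun i hi =>
      (degree_lt_iff_coeff_zero _ _).mp (hI Q hQ) i (Nat.succ_le_of_lt (by exact_mod_cast hi))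
  have hIsub : ∀ u ∈ I, ∀ v ∈ I, (u - v).degree < ((h + 1 : ℕ) : WithBot ℕ) := by
    intro u hu v hv
    rw [show u - v = (F - v) - (F - u) by ring]
    exact (degree_sub_le _ _).trans_lt (max_lt (hI v hv) (hI u hu))
  have hex : ∀ Q ∈ I, ∃ P : Fq[X], P.Monic ∧ Irreducible P ∧ P ^ k ∣ Q := by
    intro Q hQ
    obtain ⟨P, hP, hPQ⟩ := hcon Q (hIle Q hQ)
    exact ⟨normalize P, monic_normalize hP.ne_zero, (normalize_associated P).symm.irreducible hP,
      ((normalize_associated P).pow_pow.dvd_iff_dvd_left).mpr hPQ⟩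
  choose! P hPm hPi hPQ using hex
  have hPpos : ∀ Q ∈ I, 1 ≤ (P Q).natDegree := fun Q hQ => (hPi Q hQ).natDegree_pos
  have hcof : ∀ Q ∈ I, ∃ m : Fq[X], (F - m * P Q ^ k).natDegree ≤ h := by
    intro Q hQ
    obtain ⟨m, hm⟩ := hPQ Q hQ
    exact ⟨m, by rw [mul_comm, ← hm]; exact natDegree_le_of_degree_le (hIle Q hQ)⟩
  have hmaps : ∀ Q ∈ I, (P Q).natDegree - 1 ∈ Finset.range (h + h) := by
    intro Q hQ
    obtain ⟨m, hm⟩ := hcof Q hQ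
    have h1 := (natDegree_cofactor hhn (hPm Q hQ).ne_zero hm).2
    have h2 : k * (P Q).natDegree ≤ k * (h + h) := by nlinarith
    have := Nat.le_of_mul_le_mul_left h2 (by omega)
    have := hPpos Q hQ
    rw [Finset.mem_range]
    omega
  set B : ℕ → Finset Fq[X] := fun i => I.filter fun Q => (P Q).natDegree - 1 = i with hB
  have hBmem : ∀ i, ∀ Q ∈ B i, Q ∈ I ∧ (P Q).natDegree = i + 1 := by
    intro i Q hQ
    obtain ⟨hQI, hQi⟩ := Finset.mem_filter.mp hQ
    have := hPpos Q hQI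
    exact ⟨hQI, by omega⟩
  have hfib : ∀ i, (B i).card ≤ (r + 1) ^ (h + 1 - k * (i + 1)) * ((B i).image P).card := by
    intro i
    refine Finset.card_le_mul_card_image _ _ fun b hb => ?_
    obtain ⟨Q, hQ, rfl⟩ := Finset.mem_image.mp hb
    obtain ⟨hQI, hQi⟩ := hBmem i Q hQ
    have := card_le_pow_of_dvd ((B i).filter fun Q' => P Q' = P Q) (h + 1) (P Q ^ k)
      (pow_ne_zero _ (hPm Q hQI).ne_zero)
      (fun u hu v hv => hIsub u (hBmem i u (Finset.mem_filter.mp hu).1).1 v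
        (hBmem i v (Finset.mem_filter.mp hv).1).1)
      (fun u hu => by
        rw [← (Finset.mem_filter.mp hu).2]
        exact hPQ u (hBmem i u (Finset.mem_filter.mp hu).1).1)
    rwa [natDegree_pow, hQi, hq] at this
  have hsmall : ∀ i, (B i).card ≤ (r + 1) ^ (i + 1) + (r + 1) ^ (h - i) := by
    intro i
    have h1 : ((B i).image P).card ≤ (r + 1) ^ (i + 1) := by
      rw [← hq]
      refine card_monic_natDegree_le _ _ fun u hu => ?_
      obtain ⟨Q, hQ, rfl⟩ := Finset.mem_image.mp hu
      exact ⟨hPm Q (hBmem i Q hQ).1, (hBmem i Q hQ).2⟩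
    have h2 : 2 * (i + 1) ≤ k * (i + 1) := Nat.mul_le_mul_right _ hk
    refine ((hfib i).trans (Nat.mul_le_mul_left _ h1)).trans ?_
    rw [← pow_add]
    rcases le_or_gt (k * (i + 1)) (h + 1) with hle | hgt
    · exact (Nat.pow_le_pow_right (by omega) (by omega)).trans (Nat.le_add_left _ _)
    · exact (Nat.pow_le_pow_right (by omega) (by omega)).trans (Nat.le_add_right _ _)
  have hlarge : ∀ j, (B (h + j)).card ≤ ((B (h + j)).image P).card := by
    intro j
    have h1 : h + 1 - k * (h + j + 1) = 0 := by
      have : 1 * (h + j + 1) ≤ k * (h + j + 1) := Nat.mul_le_mul_right _ (by omega)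
      omega
    simpa [h1] using hfib (h + j)
  have hS := sum_card_large_le hq hr4 hp hk hnh hhn (fun j => (B (h + j)).image P)
    (fun j u hu => by
      obtain ⟨Q, hQ, rfl⟩ := Finset.mem_image.mp hu
      obtain ⟨hQI, hQd⟩ := hBmem _ Q hQ
      exact ⟨hPm Q hQI, hQd, hPi Q hQI⟩)
    (fun j u hu => by
      obtain ⟨Q, hQ, rfl⟩ := Finset.mem_image.mp hu
      exact hcof Q (hBmem _ Q hQ).1)
  have hgeom := mul_geom_sum_add_one r h
  have hlow : ∑ i ∈ Finset.range h, (B i).card ≤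
      2 * ((r + 1) * ∑ i ∈ Finset.range h, (r + 1) ^ i) := by
    refine (Finset.sum_le_sum fun i _ => hsmall i).trans_eq ?_
    rw [Finset.sum_add_distrib, two_mul, Finset.mul_sum]
    congr 1
    · exact Finset.sum_congr rfl fun i _ => pow_succ' _ _
    · rw [← Finset.sum_range_reflect]
      refine Finset.sum_congr rfl fun i hi => ?_
      rw [Finset.mem_range] at hi
      rw [← pow_succ']
      congr 1
      omega
  have htotal : (r + 1) ^ (h + 1) =
      ∑ i ∈ Finset.range h, (B i).card + ∑ j ∈ Finset.range h, (B (h + j)).card := by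
    rw [← Finset.sum_range_add (fun i => (B i).card), ← hq, ← hIcard]
    exact Finset.card_eq_sum_card_fiberwise hmaps
  have hup : ∑ j ∈ Finset.range h, (B (h + j)).card ≤
      ∑ j ∈ Finset.range h, ((B (h + j)).image P).card := Finset.sum_le_sum fun j _ => hlarge j
  have hfinal : r * (r + 1) ^ (h + 1) ≤
      r * (2 * ((r + 1) * ∑ i ∈ Finset.range h, (r + 1) ^ i)) + (2 * r + 1) * (r + 1) ^ h := by
    rw [htotal, mul_add]
    exact add_le_add (Nat.mul_le_mul_left _ hlow) ((Nat.mul_le_mul_left _ hup).trans hS)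
  have hX : 0 < (r + 1) ^ h := by positivity
  rw [pow_succ] at hfinal
  generalize (r + 1) ^ h = X at *
  generalize ∑ i ∈ Finset.range h, (r + 1) ^ i = G at *
  have h1 : r * (2 * ((r + 1) * G)) ≤ 2 * (r + 1) * X := by nlinarith
  have h2 : r * (r + 1) * X ≤ (4 * r + 3) * X := by nlinarith
  have h3 := Nat.le_of_mul_le_mul_right h2 hX
  nlinarith
end

section
/- Let k ≥ 3 and let q ≥ 3 be a prime power of characteristic p such that p does not divide k·C(2k−1, k−1), where C(2k−1,k−1) is the binomial coefficient. Then for all sufficiently large n: for every monic F ∈ F_q[x] of degree n and every integer h with n/(2k) ≤ h < n, the interval I_q(F,h) contains a k-free polynomial. -/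
open Polynomial

section ShortIntervals

open Finset UniqueFactorizationMonoid

variable {K : Type*} [Field K]

/-- The finite set of polynomials of degree less than `s` over a finite field. -/
noncomputable def polysLT (K : Type*) [Field K] [Fintype K] (s : ℕ) : Finset K[X] :=
  (univ : Finset (Fin s → K)).map
    ((degreeLTEquiv K s).symm.toEquiv.toEmbedding.trans (Function.Embedding.subtype _))

theorem mem_polysLT [Fintype K] {s : ℕ} {a : K[X]} : a ∈ polysLT K s ↔ a.degree < s := by
  simp only [polysLT, mem_map, mem_univ, true_and]
  constructor
  · rintro ⟨v, rfl⟩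
    exact mem_degreeLT.1 ((degreeLTEquiv K s).symm v).2
  · intro h
    exact ⟨degreeLTEquiv K s ⟨a, mem_degreeLT.2 h⟩, by simp⟩

theorem card_polysLT [Fintype K] (s : ℕ) : (polysLT K s).card = Fintype.card K ^ s := by
  simp [polysLT]

theorem card_le_of_dvd_sub [Fintype K] {s : ℕ} {S : Finset K[X]} {P : K[X]} (hP : P ≠ 0)
    (hS : ∀ a ∈ S, a.degree < s) (h : ∀ a ∈ S, ∀ b ∈ S, P ∣ a - b) :
    S.card ≤ Fintype.card K ^ (s - P.natDegree) := by
  rcases S.eq_empty_or_nonempty with rfl | ⟨b, hb⟩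
  · simp
  rw [← card_polysLT]
  refine card_le_card_of_injOn (fun a => (a - b) / P) (fun a ha => ?_) (fun a ha a' ha' e => ?_)
  · obtain ⟨c, hc⟩ := h a ha b hb
    have hd : (a - b).degree < s :=
      (degree_sub_le _ _).trans_lt (max_lt (hS a ha) (hS b hb))
    simp only [mem_coe, mem_polysLT, hc, mul_div_cancel_left₀ _ hP]
    rcases eq_or_ne c 0 with rfl | hc0
    · simp [bot_lt_iff_ne_bot]
    · rw [hc, degree_mul, degree_eq_natDegree hP, degree_eq_natDegree hc0] at hd
      rw [degree_eq_natDegree hc0]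
      norm_cast at hd ⊢
      omega
  · obtain ⟨c, hc⟩ := h a ha b hb
    obtain ⟨c', hc'⟩ := h a' ha' b hb
    simp only [hc, hc', mul_div_cancel_left₀ _ hP] at e
    subst e
    simpa using hc.trans hc'.symm

theorem Irreducible.dvd_sub_of_dvd_add_pow_char {p : ℕ} [Fact p.Prime] [CharP K p]
    {P A a b : K[X]} (hP : Irreducible P) (ha : P ∣ A + a ^ p) (hb : P ∣ A + b ^ p) :
    P ∣ a - b := by
  refine hP.prime.dvd_of_dvd_pow (n := p) ?_
  rw [sub_pow_char]
  simpa using dvd_sub ha hb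

theorem card_filter_irreducible_dvd_le [Fintype K] {p : ℕ} [Fact p.Prime] [CharP K p] {P : K[X]}
    (hP : Irreducible P) (A : K[X]) (s : ℕ) [DecidablePred fun a : K[X] => P ∣ A + a ^ p] :
    ((polysLT K s).filter fun a => P ∣ A + a ^ p).card ≤
      Fintype.card K ^ (s - P.natDegree) := by
  refine card_le_of_dvd_sub hP.ne_zero (fun a ha => mem_polysLT.1 (mem_filter.1 ha).1) ?_
  intro a ha b hb
  exact hP.dvd_sub_of_dvd_add_pow_char (mem_filter.1 ha).2 (mem_filter.1 hb).2

theorem card_toFinset_normalizedFactors_le [DecidableEq K] {R : K[X]} (hR : R ≠ 0) :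
    (normalizedFactors R).toFinset.card ≤ R.natDegree := by
  refine (Multiset.toFinset_card_le _).trans ?_
  have h0 : (0 : K[X]) ∉ normalizedFactors R := zero_notMem_normalizedFactors R
  have h1 := natDegree_multiset_prod (normalizedFactors R) h0
  rw [natDegree_eq_of_degree_eq (degree_eq_degree_of_associated (prod_normalizedFactors hR))] at h1
  rw [h1]
  have := Multiset.card_nsmul_le_sum (s := (normalizedFactors R).map natDegree) (a := 1) (by
    intro x hx
    obtain ⟨P, hP, rfl⟩ := Multiset.mem_map.1 hx
    exact (irreducible_of_normalized_factor P hP).natDegree_pos)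
  simpa using this

theorem two_mul_sum_pow_le {q : ℕ} (hq : 3 ≤ q) (s : ℕ) :
    2 * ∑ d ∈ Ico 1 s, q ^ d * (q ^ (s - d) * q ^ (s - d)) ≤ q ^ s * q ^ s := by
  have key : ∀ t, t < s →
      2 * ∑ d ∈ Ico 1 (t + 1), q ^ d * (q ^ (s - d) * q ^ (s - d)) + q ^ (2 * s - t)
        ≤ q ^ s * q ^ s := by
    intro t
    induction t with
    | zero => intro _; simp [two_mul, pow_add]
    | succ t ih =>
      intro ht
      have := ih (by omega)
      rw [sum_Ico_succ_top (by omega)]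
      have e1 : q ^ (t + 1) * (q ^ (s - (t + 1)) * q ^ (s - (t + 1))) = q ^ (2 * s - (t + 1)) := by
        rw [← pow_add, ← pow_add]; congr 1; omega
      have e2 : q ^ (2 * s - t) = q * q ^ (2 * s - (t + 1)) := by
        rw [← pow_succ']; congr 1; omega
      rw [e1]
      rw [e2] at this
      nlinarith [Nat.mul_le_mul_right (q ^ (2 * s - (t + 1))) hq]
  rcases s with _ | s
  · simp
  · have := key s (by omega)
    omega

/-- If `q ^ s` is large compared with `n`, then among the polynomials `F + a ^ p + X * b ^ p` with
`deg a, deg b < s` there is one which has no irreducible factor in common with its derivative. -/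
theorem exists_add_pow_char_not_dvd_derivative [Fintype K] {p : ℕ} [Fact p.Prime] [CharP K p]
    (hq : 3 ≤ Fintype.card K) {n s : ℕ} {F : K[X]} (hF : F.natDegree ≤ n) (hs : p * s ≤ n)
    (hqs : 2 * (n + 1) < Fintype.card K ^ s) :
    ∃ a b : K[X], a.degree < s ∧ b.degree < s ∧ ∀ P : K[X], Irreducible P →
      P ∣ F + X * b ^ p + a ^ p → ¬ P ∣ derivative F + b ^ p := by
  classical
  by_contra! H
  set q := Fintype.card K with hqdef
  set V := polysLT K s with hV
  have hVc : V.card = q ^ s := card_polysLT s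
  let small (P : K[X]) : Finset (K[X] × K[X]) :=
    (V ×ˢ V).filter fun x =>
      Irreducible P ∧ P ∣ F + X * x.2 ^ p + x.1 ^ p ∧ P ∣ derivative F + x.2 ^ p
  have hsmall (P : K[X]) :
      (small P).card ≤ q ^ (s - P.natDegree) * q ^ (s - P.natDegree) := by
    by_cases hP : Irreducible P
    swap
    · simp [small, hP]
    have hsub : small P ⊆ (V.filter fun b => P ∣ derivative F + b ^ p).biUnion fun b =>
        (V.filter fun a => P ∣ F + X * b ^ p + a ^ p) ×ˢ {b} := by
      rintro ⟨a, b⟩ hx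
      simp only [small, mem_filter, mem_product] at hx
      simp only [mem_biUnion, mem_filter, mem_product, mem_singleton]
      exact ⟨b, ⟨hx.1.2, hx.2.2.2⟩, ⟨hx.1.1, hx.2.2.1⟩, rfl⟩
    refine (card_le_card hsub).trans ((card_biUnion_le_card_mul _ _ (q ^ (s - P.natDegree)) ?_).trans
      (Nat.mul_le_mul_right _ (card_filter_irreducible_dvd_le hP _ s)))
    intro b _
    rw [card_product, card_singleton, mul_one]
    exact card_filter_irreducible_dvd_le hP _ s
  let degenerate : Finset (K[X] × K[X]) := V ×ˢ V.filter fun b => derivative F + b ^ p = 0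
  have hdeg : degenerate.card ≤ q ^ s * 1 := by
    rw [card_product, hVc]
    refine Nat.mul_le_mul_left _ (card_le_one.2 fun b hb b' hb' => ?_)
    have h := (mem_filter.1 hb).2.trans (mem_filter.1 hb').2.symm
    exact frobenius_inj K[X] p (add_left_cancel h)
  let large : Finset (K[X] × K[X]) :=
    (V.filter fun b => derivative F + b ^ p ≠ 0).biUnion fun b =>
      ((normalizedFactors (derivative F + b ^ p)).toFinset.filter
        fun P => s ≤ P.natDegree).biUnion fun P =>
          (V.filter fun a => P ∣ F + X * b ^ p + a ^ p) ×ˢ {b}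
  have hlarge : large.card ≤ q ^ s * n := by
    refine (card_biUnion_le_card_mul _ _ n fun b hb => ?_).trans
      (Nat.mul_le_mul_right _ ((card_filter_le _ _).trans hVc.le))
    obtain ⟨hbV, hb0⟩ := mem_filter.1 hb
    refine (card_biUnion_le_card_mul _ _ 1 fun P hP => ?_).trans ?_
    · obtain ⟨hP, hPs⟩ := mem_filter.1 hP
      rw [card_product, card_singleton, mul_one]
      refine (card_filter_irreducible_dvd_le
        (irreducible_of_normalized_factor P (Multiset.mem_toFinset.1 hP)) _ s).trans ?_
      simp [Nat.sub_eq_zero_of_le hPs]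
    · rw [mul_one]
      refine (card_filter_le _ _).trans ((card_toFinset_normalizedFactors_le hb0).trans ?_)
      refine (natDegree_add_le _ _).trans (max_le ?_ ?_)
      · exact (natDegree_derivative_le F).trans (by omega)
      · rw [natDegree_pow]
        refine le_trans (Nat.mul_le_mul_left _ ?_) hs
        exact natDegree_le_iff_degree_le.2 (mem_polysLT.1 hbV).le
  have hcover : V ×ˢ V ⊆ ((Ico 1 s).biUnion fun d => (polysLT K d).biUnion fun c =>
      small (X ^ d + c)) ∪ degenerate ∪ large := by
    rintro ⟨a, b⟩ hab
    obtain ⟨ha, hb⟩ := mem_product.1 hab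
    simp only at ha hb
    obtain ⟨P₀, hP₀, hQ₀, hR₀⟩ := H a b (mem_polysLT.1 ha) (mem_polysLT.1 hb)
    have hass : Associated P₀ (normalize P₀) := (normalize_associated P₀).symm
    set P := normalize P₀ with hPdef
    have hP : Irreducible P := hass.irreducible hP₀
    have hQ := hass.dvd_iff_dvd_left.1 hQ₀
    have hR := hass.dvd_iff_dvd_left.1 hR₀
    have hmonic : P.Monic := monic_normalize hP₀.ne_zero
    rw [mem_union, mem_union]
    by_cases h0 : derivative F + b ^ p = 0
    · exact Or.inl (Or.inr (mem_product.2 ⟨ha, mem_filter.2 ⟨hb, h0⟩⟩))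
    rcases lt_or_ge P.natDegree s with hlt | hge
    · refine Or.inl (Or.inl ?_)
      have hc : (P - X ^ P.natDegree).degree < (P.natDegree : WithBot ℕ) := by
        have h := degree_sub_lt_left (p := P) (q := X ^ P.natDegree)
          (by rw [degree_X_pow, degree_eq_natDegree hP.ne_zero]) hP.ne_zero
          (by rw [hmonic.leadingCoeff, leadingCoeff_X_pow])
        rwa [degree_eq_natDegree hP.ne_zero] at h
      refine mem_biUnion.2 ⟨P.natDegree, mem_Ico.2 ⟨hP.natDegree_pos, hlt⟩,
        mem_biUnion.2 ⟨P - X ^ P.natDegree, mem_polysLT.2 hc, ?_⟩⟩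
      rw [add_sub_cancel]
      exact mem_filter.2 ⟨hab, hP, hQ, hR⟩
    · refine Or.inr (mem_biUnion.2 ⟨b, mem_filter.2 ⟨hb, h0⟩,
        mem_biUnion.2 ⟨P, mem_filter.2 ⟨?_, hge⟩,
        mem_product.2 ⟨mem_filter.2 ⟨ha, hQ⟩, mem_singleton_self _⟩⟩⟩)
      rw [Multiset.mem_toFinset, mem_normalizedFactors_iff' h0]
      exact ⟨hP, by rw [hPdef, normalize_idem], hR⟩
  have hsum : ((Ico 1 s).biUnion fun d => (polysLT K d).biUnion fun c =>
      small (X ^ d + c)).card ≤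
      ∑ d ∈ Ico 1 s, q ^ d * (q ^ (s - d) * q ^ (s - d)) := by
    refine card_biUnion_le.trans (sum_le_sum fun d _ => ?_)
    refine (card_biUnion_le_card_mul _ _ (q ^ (s - d) * q ^ (s - d)) fun c hc => ?_).trans
      (by rw [card_polysLT])
    have hc := mem_polysLT.1 hc
    have hd : (X ^ d + c).natDegree = d :=
      natDegree_eq_of_degree_eq_some (by
        rw [degree_add_eq_left_of_degree_lt (by rwa [degree_X_pow]), degree_X_pow])
    exact (hsmall (X ^ d + c)).trans_eq (by rw [hd])
  have htot := (card_le_card hcover).trans ((card_union_le _ _).trans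
    (Nat.add_le_add_right (card_union_le _ _) _))
  rw [card_product, hVc] at htot
  have h2 := two_mul_sum_pow_le hq s
  have h3 : q ^ s * q ^ s ≤ q ^ s * (2 * (n + 1)) := by nlinarith
  exact absurd (Nat.le_of_mul_le_mul_left h3 (by omega)) (by omega)

theorem exists_forall_linear_lt_pow (c : ℕ) {q : ℕ} (hq : 2 ≤ q) :
    ∃ M : ℕ, ∀ s, M ≤ s → 2 * (c * (s + 1) + 1) < q ^ s := by
  refine ⟨4 * (c + 2), fun s hs => ?_⟩
  refine lt_of_lt_of_le ?_ (Nat.pow_le_pow_left hq s)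
  induction s, hs using Nat.le_induction with
  | base =>
    have h : c + 2 < 2 ^ (c + 2) := Nat.lt_two_pow_self
    have h4 : (c + 2) ^ 4 < (2 ^ (c + 2)) ^ 4 := Nat.pow_lt_pow_left h (by norm_num)
    rw [mul_comm 4 (c + 2), pow_mul]
    nlinarith [Nat.zero_le (c ^ 3), Nat.zero_le (c ^ 4)]
  | succ s hs ih =>
    rw [pow_succ]
    nlinarith

end ShortIntervals

/-- **Theorem 5 (Halberstam–Roth analogue).** Let `k ≥ 3` and `q ≥ 3` a prime power of
characteristic `p` with `p ∤ k·C(2k−1,k−1)`. Then for all sufficiently large `n`: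
for every monic `F` of degree `n` and every integer `h` with `n/(2k) ≤ h < n`,
the interval `I_q(F,h)` contains a `k`-free polynomial. -/
theorem kfree_in_intervals_n_div_two_k
    {Fq : Type} [Field Fq] [Fintype Fq] (q p k : ℕ) [CharP Fq p]
    (hq : Fintype.card Fq = q) (hq3 : 3 ≤ q) (hk : 3 ≤ k)
    (hp : ¬ p ∣ k * Nat.choose (2 * k - 1) (k - 1)) :
    ∃ N : ℕ, ∀ n : ℕ, N ≤ n →
      ∀ F : Polynomial Fq, F.Monic → F.natDegree = n →
        ∀ h : ℕ, (n : ℝ) / (2 * k) ≤ (h : ℝ) → h < n →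
          ∃ Q : Polynomial Fq, (F - Q).degree ≤ (h : WithBot ℕ) ∧
            ∀ P : Polynomial Fq, Irreducible P → ¬ P ^ k ∣ Q := by
  subst hq
  have hp' : Fact p.Prime := ⟨CharP.char_is_prime Fq p⟩
  have hp0 := hp'.out.pos
  obtain ⟨M, hM⟩ := exists_forall_linear_lt_pow (2 * k * p) (q := Fintype.card Fq) (by omega)
  refine ⟨2 * k * p * (M + 1), fun n hn F _ hFn h hh hhn => ?_⟩
  have hh' : n ≤ h * (2 * k) := by
    rw [div_le_iff₀ (by positivity)] at hh
    exact_mod_cast hh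
  have hs : p * (h / p) ≤ h := Nat.mul_div_le h p
  have hs' : h < p * (h / p + 1) := Nat.lt_mul_div_succ h hp0
  generalize h / p = s at hs hs'
  have hns : n ≤ 2 * k * p * (s + 1) := by nlinarith
  have hMs : M ≤ s := by
    have : 0 < 2 * k * p := by positivity
    simpa using Nat.le_of_mul_le_mul_left (hn.trans hns) this
  obtain ⟨a, b, ha, hb, H⟩ := exists_add_pow_char_not_dvd_derivative (K := Fq) (p := p) hq3 (n := n) (s := s)
    hFn.le (by omega) (by have := hM s hMs; omega)
  refine ⟨F + X * b ^ p + a ^ p, ?_, fun P hP hdvd => ?_⟩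
  · have hbd : ∀ c : Fq[X], c.degree < s → c ≠ 0 → p * c.natDegree + 1 ≤ h := fun c hc hc0 => by
      rw [degree_eq_natDegree hc0] at hc
      have : c.natDegree + 1 ≤ s := by exact_mod_cast hc
      nlinarith
    rw [add_assoc, sub_add_cancel_left, degree_neg]
    refine (degree_add_le _ _).trans (max_le ?_ ?_)
    · rcases eq_or_ne b 0 with rfl | hb0
      · simp [hp0.ne']
      · have := hbd b hb hb0
        rw [degree_mul, degree_X, degree_pow, degree_eq_natDegree hb0, nsmul_eq_mul]
        norm_cast
        omega
    · rcases eq_or_ne a 0 with rfl | ha0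
      · simp [hp0.ne']
      · have := hbd a ha ha0
        rw [degree_pow, degree_eq_natDegree ha0, nsmul_eq_mul]
        norm_cast
        omega
  · refine H P hP ((dvd_pow_self P (by omega)).trans hdvd) ?_
    obtain ⟨G, hG⟩ := (pow_dvd_pow P (show 2 ≤ k by omega)).trans hdvd
    rw [sq, mul_assoc] at hG
    have hder : derivative (F + X * b ^ p + a ^ p) = derivative F + b ^ p := by
      simp [derivative_pow]
    rw [← hder, hG, derivative_mul]
    exact dvd_add ((dvd_mul_right P G).mul_left _) (dvd_mul_right P _)
end

section
/- Let F_q be a finite field with q elements, let k ≥ 2, let h and ℓ be positive integers with ℓ ≤ log_q(h/k) − 1, and let F ∈ F_q[x] with deg F > h. For every monic irreducible polynomial P of degree at most ℓ fix a polynomial Q_P ∈ F_q[x]. Then the number of polynomials Q in the interval I_q(F,h) satisfying Q ≡ Q_P (mod P^k) for at least one monic irreducible P with deg P ≤ ℓ is exactly q^{h+1}·(1 − ∏_P (1 − q^{−k·deg P})), where the product runs over all monic irreducible polynomials P of degree at most ℓ. -/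
open Polynomial

theorem AddMonoidHom.card_mul_ncard_preimage {G M : Type*} [AddGroup G] [Finite G] [AddGroup M]
    (f : G →+ M) (hf : Function.Surjective f) (s : Set M) :
    Nat.card M * (f ⁻¹' s).ncard = Nat.card G * s.ncard := by
  classical
  have := Fintype.ofFinite G
  have : Finite M := Finite.of_surjective f hf
  have := Fintype.ofFinite M
  have key (t : Finset M) : (Finset.univ.filter fun g ↦ f g ∈ t).card =
      t.card * (Finset.univ.filter fun g ↦ f g = 0).card := by
    rw [Finset.card_eq_sum_card_fiberwise (f := f) (t := t) (by intro; simp)]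
    refine Finset.sum_const_nat fun x hx ↦ ?_
    rw [AddMonoidHom.card_fiber_eq_of_mem_range f (hf 0) (hf x), Finset.filter_filter]
    congr 1
    ext g
    simp only [Finset.mem_filter_univ]
    exact ⟨fun h ↦ h.2, fun h ↦ ⟨h ▸ hx, h⟩⟩
  have hG : Nat.card G = Nat.card M * (Finset.univ.filter fun g ↦ f g = 0).card := by
    simpa using key Finset.univ
  have hs := key s.toFinset
  rw [hG, Set.ncard_eq_toFinset_card' s, mul_assoc, mul_comm _ s.toFinset.card, ← hs,
    Set.ncard_eq_toFinset_card']
  congr 2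
  ext g
  simp

namespace Polynomial

theorem natCard_quotient_span_singleton {K : Type*} [Field K] {f : K[X]} (hf : f ≠ 0) :
    Nat.card (K[X] ⧸ Ideal.span {f}) = Nat.card K ^ f.natDegree := by
  have : Module.Finite K (K[X] ⧸ Ideal.span {f}) := (AdjoinRoot.powerBasis hf).finite
  rw [Module.natCard_eq_pow_finrank (K := K), finrank_quotient_span_eq_natDegree]

theorem natCard_degreeLT {K : Type*} [Field K] (n : ℕ) :
    Nat.card (degreeLT K n) = Nat.card K ^ n := by
  rw [Nat.card_congr (degreeLTEquiv K n).toEquiv, Nat.card_fun, Nat.card_fin]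

instance finite_degreeLT {K : Type*} [Field K] [Finite K] (n : ℕ) : Finite (degreeLT K n) :=
  Finite.of_equiv _ (degreeLTEquiv K n).symm.toEquiv

/-- Chinese remainder theorem with representatives of small degree. -/
theorem exists_mem_degreeLT_forall_mk_eq {K ι : Type*} [Field K] [Fintype ι] {m : ι → K[X]}
    (hm : ∀ i, m i ≠ 0) (hcop : Pairwise (Function.onFun IsCoprime m)) {n : ℕ}
    (hn : ∑ i, (m i).natDegree ≤ n) (x : ∀ i, K[X] ⧸ Ideal.span {m i}) :
    ∃ R ∈ degreeLT K n, ∀ i, Ideal.Quotient.mk (Ideal.span {m i}) R = x i := by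
  obtain ⟨r, hr⟩ := Ideal.pi_quotient_surjective (I := fun i ↦ Ideal.span {m i})
    (fun i j hij ↦ (Ideal.isCoprime_span_singleton_iff _ _).2 (hcop hij)) x
  have h0 : ∏ i, m i ≠ 0 := Finset.prod_ne_zero_iff.2 fun i _ ↦ hm i
  refine ⟨r % ∏ i, m i, ?_, fun i ↦ ?_⟩
  · rw [mem_degreeLT]
    refine (EuclideanDomain.mod_lt r h0).trans_le ?_
    rw [degree_eq_natDegree h0, natDegree_prod _ _ fun i _ ↦ hm i]
    exact_mod_cast hn
  · rw [← hr i, Ideal.Quotient.mk_eq_mk_iff_sub_mem, Ideal.mem_span_singleton]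
    refine (Finset.dvd_prod_of_mem m (Finset.mem_univ i)).trans ?_
    rw [EuclideanDomain.mod_eq_sub_mul_div]
    exact ⟨-(r / ∏ i, m i), by ring⟩

theorem ncard_degreeLT_forall_not_dvd_sub {K ι : Type*} [Field K] [Finite K] [Fintype ι]
    {m : ι → K[X]} (c : ι → K[X]) (hm : ∀ i, m i ≠ 0)
    (hcop : Pairwise (Function.onFun IsCoprime m)) {n : ℕ} (hn : ∑ i, (m i).natDegree ≤ n) :
    ({R : degreeLT K n | ∀ i, ¬ m i ∣ R - c i}.ncard : ℝ) =
      (Nat.card K : ℝ) ^ n * ∏ i, (1 - ((Nat.card K : ℝ) ^ (m i).natDegree)⁻¹) := by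
  let f : degreeLT K n →+ ∀ i, K[X] ⧸ Ideal.span {m i} :=
    (AddMonoidHom.pi fun i ↦ (Ideal.Quotient.mk (Ideal.span {m i})).toAddMonoidHom).comp
      (degreeLT K n).toAddSubgroup.subtype
  have hf : Function.Surjective f := fun x ↦
    have ⟨R, hR, h⟩ := exists_mem_degreeLT_forall_mk_eq hm hcop hn x
    ⟨⟨R, hR⟩, _root_.funext h⟩
  have hq : (Nat.card K : ℝ) ≠ 0 := by exact_mod_cast Nat.card_pos.ne'
  have hfin (i : ι) : Finite (K[X] ⧸ Ideal.span {m i}) :=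
    Nat.finite_of_card_ne_zero (by
      rw [natCard_quotient_span_singleton (hm i)]; exact pow_ne_zero _ Nat.card_pos.ne')
  have key := f.card_mul_ncard_preimage hf
    (Set.univ.pi fun i ↦ {Ideal.Quotient.mk (Ideal.span {m i}) (c i)}ᶜ)
  have hpre : f ⁻¹' (Set.univ.pi fun i ↦ {Ideal.Quotient.mk (Ideal.span {m i}) (c i)}ᶜ) =
      {R : degreeLT K n | ∀ i, ¬ m i ∣ R - c i} := by
    ext R
    simp only [Set.mem_preimage, Set.mem_univ_pi, Set.mem_compl_iff, Set.mem_singleton_iff,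
      Set.mem_ofPred_eq, ← Ideal.mem_span_singleton, ← Ideal.Quotient.mk_eq_mk_iff_sub_mem]
    rfl
  have hcard : ((Set.univ.pi fun i ↦ {Ideal.Quotient.mk (Ideal.span {m i}) (c i)}ᶜ).ncard : ℝ) =
      ∏ i, ((Nat.card K : ℝ) ^ (m i).natDegree - 1) := by
    rw [← Nat.card_coe_set_eq, Nat.card_congr (Equiv.Set.univPi _), Nat.card_pi, Nat.cast_prod]
    refine Finset.prod_congr rfl fun i _ ↦ ?_
    rw [Nat.card_coe_set_eq, eq_sub_iff_add_eq']
    have := Set.ncard_add_ncard_compl {Ideal.Quotient.mk (Ideal.span {m i}) (c i)}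
    rw [Set.ncard_singleton, natCard_quotient_span_singleton (hm i)] at this
    exact_mod_cast this
  rw [hpre, Nat.card_pi, natCard_degreeLT] at key
  simp only [natCard_quotient_span_singleton (hm _)] at key
  have key' := congrArg (Nat.cast : ℕ → ℝ) key
  push_cast at key'
  rw [hcard] at key'
  have hprod : ∏ i, (Nat.card K : ℝ) ^ (m i).natDegree ≠ 0 :=
    Finset.prod_ne_zero_iff.2 fun i _ ↦ pow_ne_zero _ hq
  rw [← mul_right_inj' hprod, key', mul_left_comm, ← Finset.prod_mul_distrib]
  congr 1
  refine Finset.prod_congr rfl fun i _ ↦ ?_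
  rw [mul_sub, mul_one, mul_inv_cancel₀ (pow_ne_zero _ hq)]

theorem isCoprime_of_monic_of_irreducible {K : Type*} [Field K] {P Q : K[X]} (hP : P.Monic)
    (hQ : Q.Monic) (hPi : Irreducible P) (hQi : Irreducible Q) (h : P ≠ Q) : IsCoprime P Q :=
  hPi.coprime_iff_not_dvd.2 fun hd ↦
    h (eq_of_monic_of_associated hP hQ (hPi.associated_of_dvd hQi hd))

theorem finite_setOf_natDegree_le {K : Type*} [Field K] [Finite K] (n : ℕ) :
    {P : K[X] | P.natDegree ≤ n}.Finite := by
  refine (Set.finite_coe_iff.1 (finite_degreeLT (n + 1))).subset fun P hP ↦ ?_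
  rw [SetLike.mem_coe, mem_degreeLT]
  exact degree_le_natDegree.trans_lt (by exact_mod_cast Nat.lt_succ_of_le hP)

theorem ncard_monic_irreducible_mul_le {K : Type*} [Field K] [Finite K] {d : ℕ} (hd : d ≠ 0) :
    {P : K[X] | P.Monic ∧ Irreducible P ∧ P.natDegree = d}.ncard * d ≤ Nat.card K ^ d := by
  have hfin : {P : K[X] | P.Monic ∧ Irreducible P ∧ P.natDegree = d}.Finite :=
    (finite_setOf_natDegree_le d).subset fun P hP ↦ hP.2.2.le
  have hmem {P : K[X]} (hP : P ∈ hfin.toFinset) :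
      P.Monic ∧ Irreducible P ∧ P.natDegree = d := by simpa using hP
  have hdvd : ∏ P ∈ hfin.toFinset, P ∣ (X ^ Nat.card K ^ d - X : K[X]) := by
    refine Finset.prod_dvd_of_coprime (fun P hP Q hQ hPQ ↦ ?_) fun P hP ↦ ?_
    · exact isCoprime_of_monic_of_irreducible (hmem hP).1 (hmem hQ).1 (hmem hP).2.1
        (hmem hQ).2.1 hPQ
    · exact (hmem hP).2.1.natDegree_dvd_iff_dvd_X_pow_card_pow_sub_X.1 (hmem hP).2.2.dvd
  have hle := natDegree_le_of_dvd hdvd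
    (FiniteField.X_pow_card_pow_sub_X_ne_zero K hd Finite.one_lt_card)
  rwa [FiniteField.X_pow_card_pow_sub_X_natDegree_eq K hd Finite.one_lt_card,
    natDegree_prod _ _ fun P hP ↦ (hmem hP).1.ne_zero,
    Finset.sum_const_nat fun P hP ↦ (hmem hP).2.2, ← Set.ncard_eq_toFinset_card _ hfin] at hle

/-- Index set of the sieve: the monic irreducible polynomials of degree at most `ℓ`. -/
noncomputable def monicIrreducibles (K : Type*) [Field K] [Finite K] (ℓ : ℕ) : Finset K[X] :=
  Set.Finite.toFinset (s := {P : K[X] | P.Monic ∧ Irreducible P ∧ P.natDegree ≤ ℓ})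
    ((finite_setOf_natDegree_le ℓ).subset fun _ hP ↦ hP.2.2)

theorem mem_monicIrreducibles {K : Type*} [Field K] [Finite K] {ℓ : ℕ} {P : K[X]} :
    P ∈ monicIrreducibles K ℓ ↔ P.Monic ∧ Irreducible P ∧ P.natDegree ≤ ℓ := by
  simp [monicIrreducibles]

theorem natDegree_mem_Icc_of_mem_monicIrreducibles {K : Type*} [Field K] [Finite K] {ℓ : ℕ}
    {P : K[X]} (hP : P ∈ monicIrreducibles K ℓ) : P.natDegree ∈ Finset.Icc 1 ℓ :=
  have hP := mem_monicIrreducibles.1 hP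
  Finset.mem_Icc.2 ⟨hP.2.1.natDegree_pos, hP.2.2⟩

theorem card_filter_monicIrreducibles {K : Type*} [Field K] [Finite K] {ℓ d : ℕ} (hd : d ≤ ℓ) :
    ((monicIrreducibles K ℓ).filter fun P ↦ P.natDegree = d).card =
      {P : K[X] | P.Monic ∧ Irreducible P ∧ P.natDegree = d}.ncard := by
  rw [← Set.ncard_coe_finset]
  congr 1
  ext P
  simp only [Finset.coe_filter, mem_monicIrreducibles, Set.mem_ofPred_eq]
  exact ⟨fun h ↦ ⟨h.1.1, h.1.2.1, h.2⟩, fun h ↦ ⟨⟨h.1, h.2.1, h.2.2.trans_le hd⟩, h.2.2⟩⟩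

theorem prod_monicIrreducibles {K M : Type*} [Field K] [Finite K] [CommMonoid M] (ℓ : ℕ)
    (g : ℕ → M) :
    ∏ P ∈ monicIrreducibles K ℓ, g P.natDegree =
      ∏ d ∈ Finset.Icc 1 ℓ,
        g d ^ {P : K[X] | P.Monic ∧ Irreducible P ∧ P.natDegree = d}.ncard := by
  rw [← Finset.prod_fiberwise_of_maps_to fun _ ↦ natDegree_mem_Icc_of_mem_monicIrreducibles]
  refine Finset.prod_congr rfl fun d hd ↦ ?_
  rw [Finset.prod_congr rfl fun P hP ↦ by rw [(Finset.mem_filter.1 hP).2],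
    Finset.prod_const, card_filter_monicIrreducibles (Finset.mem_Icc.1 hd).2]

theorem sum_natDegree_monicIrreducibles_le (K : Type*) [Field K] [Finite K] (ℓ : ℕ) :
    ∑ P ∈ monicIrreducibles K ℓ, P.natDegree ≤ Nat.card K ^ (ℓ + 1) := by
  rw [← Finset.sum_fiberwise_of_maps_to fun _ ↦ natDegree_mem_Icc_of_mem_monicIrreducibles]
  calc _ ≤ ∑ d ∈ Finset.Icc 1 ℓ, Nat.card K ^ d := Finset.sum_le_sum fun d hd ↦ by
        rw [Finset.sum_const_nat fun P hP ↦ (Finset.mem_filter.1 hP).2,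
          card_filter_monicIrreducibles (Finset.mem_Icc.1 hd).2]
        exact ncard_monic_irreducible_mul_le (Nat.one_le_iff_ne_zero.1 (Finset.mem_Icc.1 hd).1)
    _ ≤ Nat.card K ^ (ℓ + 1) :=
        (Nat.geomSum_lt (n := ℓ + 1) Finite.one_lt_card fun d hd ↦
          Nat.lt_succ_of_le (Finset.mem_Icc.1 hd).2).le

end Polynomial

theorem Real.pow_mul_le_of_le_log_div_log_sub_one {q k h ℓ : ℕ} (hq : 1 < q) (hk : 0 < k)
    (hh : 0 < h) (hℓ : (ℓ : ℝ) ≤ Real.log ((h : ℝ) / k) / Real.log q - 1) :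
    k * q ^ (ℓ + 1) ≤ h := by
  have hq' : (1 : ℝ) < q := by exact_mod_cast hq
  have hk' : (0 : ℝ) < k := by exact_mod_cast hk
  have hh' : (0 : ℝ) < h := by exact_mod_cast hh
  rw [le_sub_iff_add_le, le_div_iff₀ (Real.log_pos hq')] at hℓ
  have hlog : Real.log ((q : ℝ) ^ (ℓ + 1)) ≤ Real.log ((h : ℝ) / k) := by
    rw [Real.log_pow]
    exact_mod_cast hℓ
  rw [Real.log_le_log_iff (by positivity) (by positivity), le_div_iff₀' hk'] at hlog
  exact_mod_cast hlog

/-- **Lemma 3.2 (exact sieve).** Let `k ≥ 2`, `ℓ ≤ log_q(h/k) − 1`, and for each monic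
irreducible `P` of degree at most `ℓ` fix a congruence class `Q_P mod P^k`. Then the
number of polynomials in the interval `I_q(F,h)` satisfying at least one of these
congruences is exactly `q^{h+1}·(1 − ∏_P (1 − q^{−k·deg P}))`, the product running over
all monic irreducibles of degree at most `ℓ` (grouped here by degree). -/
theorem exact_sieve_count
    {Fq : Type} [Field Fq] [Fintype Fq] (q : ℕ) (hq : Fintype.card Fq = q)
    (k h ℓ : ℕ) (hk : 2 ≤ k) (hh : 0 < h) (hℓ0 : 0 < ℓ)
    (hℓ : (ℓ : ℝ) ≤ Real.log ((h : ℝ) / k) / Real.log q - 1)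
    (F : Polynomial Fq) (hF : (h : WithBot ℕ) < F.degree)
    (Qc : Polynomial Fq → Polynomial Fq) :
    ({Q : Polynomial Fq | (F - Q).degree ≤ (h : WithBot ℕ) ∧
        ∃ P : Polynomial Fq, P.Monic ∧ Irreducible P ∧ P.natDegree ≤ ℓ ∧
          P ^ k ∣ (Q - Qc P)}.ncard : ℝ)
      = (q : ℝ) ^ (h + 1) *
        (1 - ∏ d ∈ Finset.Icc 1 ℓ,
          (1 - ((q : ℝ) ^ (k * d))⁻¹) ^
            ({P : Polynomial Fq | P.Monic ∧ Irreducible P ∧ P.natDegree = d}.ncard)) := by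
  subst hq
  simp only [← Nat.card_eq_fintype_card] at hℓ ⊢
  have hsum : ∑ P : monicIrreducibles Fq ℓ, (P.1 ^ k).natDegree ≤ h + 1 := by
    simp only [natDegree_pow]
    rw [Finset.sum_coe_sort (monicIrreducibles Fq ℓ) fun P ↦ k * P.natDegree, ← Finset.mul_sum]
    calc _ ≤ k * Nat.card Fq ^ (ℓ + 1) :=
          Nat.mul_le_mul_left k (sum_natDegree_monicIrreducibles_le Fq ℓ)
      _ ≤ h := Real.pow_mul_le_of_le_log_div_log_sub_one Finite.one_lt_card (by omega) hh hℓ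
      _ ≤ h + 1 := Nat.le_succ h
  have hgood := ncard_degreeLT_forall_not_dvd_sub (fun P : monicIrreducibles Fq ℓ ↦ F - Qc P.1)
    (fun P ↦ pow_ne_zero k (mem_monicIrreducibles.1 P.2).1.ne_zero)
    (fun P Q hPQ ↦
      have hP := mem_monicIrreducibles.1 P.2
      have hQ := mem_monicIrreducibles.1 Q.2
      (isCoprime_of_monic_of_irreducible hP.1 hQ.1 hP.2.1 hQ.2.1
        (Subtype.coe_ne_coe.2 hPQ)).pow) hsum
  have hbad : {Q : Fq[X] | (F - Q).degree ≤ (h : WithBot ℕ) ∧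
      ∃ P : Fq[X], P.Monic ∧ Irreducible P ∧ P.natDegree ≤ ℓ ∧ P ^ k ∣ (Q - Qc P)} =
      (fun R : degreeLT Fq (h + 1) ↦ F - R.1) '' {R : degreeLT Fq (h + 1) |
        ∀ P : monicIrreducibles Fq ℓ, ¬ P.1 ^ k ∣ R.1 - (F - Qc P.1)}ᶜ := by
    have hdeg (R : Fq[X]) : R.degree ≤ (h : WithBot ℕ) ↔ R ∈ degreeLT Fq (h + 1) := by
      rw [degreeLT_succ_eq_degreeLE, mem_degreeLE]
    have hneg (Q P : Fq[X]) : P ^ k ∣ Q - Qc P ↔ P ^ k ∣ F - Q - (F - Qc P) := by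
      rw [← dvd_neg]
      ring_nf
    ext Q
    simp only [Set.mem_ofPred_eq, Set.mem_image, Set.mem_compl_iff, not_forall, not_not]
    constructor
    · rintro ⟨hQ, P, hP, hPi, hPd, hdvd⟩
      exact ⟨⟨F - Q, (hdeg _).1 hQ⟩, ⟨⟨P, mem_monicIrreducibles.2 ⟨hP, hPi, hPd⟩⟩,
        (hneg Q P).1 hdvd⟩, sub_sub_cancel F Q⟩
    · rintro ⟨R, ⟨P, hdvd⟩, rfl⟩
      have hP := mem_monicIrreducibles.1 P.2
      refine ⟨?_, P.1, hP.1, hP.2.1, hP.2.2, (hneg _ _).2 ?_⟩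
      · rw [sub_sub_cancel, hdeg]
        exact R.2
      · rwa [sub_sub_cancel]
  rw [hbad, Set.ncard_image_of_injective _ fun R S hRS ↦ Subtype.ext (sub_right_injective hRS)]
  have htotal := congrArg (Nat.cast : ℕ → ℝ) (Set.ncard_add_ncard_compl {R : degreeLT Fq (h + 1) |
    ∀ P : monicIrreducibles Fq ℓ, ¬ P.1 ^ k ∣ R.1 - (F - Qc P.1)})
  rw [natCard_degreeLT, Nat.cast_add, hgood] at htotal
  simp only [natDegree_pow] at htotal
  rw [Finset.prod_coe_sort (monicIrreducibles Fq ℓ)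
    fun P ↦ 1 - ((Nat.card Fq : ℝ) ^ (k * P.natDegree))⁻¹,
    prod_monicIrreducibles ℓ fun d ↦ 1 - ((Nat.card Fq : ℝ) ^ (k * d))⁻¹] at htotal
  push_cast at htotal
  linarith
end

section
/- Let F_q be a finite field with q elements of characteristic p, let k ≥ 2, let F ∈ F_q[x] be monic of degree n, let h be an integer with 0 < h < n, and suppose h < d ≤ n/k. Let S_q(d) be the set of monic polynomials G of degree d such that G^k·A ∈ I_q(F,h) for some monic polynomial A. Let r be the least positive integer such that p does not divide the binomial coefficient C(k,r). If G, H ∈ S_q(d) with G ≠ H, then: if r < k, one has deg(G−H) ≥ ((k+r)d − n)/r; and if r = k, one has either deg(G−H) ≥ (2k·d − n)/k or deg(G−H) ≤ (h + k·d − n)/k. -/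
open Polynomial

/-- If `deg (G - H) < deg H` and `r` is the least positive index with `p ∤ C(k,r)`, then the
term of index `r` dominates the binomial expansion of `G ^ k - H ^ k`. -/
theorem degree_pow_sub_pow_of_least_choose {K : Type*} [Field K] {p k r : ℕ} [CharP K p]
    (hr0 : 0 < r) (hrk : r ≤ k) (hrnd : ¬ p ∣ Nat.choose k r)
    (hrmin : ∀ s : ℕ, 0 < s → s < r → p ∣ Nat.choose k s)
    {G H : K[X]} (hGH : G ≠ H) (hlt : (G - H).natDegree < H.natDegree) :
    (G ^ k - H ^ k).degree =
      ((r * (G - H).natDegree + (k - r) * H.natDegree : ℕ) : WithBot ℕ) := by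
  set D := G - H with hD
  have hD0 : D ≠ 0 := sub_ne_zero.mpr hGH
  have hH0 : H ≠ 0 := by rintro rfl; simp at hlt
  set f : ℕ → K[X] := fun s => D ^ s * H ^ (k - s) * (k.choose s : K[X]) with hf
  have hsum : G ^ k - H ^ k = f r + ∑ s ∈ ((Finset.range (k + 1)).erase 0).erase r, f s := by
    have hGD : G = D + H := by rw [hD]; ring
    rw [Finset.add_sum_erase _ f (by simp; omega), Finset.sum_erase_eq_sub (by simp), hGD, add_pow]
    simp [hf]
  have hcast : ((k.choose r : ℕ) : K) ≠ 0 := by rwa [Ne, CharP.cast_eq_zero_iff K p]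
  have hfr : (f r).degree = ((r * D.natDegree + (k - r) * H.natDegree : ℕ) : WithBot ℕ) := by
    have hC : (k.choose r : K[X]) = C ((k.choose r : ℕ) : K) := by simp
    simp only [hf]
    rw [hC, degree_mul_C hcast, degree_eq_natDegree (mul_ne_zero (pow_ne_zero _ hD0)
      (pow_ne_zero _ hH0)), natDegree_mul (pow_ne_zero _ hD0) (pow_ne_zero _ hH0),
      natDegree_pow, natDegree_pow]
  have hrest : (∑ s ∈ ((Finset.range (k + 1)).erase 0).erase r, f s).degree < (f r).degree := by
    rw [hfr, ← mem_degreeLT]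
    refine Submodule.sum_mem _ fun s hs => ?_
    simp only [Finset.mem_erase, Finset.mem_range] at hs
    obtain ⟨hsr, hs0, hsk⟩ := hs
    rw [mem_degreeLT]
    rcases lt_or_gt_of_ne hsr with h | h
    · have hz : (k.choose s : K[X]) = 0 :=
        (CharP.cast_eq_zero_iff K[X] p _).mpr (hrmin s (by omega) h)
      simp only [hf, hz, mul_zero, degree_zero]
      exact WithBot.bot_lt_coe _
    · have hle : (f s).natDegree ≤ s * D.natDegree + (k - s) * H.natDegree := by
        simp only [hf]
        refine (natDegree_mul_le).trans ?_
        rw [natDegree_natCast, add_zero]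
        exact natDegree_mul_le.trans (add_le_add natDegree_pow_le natDegree_pow_le)
      refine lt_of_le_of_lt (degree_le_of_natDegree_le hle) ?_
      rw [Nat.cast_withBot, Nat.cast_withBot, WithBot.coe_lt_coe]
      obtain ⟨t, rfl⟩ := Nat.exists_eq_add_of_lt h
      obtain ⟨u, rfl⟩ := Nat.exists_eq_add_of_le (Nat.lt_succ_iff.mp hsk)
      have e1 : r + t + 1 + u - (r + t + 1) = u := by omega
      have e2 : r + t + 1 + u - r = t + 1 + u := by omega
      rw [e1, e2]
      nlinarith
  rw [hsum, degree_add_eq_left_of_degree_lt hrest, hfr]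

/-- If `F` and `G ^ k * A` are close and `F`, `G` are monic, then the degree of the cofactor `A`
is determined by the degrees of `F` and `G`. -/
theorem natDegree_cofactor_of_degree_sub_le {K : Type*} [Field K] {k h : ℕ} {F G A : K[X]}
    (hG : G.Monic) (hA : A.Monic) (hF : h < F.natDegree)
    (hFA : (F - G ^ k * A).degree ≤ (h : WithBot ℕ)) :
    k * G.natDegree + A.natDegree = F.natDegree := by
  have hF0 : F ≠ 0 := by rintro rfl; simp at hF
  have hlt : (F - G ^ k * A).degree < F.degree :=
    hFA.trans_lt (by rw [degree_eq_natDegree hF0]; exact_mod_cast hF)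
  have hdeg := natDegree_eq_of_degree_eq (degree_sub_eq_left_of_degree_lt hlt)
  rw [sub_sub_cancel, (hG.pow k).natDegree_mul hA, hG.natDegree_pow] at hdeg
  exact hdeg

/-- Either the cofactors agree and `G - H` has small degree, or they differ and `G - H` has
large degree. -/
theorem natDegree_sub_dichotomy_of_pow_mul_close {K : Type*} [Field K] {p k r h d m : ℕ}
    [CharP K p] (hk : 0 < k) (hhd : h < d)
    (hr0 : 0 < r) (hrk : r ≤ k) (hrnd : ¬ p ∣ Nat.choose k r)
    (hrmin : ∀ s : ℕ, 0 < s → s < r → p ∣ Nat.choose k s)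
    {G H A B : K[X]} (hG : G.Monic) (hH : H.Monic) (hGd : G.natDegree = d)
    (hHd : H.natDegree = d) (hGH : G ≠ H) (hA : A ≠ 0) (hAm : A.natDegree = m)
    (hclose : (G ^ k * A - H ^ k * B).degree ≤ (h : WithBot ℕ)) :
    m + r * (G - H).natDegree + (k - r) * d ≤ h ∨
      k * d ≤ m + r * (G - H).natDegree + (k - r) * d := by
  have hlt : (G - H).natDegree < H.natDegree := by
    rw [hHd]
    refine (natDegree_lt_iff_degree_lt (sub_ne_zero.mpr hGH)).mpr ?_
    have hdeg : G.degree = H.degree := by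
      rw [degree_eq_natDegree hG.ne_zero, degree_eq_natDegree hH.ne_zero, hGd, hHd]
    have := degree_sub_lt_left hdeg hG.ne_zero (by rw [hG.leadingCoeff, hH.leadingCoeff])
    rwa [degree_eq_natDegree hG.ne_zero, hGd] at this
  have hpow := degree_pow_sub_pow_of_least_choose hr0 hrk hrnd hrmin hGH hlt
  have hprod : (A * (G ^ k - H ^ k)).degree =
      ((m + r * (G - H).natDegree + (k - r) * d : ℕ) : WithBot ℕ) := by
    rw [degree_mul, hpow, degree_eq_natDegree hA, hAm, hHd]
    push_cast
    ring
  have hsplit : G ^ k * A - H ^ k * B = A * (G ^ k - H ^ k) + H ^ k * (A - B) := by ring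
  by_cases hAB : A = B
  · left
    rw [hsplit, hAB, sub_self, mul_zero, add_zero, ← hAB, hprod] at hclose
    exact_mod_cast hclose
  · right
    by_contra! hcon
    have hge : ((k * d : ℕ) : WithBot ℕ) ≤ (H ^ k * (A - B)).degree := by
      have hne := mul_ne_zero (pow_ne_zero k hH.ne_zero) (sub_ne_zero.mpr hAB)
      rw [degree_eq_natDegree hne, natDegree_mul (pow_ne_zero k hH.ne_zero)
        (sub_ne_zero.mpr hAB), natDegree_pow, hHd]
      exact_mod_cast Nat.le_add_right _ _
    have hdom : (A * (G ^ k - H ^ k)).degree < (H ^ k * (A - B)).degree := by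
      rw [hprod]
      exact lt_of_lt_of_le (by exact_mod_cast hcon) hge
    rw [hsplit, degree_add_eq_right_of_degree_lt hdom] at hclose
    have hle : k * d ≤ h := by exact_mod_cast hge.trans hclose
    have := Nat.le_mul_of_pos_left d hk
    omega

/-- **Proposition 5.1.** Suppose `h < d ≤ n/k` and `G, H ∈ S_q(d)` with `G ≠ H`.
Let `r` be the least positive integer with `p ∤ C(k,r)`. If `r < k` then
`deg(G−H) ≥ ((k+r)d − n)/r`; if `r = k` then either `deg(G−H) ≥ (2kd − n)/k` or
`deg(G−H) ≤ (h + kd − n)/k`. -/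
theorem spacing_in_Sqd
    {Fq : Type} [Field Fq] [Fintype Fq] (q p k n h d r : ℕ) [CharP Fq p]
    (hq : Fintype.card Fq = q) (hk : 2 ≤ k)
    (F : Polynomial Fq) (hF : F.Monic) (hFdeg : F.natDegree = n)
    (hh0 : 0 < h) (hhn : h < n) (hhd : h < d) (hdn : (d : ℝ) ≤ (n : ℝ) / k)
    (hr0 : 0 < r) (hrnd : ¬ p ∣ Nat.choose k r)
    (hrmin : ∀ s : ℕ, 0 < s → s < r → p ∣ Nat.choose k s)
    (G H : Polynomial Fq)
    (hG : G.Monic ∧ G.natDegree = d ∧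
      ∃ A : Polynomial Fq, A.Monic ∧ (F - G ^ k * A).degree ≤ (h : WithBot ℕ))
    (hH : H.Monic ∧ H.natDegree = d ∧
      ∃ A : Polynomial Fq, A.Monic ∧ (F - H ^ k * A).degree ≤ (h : WithBot ℕ))
    (hGH : G ≠ H) :
    (r < k → (((k : ℝ) + r) * d - n) / r ≤ ((G - H).natDegree : ℝ)) ∧
    (r = k → ((2 * (k : ℝ) * d - n) / k ≤ ((G - H).natDegree : ℝ) ∨
      ((G - H).natDegree : ℝ) ≤ ((h : ℝ) + k * d - n) / k)) := by
  obtain ⟨hGm, hGd, A, hA, hFA⟩ := hG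
  obtain ⟨hHm, hHd, B, hB, hFB⟩ := hH
  have hAm := natDegree_cofactor_of_degree_sub_le hGm hA (hFdeg ▸ hhn) hFA
  rw [hGd, hFdeg] at hAm
  have hclose : (G ^ k * A - H ^ k * B).degree ≤ (h : WithBot ℕ) := by
    have hsplit : G ^ k * A - H ^ k * B = (F - H ^ k * B) - (F - G ^ k * A) := by ring
    rw [hsplit]
    exact (degree_sub_le _ _).trans (max_le hFB hFA)
  have hAmR : (k : ℝ) * d + A.natDegree = n := by exact_mod_cast hAm
  have hrR : (0 : ℝ) < r := by exact_mod_cast hr0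
  have key := fun hrk : r ≤ k => natDegree_sub_dichotomy_of_pow_mul_close (by omega) hhd hr0 hrk
    hrnd hrmin hGm hHm hGd hHd hGH hA.ne_zero rfl hclose
  constructor
  · intro hrk
    rw [div_le_iff₀ hrR]
    rcases key hrk.le with hsmall | hlarge
    · have := Nat.le_mul_of_pos_left d (Nat.sub_pos_of_lt hrk)
      omega
    · have hlargeR : (k : ℝ) * d ≤ A.natDegree + r * (G - H).natDegree + (k - r) * d := by
        rw [← Nat.cast_sub hrk.le]
        exact_mod_cast hlarge
      linarith
  · rintro rfl
    rw [div_le_iff₀ hrR, le_div_iff₀ hrR]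
    have key' := key le_rfl
    rw [Nat.sub_self, zero_mul, add_zero] at key'
    rcases key' with hsmall | hlarge
    · right
      have hsmallR : (A.natDegree : ℝ) + r * (G - H).natDegree ≤ h := by exact_mod_cast hsmall
      linarith
    · left
      have hlargeR : (r : ℝ) * d ≤ A.natDegree + r * (G - H).natDegree := by
        exact_mod_cast hlarge
      linarith
end

section
/- Let F_q be a finite field with q elements of characteristic p, let k ≥ 2, let F ∈ F_q[x] be monic of degree n, and let h be an integer with 0 < h < n. Let S_q(d) be the set of monic polynomials G of degree d such that G^k·A ∈ I_q(F,h) for some monic polynomial A. Suppose the least positive integer r with p ∤ C(k,r) equals k (i.e., p divides C(k,r) for all 1 ≤ r < k), and suppose h < d, (n−h)/k ≤ d ≤ n/k. Then |S_q(d)| ≤ q^{h/k + 1}. -/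
open Polynomial

/-- The `k`-th power map as a ring homomorphism, when all the intermediate binomial coefficients
`C(k, s)` vanish in the characteristic. -/
def powRingHom (R : Type*) [CommRing R] (p k : ℕ) [CharP R p] (hk : k ≠ 0)
    (hrk : ∀ s : ℕ, 0 < s → s < k → p ∣ Nat.choose k s) : R →+* R where
  toFun x := x ^ k
  map_one' := one_pow k
  map_mul' x y := mul_pow x y k
  map_zero' := zero_pow hk
  map_add' x y := by
    obtain ⟨l, rfl⟩ := Nat.exists_eq_succ_of_ne_zero hk
    rw [add_pow, Finset.sum_range_succ, Finset.sum_range_succ', Finset.sum_eq_zero]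
    · simp [add_comm]
    · intro s hs
      have hs : s < l := Finset.mem_range.1 hs
      rw [(CharP.cast_eq_zero_iff R p _).2 (hrk (s + 1) (by omega) (by omega)), mul_zero]

theorem expand_map_powRingHom {R : Type*} [CommRing R] (p k : ℕ) [CharP R p] (hk : k ≠ 0)
    (hrk : ∀ s : ℕ, 0 < s → s < k → p ∣ Nat.choose k s) (G : R[X]) :
    expand R k (G.map (powRingHom R p k hk hrk)) = G ^ k := by
  induction G using Polynomial.induction_on' with
  | add f g hf hg =>
    rw [Polynomial.map_add, map_add, hf, hg]
    exact (map_add (powRingHom R[X] p k hk hrk) f g).symm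
  | monomial j a =>
    rw [map_monomial, expand_monomial, monomial_pow, mul_comm]
    rfl

/-- The polynomial whose `j`-th coefficient is the coefficient of `P` at `j * k + i`. -/
noncomputable def residueSection {R : Type*} [CommRing R] (k i : ℕ) (P : R[X]) : R[X] :=
  divX (contract k (X ^ (k - i) * P))

theorem coeff_residueSection {R : Type*} [CommRing R] {k i : ℕ} (hi : i < k) (P : R[X]) (j : ℕ) :
    (residueSection k i P).coeff j = P.coeff (j * k + i) := by
  rw [residueSection, coeff_divX, coeff_contract (by omega),
    show (j + 1) * k = j * k + i + (k - i) by rw [add_mul]; omega, coeff_X_pow_mul]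

theorem X_mul_residueSection {R : Type*} [CommRing R] {k i : ℕ} (hi : i < k) (P : R[X]) :
    X * residueSection k i P = contract k (X ^ (k - i) * P) := by
  have h0 : (contract k (X ^ (k - i) * P)).coeff 0 = 0 := by
    rw [coeff_contract (by omega), zero_mul, coeff_X_pow_mul', if_neg (by omega)]
  conv_rhs => rw [← X_mul_divX_add (contract k (X ^ (k - i) * P)), h0, C_0, add_zero]
  rfl

theorem residueSection_mul_expand {R : Type*} [CommRing R] {k i : ℕ} (hi : i < k) (P g : R[X]) :
    residueSection k i (P * expand R k g) = residueSection k i P * g := by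
  apply isRegular_X.left
  beta_reduce
  rw [X_mul_residueSection hi, ← mul_assoc, contract_mul_expand (by omega), ← mul_assoc,
    X_mul_residueSection hi]

theorem monic_residueSection {R : Type*} [CommRing R] {k i m : ℕ} (hi : i < k)
    {A : R[X]} (hA : A.Monic) (hdeg : A.natDegree = m * k + i) :
    (residueSection k i A).natDegree ≤ m ∧ (residueSection k i A).coeff m = 1 := by
  constructor
  · rw [natDegree_le_iff_coeff_eq_zero]
    intro j hj
    rw [coeff_residueSection hi]
    apply coeff_eq_zero_of_natDegree_lt
    have := Nat.mul_lt_mul_of_pos_right hj (show 0 < k by omega)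
    omega
  · rw [coeff_residueSection hi, ← hdeg]
    exact hA

theorem natDegree_cofactor_s11 {R : Type*} [CommRing R] [Nontrivial R] {F G A : R[X]} {k h : ℕ}
    (hF : F.Monic) (hh : h < F.natDegree) (hG : G.Monic) (hA : A.Monic)
    (hFA : (F - G ^ k * A).degree ≤ (h : WithBot ℕ)) :
    k * G.natDegree + A.natDegree = F.natDegree := by
  rw [← hG.natDegree_pow, ← (hG.pow k).natDegree_mul hA]
  have hlt : (F - G ^ k * A).degree < F.degree := by
    rw [degree_eq_natDegree hF.ne_zero]
    exact hFA.trans_lt (by exact_mod_cast hh)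
  have hdeg := degree_sub_eq_left_of_degree_lt hlt
  rw [sub_sub_cancel] at hdeg
  exact natDegree_eq_of_degree_eq hdeg

/-- **Lemma 5.2.** In the notation of Proposition 5.1, if `r = k` (i.e. `p ∣ C(k,s)` for
all `1 ≤ s < k`) and `(n−h)/k ≤ d ≤ n/k` with `h < d`, then `|S_q(d)| ≤ q^{h/k + 1}`. -/
theorem card_Sqd_r_eq_k
    {Fq : Type} [Field Fq] [Fintype Fq] (q p k n h d : ℕ) [CharP Fq p]
    (hq : Fintype.card Fq = q) (hk : 2 ≤ k)
    (F : Polynomial Fq) (hF : F.Monic) (hFdeg : F.natDegree = n)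
    (hh0 : 0 < h) (hhn : h < n)
    (hrk : ∀ s : ℕ, 0 < s → s < k → p ∣ Nat.choose k s)
    (hhd : h < d) (hd1 : ((n : ℝ) - h) / k ≤ (d : ℝ)) (hd2 : (d : ℝ) ≤ (n : ℝ) / k) :
    ({G : Polynomial Fq | G.Monic ∧ G.natDegree = d ∧
        ∃ A : Polynomial Fq, A.Monic ∧
          (F - G ^ k * A).degree ≤ (h : WithBot ℕ)}.ncard : ℝ)
      ≤ (q : ℝ) ^ ((h : ℝ) / k + 1) := by
  have hk0 : 0 < k := by omega
  have hkR : (0 : ℝ) < k := by exact_mod_cast hk0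
  have hnk : n ≤ h + d * k := by
    rw [div_le_iff₀ hkR] at hd1
    have : (n : ℝ) ≤ h + d * k := by linarith
    exact_mod_cast this
  have hdn : d ≤ n / k := by
    rw [le_div_iff₀ hkR] at hd2
    rw [Nat.le_div_iff_mul_le hk0]
    exact_mod_cast hd2
  obtain ⟨m, hm⟩ := Nat.exists_eq_add_of_le hdn
  have hmH : m ≤ h / k := by
    have := Nat.div_le_div_right (c := k) hnk
    rw [Nat.add_mul_div_right _ _ hk0] at this
    omega
  obtain ⟨l, hl⟩ := Nat.exists_eq_add_of_le hmH
  have hi : n % k < k := Nat.mod_lt _ hk0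
  have hn : n = d * k + (m * k + n % k) := by
    have := Nat.div_add_mod n k
    rw [hm] at this
    linarith
  set T := {G : Polynomial Fq | G.Monic ∧ G.natDegree = d ∧
        ∃ A : Polynomial Fq, A.Monic ∧
          (F - G ^ k * A).degree ≤ (h : WithBot ℕ)} with hT
  have hex : ∀ G : Fq[X], ∃ A : Fq[X], G ∈ T → A.Monic ∧
      (F - G ^ k * A).degree ≤ (h : WithBot ℕ) := by
    intro G
    by_cases hG : G ∈ T
    · obtain ⟨_, _, A, hA⟩ := hG
      exact ⟨A, fun _ => hA⟩
    · exact ⟨0, fun h => absurd h hG⟩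
  choose cof hcof using hex
  let φ := powRingHom Fq p k hk0.ne' hrk
  let f : Fq[X] → (Fin m → Fq) × (Fin (l + 1) → Fq) := fun G =>
    (fun j => (residueSection k (n % k) (cof G)).coeff j, fun j => G.coeff j)
  have hsec : ∀ G ∈ T, (residueSection k (n % k) (cof G)).natDegree ≤ m ∧
      (residueSection k (n % k) (cof G)).coeff m = 1 := by
    intro G hG
    obtain ⟨hA, hFA⟩ := hcof G hG
    apply monic_residueSection hi hA
    have := natDegree_cofactor_s11 hF (hFdeg ▸ hhn) hG.1 hA hFA
    rw [hFdeg, hG.2.1, mul_comm k d] at this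
    omega
  have hinj : Set.InjOn f T := by
    intro G₁ h₁ G₂ h₂ hf
    obtain ⟨hf₁, hf₂⟩ := Prod.ext_iff.1 hf
    have ha : residueSection k (n % k) (cof G₁) = residueSection k (n % k) (cof G₂) := by
      ext j
      rcases lt_trichotomy j m with hj | rfl | hj
      · exact congrFun hf₁ ⟨j, hj⟩
      · rw [(hsec G₁ h₁).2, (hsec G₂ h₂).2]
      · rw [coeff_eq_zero_of_natDegree_lt ((hsec G₁ h₁).1.trans_lt hj),
          coeff_eq_zero_of_natDegree_lt ((hsec G₂ h₂).1.trans_lt hj)]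
    have hcoeff : ∀ G ∈ T, ∀ j, h / k < j →
        (residueSection k (n % k) (cof G) * G.map φ).coeff j = F.coeff (j * k + n % k) := by
      intro G hG j hj
      rw [← residueSection_mul_expand hi, coeff_residueSection hi, expand_map_powRingHom,
        mul_comm, eq_comm, ← sub_eq_zero, ← coeff_sub]
      apply coeff_eq_zero_of_degree_lt
      refine (hcof G hG).2.trans_lt ?_
      have := (Nat.div_lt_iff_lt_mul hk0).1 hj
      exact_mod_cast this.trans_le (Nat.le_add_right _ _)
    have hdeg : (residueSection k (n % k) (cof G₁) * (G₁.map φ - G₂.map φ)).natDegree ≤ h / k := by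
      rw [natDegree_le_iff_coeff_eq_zero]
      intro j hj
      rw [mul_sub, coeff_sub, hcoeff G₁ h₁ j hj, ha, hcoeff G₂ h₂ j hj, sub_self]
    have hzero : G₁.map φ - G₂.map φ = 0 := by
      by_contra hne
      have ha0 : residueSection k (n % k) (cof G₁) ≠ 0 := by
        intro h0
        simpa [h0] using (hsec G₁ h₁).2
      rw [natDegree_mul ha0 hne] at hdeg
      have hm' : m ≤ (residueSection k (n % k) (cof G₁)).natDegree :=
        le_natDegree_of_ne_zero (by rw [(hsec G₁ h₁).2]; exact one_ne_zero)
      have hlt : (G₁.map φ - G₂.map φ).natDegree < l + 1 := by omega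
      have hc : G₁.coeff _ = G₂.coeff _ := congrFun hf₂ ⟨_, hlt⟩
      apply leadingCoeff_ne_zero.2 hne
      rw [leadingCoeff, coeff_sub, coeff_map, coeff_map, hc, sub_self]
    exact Polynomial.map_injective φ φ.injective (sub_eq_zero.1 hzero)
  have hcard : T.ncard ≤ q ^ (h / k + 1) := by
    calc T.ncard ≤ (Set.univ : Set ((Fin m → Fq) × (Fin (l + 1) → Fq))).ncard :=
          Set.ncard_le_ncard_of_injOn f (fun _ _ => Set.mem_univ _) hinj
      _ = q ^ (h / k + 1) := by
          rw [Set.ncard_univ, Nat.card_eq_fintype_card, Fintype.card_prod, Fintype.card_fun,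
            Fintype.card_fun, hq, Fintype.card_fin, Fintype.card_fin, ← pow_add, hl, add_assoc]
  have hq1 : (1 : ℝ) ≤ q := by
    rw [← hq]
    exact_mod_cast Fintype.card_pos (α := Fq)
  calc (T.ncard : ℝ) ≤ (q : ℝ) ^ (h / k + 1) := by exact_mod_cast hcard
    _ = (q : ℝ) ^ (((h / k : ℕ) : ℝ) + 1) := by rw [← Real.rpow_natCast]; push_cast; rfl
    _ ≤ (q : ℝ) ^ ((h : ℝ) / k + 1) :=
        Real.rpow_le_rpow_of_exponent_le hq1 (by gcongr; exact Nat.cast_div_le)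
end
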